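/- arXiv:1503.07056 — 2 statements merged into one kernel-verified Lean document; each statement's English description precedes it below -/
import Mathlib

section
/- For every prime power q, the projective symplectic group PSp_6(q) — that is, the quotient of the symplectic group Sp_6(q) of 6×6 matrices over the field F_q preserving a fixed nondegenerate alternating bilinear form (e.g. Mathlib's Matrix.symplecticGroup (Fin 3) F_q) by its center — is (2,3)-generated. -/
section Squarefree

open Polynomial

variable {F : Type*} [Field F]

theorem separable_quadratic {s : F} (hs : s ^ 2 ≠ 4) : (X ^ 2 - C s * X + 1 : F[X]).Separable := by
  have h : 4 - s ^ 2 ≠ 0 := sub_ne_zero.2 hs.symm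
  refine ⟨C (4 - s ^ 2)⁻¹ * 4, -C (4 - s ^ 2)⁻¹ * (2 * X - C s), ?_⟩
  have h1 : C (4 - s ^ 2)⁻¹ * (4 - C s ^ 2) = (1 : F[X]) := by
    rw [← C_pow, ← C_ofNat, ← C_sub, ← C_mul, inv_mul_cancel₀ h, C_1]
  have h2 : derivative (X ^ 2 - C s * X + 1 : F[X]) = 2 * X - C s := by
    simp; norm_num
  rw [h2]
  linear_combination h1

theorem separable_linear_mul_quadratic {s : F} (hs : s ^ 2 ≠ 4) :
    ((X - 1) * (X ^ 2 - C s * X + 1) : F[X]).Separable := by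
  have h : 2 - s ≠ 0 := fun h => hs (by linear_combination -(2 + s) * h)
  have h1 : C (2 - s)⁻¹ * (2 - C s) = (1 : F[X]) := by
    rw [← C_ofNat, ← C_sub, ← C_mul, inv_mul_cancel₀ h, C_1]
  refine separable_X_sub_C (x := (1 : F)) |>.mul (separable_quadratic hs) ?_
  exact ⟨-C (2 - s)⁻¹ * (X + 1 - C s), C (2 - s)⁻¹, by rw [C_1]; linear_combination h1⟩

theorem squarefree_linear_mul_quadratics {s t : F} (hs : s ^ 2 ≠ 4) (ht : t ^ 2 ≠ 4)
    (hst : s ≠ t) :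
    Squarefree ((X - 1) * (X ^ 2 - C s * X + 1) * (X ^ 2 - C t * X + 1) : F[X]) := by
  have h : t - s ≠ 0 := sub_ne_zero.2 hst.symm
  have h1 : C (t - s)⁻¹ * (C t - C s) = (1 : F[X]) := by
    rw [← C_sub, ← C_mul, inv_mul_cancel₀ h, C_1]
  have h2 : 2 - t ≠ 0 := fun h => ht (by linear_combination -(2 + t) * h)
  have h3 : C (2 - t)⁻¹ * (2 - C t) = (1 : F[X]) := by
    rw [← C_ofNat, ← C_sub, ← C_mul, inv_mul_cancel₀ h2, C_1]
  refine ((separable_linear_mul_quadratic hs).mul (separable_quadratic ht) ?_).squarefree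
  refine IsCoprime.mul_left ⟨-C (2 - t)⁻¹ * (X + 1 - C t), C (2 - t)⁻¹, ?_⟩
    ⟨-(X - C t) * C (t - s)⁻¹, 1 + (X - C t) * C (t - s)⁻¹, ?_⟩
  · linear_combination h3
  · linear_combination -X * (X - C t) * h1

end Squarefree

section Fields

variable {F : Type*} [Field F] [Finite F]

theorem AddSubgroup.eq_top_of_mul_mem {S : AddSubgroup F} (h1 : 1 ∈ S) {b : F}
    (hb : ∀ s ∈ S, b * s ∈ S) (htop : Subfield.closure {b} = ⊤) : S = ⊤ := by
  have := Fintype.ofFinite F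
  let M : Subfield F :=
    { carrier := {c | ∀ s ∈ S, c * s ∈ S}
      mul_mem' := fun {c d} hc hd s hs => by rw [mul_assoc]; exact hc _ (hd _ hs)
      one_mem' := fun s hs => by rwa [one_mul]
      add_mem' := fun {c d} hc hd s hs => by rw [add_mul]; exact S.add_mem (hc _ hs) (hd _ hs)
      zero_mem' := fun s hs => by rw [zero_mul]; exact S.zero_mem
      neg_mem' := fun {c} hc s hs => by rw [neg_mul]; exact S.neg_mem (hc _ hs)
      inv_mem' := fun c hc s hs => by
        have hpow (n : ℕ) : c ^ n * s ∈ S := by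
          induction n with
          | zero => simpa using hs
          | succ n ih => rw [pow_succ', mul_assoc]; exact hc _ ih
        rcases eq_or_ne c 0 with rfl | h0
        · simp [S.zero_mem]
        have h2 : Fintype.card F - 1 = (Fintype.card F - 2) + 1 := by
          have := Fintype.one_lt_card (α := F); omega
        have : c⁻¹ = c ^ (Fintype.card F - 2) := inv_eq_of_mul_eq_one_right (by
          rw [← pow_succ', ← h2, FiniteField.pow_card_sub_one_eq_one c h0])
        rw [this]
        exact hpow _ }
  have hM : M = ⊤ := top_le_iff.1 (htop ▸ Subfield.closure_le.2 (by simpa [M] using hb))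
  refine eq_top_iff.2 fun c _ => ?_
  have : c ∈ M := hM ▸ Subfield.mem_top c
  simpa using this 1 h1

theorem closure_add_inv_eq_top [CharP F 2] {t : Fˣ} (ht : ∀ u, u ∈ Subgroup.zpowers t)
    (h1 : (t : F) + (t : F)⁻¹ ≠ 1) : Subfield.closure {(t : F) + (t : F)⁻¹} = ⊤ := by
  have := Fintype.ofFinite F
  have two := CharTwo.two_eq_zero (R := F)
  set K := Subfield.closure {(t : F) + (t : F)⁻¹} with hK
  have := Fintype.ofFinite K
  have hβ : (t : F) + (t : F)⁻¹ ∈ K := Subfield.subset_closure rfl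
  obtain ⟨k, -, hk⟩ := FiniteField.card K 2
  set Q := Fintype.card K with hQ
  have hfix : ((t : F) + (t : F)⁻¹) ^ Q = (t : F) + (t : F)⁻¹ := by
    have := FiniteField.pow_card (⟨_, hβ⟩ : K)
    exact congrArg Subtype.val this
  have hord : orderOf t = Fintype.card F - 1 := by
    rw [orderOf_eq_card_of_forall_mem_zpowers ht, Nat.card_units, Nat.card_eq_fintype_card]
  have h0 : (t : F) ≠ 0 := t.ne_zero
  rw [hk, add_pow_char_pow, ← hk, inv_pow] at hfix
  have hdvd : Q ∣ Fintype.card F := by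
    rw [hQ, ← Nat.card_eq_fintype_card, ← Nat.card_eq_fintype_card]
    exact AddSubgroup.card_addSubgroup_dvd_card K.toAddSubgroup
  have hQ1 : 1 < Q := Fintype.one_lt_card
  have hQq : Fintype.card F ≤ Q → K = ⊤ := fun h => by
    have hb := (Fintype.bijective_iff_injective_and_card (Subtype.val : K → F)).2
      ⟨Subtype.val_injective, le_antisymm (Fintype.card_le_of_injective _ Subtype.val_injective) h⟩
    refine eq_top_iff.2 fun a _ => ?_
    obtain ⟨c, rfl⟩ := hb.2 a
    exact c.2
  have hmul : ((t : F) ^ Q - t) * ((t : F) ^ Q * t - 1) = 0 := by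
    field_simp at hfix
    linear_combination hfix
  rcases mul_eq_zero.1 hmul with h | h
  · have : t ^ (Q - 1) = 1 := by
      ext
      apply mul_right_cancel₀ h0
      push_cast
      rw [← pow_succ, Nat.sub_add_cancel hQ1.le, one_mul, sub_eq_zero.1 h]
    have := Nat.le_of_dvd (by omega) (orderOf_dvd_of_pow_eq_one this)
    exact hQq (by omega)
  · have : t ^ (Q + 1) = 1 := by
      ext
      push_cast
      rw [pow_succ, sub_eq_zero.1 h]
    have h2 := Nat.le_of_dvd (by omega) (orderOf_dvd_of_pow_eq_one this)
    obtain ⟨m, hm⟩ := hdvd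
    by_cases hm1 : m ≤ 1
    · exact hQq (by rw [hm]; nlinarith)
    have hQ2 : Q = 2 := by nlinarith [Nat.sub_le (Fintype.card F) 1, Nat.sub_add_cancel (Fintype.card_pos (α := F))]
    rw [hQ2] at h
    have h3 : ((t : F) - 1) * (t ^ 2 + t + 1) = 0 := by linear_combination h
    rcases mul_eq_zero.1 h3 with h3 | h3
    · have : t = 1 := Units.ext (by simpa using sub_eq_zero.1 h3)
      rw [this, orderOf_one] at hord
      nlinarith [Nat.sub_add_cancel (Fintype.card_pos (α := F))]
    · refine absurd ?_ h1
      field_simp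
      linear_combination h3 - t * two

end Fields

section Transvections

variable {F V : Type*} [Field F] [AddCommGroup V] [Module F V]

/-- `H` contains the transvection `u ↦ u + a * B v u • v`. -/
def HasTransvection (B : V →ₗ[F] V →ₗ[F] F) (H : Subgroup (V ≃ₗ[F] V)) (v : V) (a : F) : Prop :=
  ∃ g ∈ H, ∀ u, g u = u + (a * B v u) • v

variable {B : V →ₗ[F] V →ₗ[F] F} {H : Subgroup (V ≃ₗ[F] V)}

theorem HasTransvection.zero (v : V) : HasTransvection B H v 0 :=
  ⟨1, H.one_mem, fun u => by simp⟩

theorem HasTransvection.add (hB : B.IsAlt) {v : V} {a b : F} (ha : HasTransvection B H v a)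
    (hb : HasTransvection B H v b) : HasTransvection B H v (a + b) := by
  obtain ⟨g, hg, hg'⟩ := ha
  obtain ⟨h, hh, hh'⟩ := hb
  refine ⟨g * h, H.mul_mem hg hh, fun u => ?_⟩
  rw [LinearEquiv.mul_apply, hg', hh', map_add, map_smul, hB v]
  module

theorem HasTransvection.neg (hB : B.IsAlt) {v : V} {a : F} (ha : HasTransvection B H v a) :
    HasTransvection B H v (-a) := by
  obtain ⟨g, hg, hg'⟩ := ha
  refine ⟨g⁻¹, H.inv_mem hg, fun u => ?_⟩
  apply g.injective
  have : g (g⁻¹ u) = u := by rw [← LinearEquiv.mul_apply]; simp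
  rw [this, hg', map_add, map_smul, hB v]
  module

/-- The scalars `a` for which the transvection along `v` with factor `a` lies in `H`. -/
def transvectionFactors (hB : B.IsAlt) (H : Subgroup (V ≃ₗ[F] V)) (v : V) : AddSubgroup F where
  carrier := {a | HasTransvection B H v a}
  zero_mem' := .zero v
  add_mem' := .add hB
  neg_mem' := .neg hB

theorem mem_transvectionFactors (hB : B.IsAlt) {v : V} {a : F} :
    a ∈ transvectionFactors hB H v ↔ HasTransvection B H v a := Iff.rfl

theorem hasTransvection_smul_iff {v : V} {a c : F} :
    HasTransvection B H (c • v) a ↔ HasTransvection B H v (c ^ 2 * a) := by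
  have (u : V) : (a * B (c • v) u) • c • v = (c ^ 2 * a * B v u) • v := by
    rw [map_smul, LinearMap.smul_apply, smul_eq_mul]; module
  simp only [HasTransvection, this]

theorem HasTransvection.map (hH : ∀ g ∈ H, ∀ u v, B (g u) (g v) = B u v) {g : V ≃ₗ[F] V}
    (hg : g ∈ H) {v : V} {a : F} (h : HasTransvection B H v a) : HasTransvection B H (g v) a := by
  obtain ⟨t, ht, ht'⟩ := h
  refine ⟨g * t * g⁻¹, H.mul_mem (H.mul_mem hg ht) (H.inv_mem hg), fun u => ?_⟩
  have hu : g (g⁻¹ u) = u := by rw [← LinearEquiv.mul_apply]; simp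
  rw [LinearEquiv.mul_apply, LinearEquiv.mul_apply, ht', map_add, map_smul, ← hH g hg v, hu]

/-- The vectors all of whose transvections lie in `H`. -/
def IsFull (B : V →ₗ[F] V →ₗ[F] F) (H : Subgroup (V ≃ₗ[F] V)) (v : V) : Prop :=
  ∀ a, HasTransvection B H v a

theorem IsFull.smul {v : V} (h : IsFull B H v) (c : F) : IsFull B H (c • v) :=
  fun _ => hasTransvection_smul_iff.2 (h _)

theorem IsFull.map (hH : ∀ g ∈ H, ∀ u v, B (g u) (g v) = B u v) {g : V ≃ₗ[F] V}
    (hg : g ∈ H) {v : V} (h : IsFull B H v) : IsFull B H (g v) :=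
  fun a => (h a).map hH hg

theorem IsFull.of_smul {v : V} {c : F} (hc : c ≠ 0) (h : IsFull B H (c • v)) : IsFull B H v := by
  simpa [smul_smul, hc] using h.smul c⁻¹

theorem IsFull.add (hH : ∀ g ∈ H, ∀ u v, B (g u) (g v) = B u v)
    {u v : V} (hu : IsFull B H u) (hv : IsFull B H v) (h : B v u ≠ 0) : IsFull B H (u + v) := by
  obtain ⟨g, hg, hg'⟩ := hv (B v u)⁻¹
  have := hu.map hH hg
  rwa [hg', inv_mul_cancel₀ h, one_smul] at this

/-- Moving the planar component of a vector with full transvection group. -/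
theorem IsFull.move (hB : B.IsAlt) (hH : ∀ g ∈ H, ∀ u v, B (g u) (g v) = B u v)
    {e f : V} (hef : B e f = 1) (he : IsFull B H e) (hf : IsFull B H f)
    (a b c d : F) {s : V} (hs1 : B e s = 0) (hs2 : B f s = 0) (hab : a ≠ 0 ∨ b ≠ 0)
    (hcd : c ≠ 0 ∨ d ≠ 0) (h : IsFull B H (a • e + b • f + s)) :
    IsFull B H (c • e + d • f + s) := by
  have hfe : B f e = -1 := by rw [← hef, hB.neg]
  have hplane (a b : F) : IsFull B H (a • e + b • f) := by
    rcases eq_or_ne a 0 with rfl | ha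
    · simpa using hf.smul b
    rcases eq_or_ne b 0 with rfl | hb
    · simpa using he.smul a
    refine (he.smul a).add hH (hf.smul b) ?_
    simp [hfe, ha, hb]
  have step (a b c d : F) (hne : a * d - b * c ≠ 0) (h : IsFull B H (a • e + b • f + s)) :
      IsFull B H (c • e + d • f + s) := by
    have := h.add hH (hplane (c - a) (d - b)) (by
      simp [hef, hfe, hs1, hs2, hB e, hB f]
      contrapose! hne; linear_combination -hne)
    convert this using 1
    module
  by_cases hne : a * d - b * c = 0
  · -- pass through a vector independent of both
    rcases hab with ha | hb
    · have hc : c ≠ 0 := by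
        rintro rfl
        rcases hcd with hc | hd
        · exact hc rfl
        · simp [ha, hd] at hne
      exact step 0 1 c d (by simpa using hc) (step a b 0 1 (by simpa using ha) h)
    · have hd : d ≠ 0 := by
        rintro rfl
        rcases hcd with hc | hd
        · simp [hb, hc] at hne
        · exact hd rfl
      exact step 1 0 c d (by simpa using hd) (step a b 1 0 (by simpa using hb) h)
  · exact step a b c d hne h

/-- A group containing all transvections along a hyperbolic pair, together with enough further
vectors not orthogonal to the pair, contains every transvection, as soon as the components
orthogonal to the pair that occur are closed under addition. -/
theorem isFull_of_span_of_add (hB : B.IsAlt) (hBn : ∀ v, (∀ u, B v u = 0) → v = 0)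
    (hH : ∀ g ∈ H, ∀ u v, B (g u) (g v) = B u v)
    {e f : V} (hef : B e f = 1) (he : IsFull B H e) (hf : IsFull B H f)
    (hadd : ∀ s t, B e s = 0 → B f s = 0 → B e t = 0 → B f t = 0 → IsFull B H (e + s) →
      IsFull B H (e + t) → IsFull B H (e + (s + t)))
    (hspan : Submodule.span F {v | IsFull B H v ∧ (B e v ≠ 0 ∨ B f v ≠ 0)} = ⊤) (v : V) :
    IsFull B H v := by
  have hfe : B f e = -1 := by rw [← hef, hB.neg]
  have hBs (s : V) (hs1 : B e s = 0) : B s e = 0 := by rw [← hB.neg, hs1, neg_zero]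
  have hBs' (s : V) (hs1 : B f s = 0) : B s f = 0 := by rw [← hB.neg, hs1, neg_zero]
  have hmove (a b c d : F) (s : V) (hs1 : B e s = 0) (hs2 : B f s = 0) (hab : a ≠ 0 ∨ b ≠ 0)
      (hcd : c ≠ 0 ∨ d ≠ 0) (h : IsFull B H (a • e + b • f + s)) :
      IsFull B H (c • e + d • f + s) := 
    .move hB hH hef he hf a b c d hs1 hs2 hab hcd h
  -- the orthogonal components that occur form a subspace
  let R : Submodule F V :=
    { carrier := {s | B e s = 0 ∧ B f s = 0 ∧ IsFull B H (e + s)}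
      zero_mem' := by simp [he]
      smul_mem' := by
        rintro c s ⟨h1, h2, h3⟩
        refine ⟨by simp [h1], by simp [h2], ?_⟩
        rcases eq_or_ne c 0 with rfl | hc
        · simpa using he
        have := hmove c 0 1 0 (c • s) (by simp [h1]) (by simp [h2]) (.inl hc) (.inl one_ne_zero)
          (by simpa using h3.smul c)
        simpa using this
      add_mem' := by
        rintro s t ⟨h1, h2, h3⟩ ⟨h1', h2', h3'⟩
        exact ⟨by simp [h1, h1'], by simp [h2, h2'], hadd s t h1 h2 h1' h2' h3 h3'⟩ }
  have hR (s : V) (h1 : B e s = 0) (h2 : B f s = 0) : s ∈ R := by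
    have key : ∀ w : V, w - B w f • e + B w e • f ∈ R := by
      intro w
      have hw : w ∈ Submodule.span F {v | IsFull B H v ∧ (B e v ≠ 0 ∨ B f v ≠ 0)} := by
        rw [hspan]; trivial
      induction hw using Submodule.span_induction with
      | mem w hw =>
        obtain ⟨hw, hw'⟩ := hw
        have e1 : B e (w - B w f • e + B w e • f) = 0 := by
          simp [hB e, hef, ← hB.neg w e]
        have e2 : B f (w - B w f • e + B w e • f) = 0 := by
          simp [hB f, hfe, ← hB.neg w f]
        refine ⟨e1, e2, ?_⟩
        have := hmove (B w f) (-B w e) 1 0 _ e1 e2 (by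
          rw [← hB.neg w f, ← hB.neg w e] at *
          simpa [or_comm] using hw') (.inl one_ne_zero) (by convert hw using 1; module)
        simpa using this
      | zero => simp
      | add u v _ _ hu hv =>
        convert R.add_mem hu hv using 1
        simp only [map_add, LinearMap.add_apply]; module
      | smul c u _ hu =>
        convert R.smul_mem c hu using 1
        simp only [map_smul, LinearMap.smul_apply, smul_eq_mul]; module
    have := key s
    rwa [hBs s h1, hBs' s h2, zero_smul, zero_smul, sub_zero, add_zero] at this
  set s := v - B v f • e + B v e • f with hs
  have e1 : B e s = 0 := by simp [hs, hB e, hef, ← hB.neg v e]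
  have e2 : B f s = 0 := by simp [hs, hB f, hfe, ← hB.neg v f]
  by_cases hp : B v f ≠ 0 ∨ -B v e ≠ 0
  · have := hmove 1 0 (B v f) (-B v e) s e1 e2 (.inl one_ne_zero) hp (by simpa using (hR s e1 e2).2.2)
    convert this using 1
    rw [hs]; module
  · push Not at hp
    have hvs : v = s := by rw [hs, hp.1, neg_eq_zero.1 hp.2]; simp
    by_cases hv0 : v = 0
    · rw [hv0]; simpa using he.smul 0
    obtain ⟨u, hu⟩ : ∃ u, B v u ≠ 0 := by
      by_contra! h; exact hv0 (hBn v h)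
    set t := u - B u f • e + B u e • f with ht
    have t1 : B e t = 0 := by simp [ht, hB e, hef, ← hB.neg u e]
    have t2 : B f t = 0 := by simp [ht, hB f, hfe, ← hB.neg u f]
    have hv1 : B v e = 0 := neg_eq_zero.1 hp.2
    have hvt : B v t ≠ 0 := by simpa [ht, hp.1, hv1] using hu
    have htv : B t v ≠ 0 := by rwa [← hB.neg, neg_ne_zero]
    rw [← hvs] at e1 e2
    have hx := (hR t t1 t2).2.2
    have hy := hmove 1 0 (-1) 0 (v - t) (by simp [e1, t1]) (by simp [e2, t2]) (.inl one_ne_zero)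
      (.inl (by simp)) (by
        simpa using (hR (v - t) (by simp [e1, t1]) (by simp [e2, t2])).2.2)
    have := hy.add hH hx (by simp [hB e, hB t, e1, t1, hBs, htv])
    convert this using 1
    module

/-- Over a field with more than two elements no further hypothesis is needed. -/
theorem isFull_of_span (hB : B.IsAlt) (hBn : ∀ v, (∀ u, B v u = 0) → v = 0)
    (hH : ∀ g ∈ H, ∀ u v, B (g u) (g v) = B u v) {k : F} (hk : k ≠ 0) (hk1 : k ≠ 1)
    {e f : V} (hef : B e f = 1) (he : IsFull B H e) (hf : IsFull B H f)
    (hspan : Submodule.span F {v | IsFull B H v ∧ (B e v ≠ 0 ∨ B f v ≠ 0)} = ⊤) (v : V) :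
    IsFull B H v := by
  refine isFull_of_span_of_add hB hBn hH hef he hf (fun s t h1 h2 h1' h2' h3 h3' => ?_) hspan v
  have hfe : B f e = -1 := by rw [← hef, hB.neg]
  have hte : B t e = 0 := by rw [← hB.neg, h1', neg_zero]
  have htf : B t f = 0 := by rw [← hB.neg, h2', neg_zero]
  obtain ⟨c, hc, hc'⟩ : ∃ c : F, c ≠ 0 ∧ c + B t s ≠ 0 := by
    by_cases h : 1 + B t s = 0
    · exact ⟨k, hk, fun h' => hk1 (by linear_combination h' - h)⟩
    · exact ⟨1, one_ne_zero, h⟩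
  have hs : IsFull B H ((0 : F) • e + c • f + s) :=
    .move hB hH hef he hf 1 0 0 c h1 h2 (.inl one_ne_zero) (.inr hc) (by simpa using h3)
  have := hs.add hH h3' (by simpa [hef, h1, hte, htf, hB e] using hc')
  have := IsFull.move hB hH hef he hf 1 c 1 0 (s := s + t) (by simp [h1, h1']) (by simp [h2, h2'])
    (.inl one_ne_zero) (.inl one_ne_zero) (by convert this using 1; module)
  simpa using this

/-- Over the field with two elements it is enough to find a hyperbolic plane orthogonal to the
given one among the components that occur. -/
theorem isFull_of_span_of_two (hF : ∀ a : F, a = 0 ∨ a = 1)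
    (hB : B.IsAlt) (hBn : ∀ v, (∀ u, B v u = 0) → v = 0)
    (hH : ∀ g ∈ H, ∀ u v, B (g u) (g v) = B u v)
    {e f : V} (hef : B e f = 1) (he : IsFull B H e) (hf : IsFull B H f)
    (hspan : Submodule.span F {v | IsFull B H v ∧ (B e v ≠ 0 ∨ B f v ≠ 0)} = ⊤)
    {p q : V} (hep : B e p = 0) (hfp : B f p = 0) (heq : B e q = 0) (hfq : B f q = 0)
    (hpq : B p q = 1) (hp : IsFull B H (e + p)) (hq : IsFull B H (e + q))
    (hpq' : IsFull B H (e + (p + q))) (v : V) :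
    IsFull B H v := by
  have h11 : (1 : F) + 1 = 0 := (hF (1 + 1)).resolve_right (by simp)
  have hself (u : V) : u + u = 0 := by rw [← one_smul F u, ← add_smul, h11, zero_smul]
  have hsymm (u v : V) : B u v = B v u := by
    rw [← hB.neg]; linear_combination -h11 * B v u
  have horth (s t : V) (h1 : B e s = 0) (h2 : B f s = 0) (h1' : B e t = 0) (h2' : B f t = 0)
      (h3 : IsFull B H (e + s)) (h3' : IsFull B H (e + t)) (hst : B s t = 0) :
      IsFull B H (e + (s + t)) := by
    have hs : IsFull B H ((0 : F) • e + (1 : F) • f + s) :=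
      .move hB hH hef he hf 1 0 0 1 h1 h2 (.inl one_ne_zero) (.inr one_ne_zero) (by simpa using h3)
    have := hs.add hH h3' (by simp [hef, h1, hsymm t, h2', hst])
    have := IsFull.move hB hH hef he hf 1 1 1 0 (s := s + t) (by simp [h1, h1']) (by simp [h2, h2'])
      (.inl one_ne_zero) (.inl one_ne_zero) (by convert this using 1; module)
    simpa using this
  have hcancel (u v : V) : u + v + v = u := by rw [add_assoc, hself, add_zero]
  have hplane {p q : V} (hep : B e p = 0) (hfp : B f p = 0) (heq : B e q = 0) (hfq : B f q = 0)
      (hpq : B p q = 1) (hp : IsFull B H (e + p)) (hq : IsFull B H (e + q))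
      (hpq' : IsFull B H (e + (p + q))) (r : V) (h1 : B e r = 0) (h2 : B f r = 0)
      (h3 : IsFull B H (e + r)) : IsFull B H (e + (r + p)) := by
    rcases hF (B r p) with h | h
    · exact horth r p h1 h2 hep hfp h3 hp h
    rcases hF (B r q) with h' | h'
    · have := horth (r + q) (p + q) (by simp [*]) (by simp [*]) (by simp [*]) (by simp [*])
        (horth r q h1 h2 heq hfq h3 hq h') hpq' (by
          simp only [map_add, LinearMap.add_apply, h, h', hsymm q p, hpq, hB q]
          linear_combination h11)
      rwa [show r + q + (p + q) = r + p + q + q by abel, hcancel] at this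
    · have := horth (r + (p + q)) q (by simp [*]) (by simp [*]) heq hfq
        (horth r (p + q) h1 h2 (by simp [*]) (by simp [*]) h3 hpq' (by
          simp only [map_add, h, h', h11])) hq (by
          simp only [map_add, LinearMap.add_apply, h', hpq, hB q]
          linear_combination h11)
      rwa [show r + (p + q) + q = r + p + q + q by abel, hcancel] at this
  have hP := hplane hep hfp heq hfq hpq hp hq hpq'
  have hQ := hplane heq hfq hep hfp (by rw [hsymm, hpq]) hq hp (by rwa [add_comm q])
  refine isFull_of_span_of_add hB hBn hH hef he hf (fun s t h1 h2 h1' h2' h3 h3' => ?_) hspan v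
  -- adjusting one summand by a vector of the plane
  have hone (s t r : V) (h1 : B e s = 0) (h2 : B f s = 0) (h1' : B e t = 0) (h2' : B f t = 0)
      (hr : B e r = 0) (hr' : B f r = 0)
      (hR : ∀ u, B e u = 0 → B f u = 0 → IsFull B H (e + u) → IsFull B H (e + (u + r)))
      (h3 : IsFull B H (e + s)) (h3' : IsFull B H (e + t)) (h : B s t + B s r = 0) :
      IsFull B H (e + (s + t)) := by
    have := hR (s + (t + r)) (by simp [*]) (by simp [*])
      (horth s (t + r) h1 h2 (by simp [*]) (by simp [*]) h3 (hR t h1' h2' h3') (by simpa using h))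
    rwa [show s + (t + r) + r = s + t + r + r by abel, hcancel] at this
  rcases hF (B s t) with hst | hst
  · exact horth s t h1 h2 h1' h2' h3 h3' hst
  rcases hF (B s q) with hsq | hsq
  swap
  · exact hone s t q h1 h2 h1' h2' heq hfq hQ h3 h3' (by rw [hst, hsq, h11])
  rcases hF (B t p) with htp | htp
  swap
  · rw [add_comm s]
    exact hone t s p h1' h2' h1 h2 hep hfp hP h3' h3 (by
      rw [hsymm t, hst, htp, h11])
  have := hP _ (by simp [*]) (by simp [*]) <| hone (s + p) t q (by simp [*]) (by simp [*]) h1' h2'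
    heq hfq hQ (hP s h1 h2 h3) h3' (by
      simp [hst, hsq, hsymm p t, htp, hpq, h11])
  rwa [show s + p + t + p = s + t + p + p by abel, hcancel] at this

/-- Two vectors with nonzero pairing are exchanged by a transvection. -/
theorem exists_mem_apply_eq (hB : B.IsAlt) (hfull : ∀ v, IsFull B H v) {u w : V} (h : B w u ≠ 0) :
    ∃ t ∈ H, t u = w ∧ ∀ y, B (w - u) y = 0 → t y = y := by
  obtain ⟨t, ht, ht'⟩ := hfull (w - u) (B w u)⁻¹
  refine ⟨t, ht, ?_, fun y hy => by rw [ht', hy]; simp⟩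
  rw [ht', map_sub, LinearMap.sub_apply, hB u, sub_zero, inv_mul_cancel₀ h]
  module

/-- The isometry group of a nondegenerate alternating form is generated by transvections. -/
theorem mem_of_forall_isFull [FiniteDimensional F V] (hB : B.IsAlt)
    (hBn : ∀ v, (∀ u, B v u = 0) → v = 0) (hH : ∀ g ∈ H, ∀ u v, B (g u) (g v) = B u v)
    (hfull : ∀ v, IsFull B H v) (g : V ≃ₗ[F] V) (hg : ∀ u v, B (g u) (g v) = B u v) : g ∈ H := by
  obtain ⟨n, hn⟩ : ∃ n, Module.finrank F V ≤
      Module.finrank F (LinearMap.eqLocus g.toLinearMap LinearMap.id) + n := ⟨_, le_add_self⟩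
  induction n generalizing g with
  | zero =>
    have htop := Submodule.eq_top_of_finrank_eq (le_antisymm (Submodule.finrank_le _) hn)
    convert H.one_mem
    ext v
    have : v ∈ LinearMap.eqLocus g.toLinearMap LinearMap.id := htop ▸ trivial
    simpa using this
  | succ n ih =>
    by_cases hg1 : ∀ v, g v = v
    · rw [show g = 1 from LinearEquiv.ext hg1]
      exact H.one_mem
    push Not at hg1
    suffices h : ∃ t ∈ H, (∀ y, g y = y → t y = y) ∧ ∃ v, g v ≠ v ∧ t (g v) = v by
      obtain ⟨t, ht, hfix, v, hv, hv'⟩ := h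
      have hlt : LinearMap.eqLocus g.toLinearMap LinearMap.id <
          LinearMap.eqLocus (t * g).toLinearMap LinearMap.id := by
        refine lt_of_le_of_ne (fun y hy => ?_) fun h => hv ?_
        · have hy : g y = y := by simpa using hy
          simp [hy, hfix y hy]
        · have : v ∈ LinearMap.eqLocus (t * g).toLinearMap LinearMap.id := by simpa using hv'
          rw [← h] at this
          simpa using this
      have := ih (t * g) (fun u v => by
        rw [LinearEquiv.mul_apply, LinearEquiv.mul_apply, hH t ht, hg]) (by
        have := Submodule.finrank_lt_finrank_of_lt hlt
        lia)
      exact (H.mul_mem_cancel_left ht).1 this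
    have hperp {y : V} (hy : g y = y) (v : V) : B (g v - v) y = 0 := by
      rw [map_sub, LinearMap.sub_apply, sub_eq_zero, ← hg v y, hy]
    by_cases hv : ∃ v, B v (g v) ≠ 0
    · obtain ⟨v, hv⟩ := hv
      obtain ⟨t, ht, htv, ht'⟩ := exists_mem_apply_eq hB hfull hv
      refine ⟨t, ht, fun y hy => ht' y ?_, v, fun h => hv (by rw [h, hB v]), htv⟩
      rw [← neg_sub, map_neg, LinearMap.neg_apply, hperp hy, neg_zero]
    push Not at hv
    obtain ⟨v, hgv⟩ := hg1
    obtain ⟨u, hu⟩ : ∃ u, B (v - g v) u ≠ 0 := by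
      by_contra! h; exact hgv (sub_eq_zero.1 (hBn _ h)).symm
    have hpol : B u (g v) + B v (g u) = 0 := by
      have := hv (u + v)
      simpa [hv] using this
    have h1 : B (g v + (g u - u)) (g v) ≠ 0 := by
      simp only [map_add, map_sub, LinearMap.add_apply, LinearMap.sub_apply, hB (g v), hg,
        ← hB.neg v u, ← hB.neg (g v) u] at hu ⊢
      contrapose! hu
      linear_combination -hu
    have h2 : B v (g v + (g u - u)) ≠ 0 := by
      simp only [map_add, map_sub, LinearMap.sub_apply, hv, ← hB.neg (g v) u] at hu hpol ⊢
      contrapose! hu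
      linear_combination hpol - hu
    obtain ⟨t, ht, htv, ht'⟩ := exists_mem_apply_eq hB hfull h1
    obtain ⟨s, hs, hsv, hs'⟩ := exists_mem_apply_eq hB hfull h2
    refine ⟨s * t, H.mul_mem hs ht, fun y hy => ?_, v, hgv, by simp [htv, hsv]⟩
    have e1 : B (g v + (g u - u) - g v) y = 0 := by rw [add_sub_cancel_left, hperp hy]
    have e2 : B (v - (g v + (g u - u))) y = 0 := by
      rw [← neg_sub, map_neg, add_sub_right_comm, map_add, LinearMap.neg_apply, LinearMap.add_apply,
        hperp hy, hperp hy, add_zero, neg_zero]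
    rw [LinearEquiv.mul_apply, ht' y e1, hs' y e2]

/-- An automorphism of a finite vector space annihilated by a squarefree polynomial has order
prime to the characteristic. -/
theorem exists_pow_eq_one_of_squarefree [Finite V] (p : ℕ) [Fact p.Prime] [CharP F p]
    (w : V ≃ₗ[F] V) {f : Polynomial F} (hf : Squarefree f)
    (h : Polynomial.aeval w.toLinearMap f = 0) : ∃ m : ℕ, (m : F) ≠ 0 ∧ w ^ m = 1 := by
  have hfin : Finite (V ≃ₗ[F] V) := Finite.of_injective (fun g => (g : V → V)) DFunLike.coe_injective
  obtain ⟨k, m, hm, hn⟩ := Nat.exists_eq_pow_mul_and_not_dvd (orderOf_pos w).ne' p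
    (Fact.out : p.Prime).ne_one
  refine ⟨m, fun h => hm ((CharP.cast_eq_zero_iff F p m).1 h), ?_⟩
  have hpow (n : ℕ) : (w ^ n).toLinearMap = w.toLinearMap ^ n := by
    induction n with
    | zero => rfl
    | succ n ih => rw [pow_succ, pow_succ, ← ih]; rfl
  have h1 : minpoly F w.toLinearMap ∣ (Polynomial.X ^ m - 1) ^ p ^ k := by
    apply minpoly.dvd
    have : (Polynomial.X ^ m - 1 : Polynomial F) ^ p ^ k = Polynomial.X ^ orderOf w - 1 := by
      rw [sub_pow_char_pow, one_pow, ← pow_mul, hn, mul_comm]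
    rw [this, map_sub, map_pow, Polynomial.aeval_X, ← hpow, pow_orderOf_eq_one, map_one]
    exact sub_self _
  have h2 := ((hf.squarefree_of_dvd (minpoly.dvd F _ h)).dvd_pow_iff_dvd
    (pow_pos (Fact.out : p.Prime).pos k).ne').1 h1
  have h3 := Polynomial.aeval_eq_zero_of_dvd_aeval_eq_zero h2 (minpoly.aeval F _)
  rw [map_sub, map_pow, Polynomial.aeval_X, ← hpow, map_one, sub_eq_zero] at h3
  exact LinearEquiv.toLinearMap_injective h3

/-- If `w` is the commuting product of a transvection and of an automorphism annihilated by
a squarefree polynomial, then the transvection is a power of `w`. -/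
theorem hasTransvection_of_squarefree [Finite V] (p : ℕ) [Fact p.Prime] [CharP F p]
    (hB : B.IsAlt) {w : V ≃ₗ[F] V} (hw : w ∈ H) (hwB : ∀ u v, B (w u) (w v) = B u v) {v : V}
    (hv : w v = v) (a : F) {f : Polynomial F} (hf : Squarefree f)
    (h : Polynomial.aeval (w.toLinearMap - (a • B v).smulRight v) f = 0) :
    HasTransvection B H v a := by
  let w₀ := w * LinearEquiv.transvection (f := -(a • B v)) (v := v) (by simp [hB v])
  have hw₀ (u : V) : w₀ u = w u - (a * B v u) • v := by
    simp [w₀, LinearMap.transvection.apply, hv, sub_eq_add_neg]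
  obtain ⟨m, hm, hm'⟩ := exists_pow_eq_one_of_squarefree p w₀ hf (by
    convert h
    ext u
    simp [hw₀])
  have hBv (u : V) : B v (w u) = B v u := by nth_rw 1 [← hv, hwB]
  have hpow (n : ℕ) (u : V) : (w ^ n) u = (w₀ ^ n) u + (n * a * B v u) • v ∧
      B v ((w₀ ^ n) u) = B v u := by
    induction n with
    | zero => simp
    | succ n ih =>
      obtain ⟨h1, h2⟩ := ih
      rw [pow_succ', pow_succ', LinearEquiv.mul_apply, LinearEquiv.mul_apply, h1, hw₀, map_sub, hBv,
        h2, map_smul, hB v, map_add, map_smul, hv]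
      refine ⟨?_, by simp⟩
      push_cast
      module
  have key : HasTransvection B H v (m * a) :=
    ⟨w ^ m, H.pow_mem hw m, fun u => by rw [(hpow m u).1, hm']; rfl⟩
  obtain ⟨k, hk⟩ : ∃ k : ℕ, (k * m : F) = 1 := by
    have hp : p.Prime := Fact.out
    obtain ⟨k, hk⟩ := Nat.exists_mul_mod_eq_one_of_coprime ((Nat.coprime_comm.1 <|
      hp.coprime_iff_not_dvd.2 fun h => hm ((CharP.cast_eq_zero_iff F p m).2 h))) hp.one_lt
    refine ⟨k, ?_⟩
    rw [mul_comm, ← Nat.cast_mul, CharP.cast_eq_mod F p, hk.2, Nat.cast_one]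
  have := (transvectionFactors hB H v).nsmul_mem key k
  rwa [nsmul_eq_mul, ← mul_assoc, hk, one_mul] at this

/-- The group generated by two isometries consists of isometries. -/
theorem isometry_of_mem_closure {x y : V ≃ₗ[F] V} (hx : ∀ u v, B (x u) (x v) = B u v)
    (hy : ∀ u v, B (y u) (y v) = B u v) :
    ∀ g ∈ Subgroup.closure {x, y}, ∀ u v, B (g u) (g v) = B u v := by
  intro g hg
  induction hg using Subgroup.closure_induction with
  | mem g hg => rcases hg with rfl | rfl <;> assumption
  | one => simp
  | mul g h _ _ hg hh => intro u v; rw [LinearEquiv.mul_apply, LinearEquiv.mul_apply, hg, hh]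
  | inv g _ hg =>
    intro u v
    rw [← hg, ← LinearEquiv.mul_apply, ← LinearEquiv.mul_apply]; simp

open Matrix in
/-- Isometries `x`, `y` of a space isometric to the standard symplectic space provide generators
of the projective symplectic group once the group they generate contains all transvections. -/
theorem exists_generators_of_isFull [FiniteDimensional F V] (hB : B.IsAlt)
    (ψ : V ≃ₗ[F] (Fin 3 ⊕ Fin 3 → F))
    (hψ : ∀ u v, B u v = ψ u ⬝ᵥ (J (Fin 3) F *ᵥ ψ v)) (x y : V ≃ₗ[F] V)
    (hx : ∀ u v, B (x u) (x v) = B u v) (hy : ∀ u v, B (y u) (y v) = B u v)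
    {ε : F} (hx2 : ∀ u, x (x u) = ε • u) (hy3 : ∀ u, y (y (y u)) = u)
    {u₀ : V} (hxy : x (y u₀) ≠ y (x u₀))
    (hfull : (∀ v, (∀ u, B v u = 0) → v = 0) →
      (∀ g ∈ Subgroup.closure {x, y}, ∀ u v, B (g u) (g v) = B u v) →
      ∀ v, IsFull B (Subgroup.closure {x, y}) v) :
    ∃ g h : symplecticGroup (Fin 3) F ⧸ Subgroup.center (symplecticGroup (Fin 3) F),
      orderOf g = 2 ∧ orderOf h = 3 ∧ Subgroup.closure {g, h} = ⊤ := by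
  have hBn (v : V) (h : ∀ u, B v u = 0) : v = 0 := by
    have h1 (z : Fin 3 ⊕ Fin 3 → F) : ψ v ⬝ᵥ z = 0 := by
      have := h (ψ.symm (-(J (Fin 3) F *ᵥ z)))
      rw [hψ, LinearEquiv.apply_symm_apply, mulVec_neg, mulVec_mulVec, J_squared, neg_mulVec,
        neg_neg, one_mulVec] at this
      exact this
    exact ψ.map_eq_zero_iff.1 (dotProduct_eq_zero _ h1)
  have hH := isometry_of_mem_closure hx hy
  replace hfull := hfull hBn hH
  have hpair (X : Matrix (Fin 3 ⊕ Fin 3) (Fin 3 ⊕ Fin 3) F) (u v : Fin 3 ⊕ Fin 3 → F) :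
      X *ᵥ u ⬝ᵥ (J (Fin 3) F *ᵥ X *ᵥ v) = u ⬝ᵥ (Xᵀ * J (Fin 3) F * X) *ᵥ v := by
    rw [← vecMul_transpose, ← dotProduct_mulVec, mulVec_mulVec, mulVec_mulVec, mul_assoc]
  -- matrices of isometries
  have hmat (g : V ≃ₗ[F] V) (hg : ∀ u v, B (g u) (g v) = B u v) :
      ∃ X : symplecticGroup (Fin 3) F, ∀ v, ψ (g v) = X.1 *ᵥ ψ v := by
    let X := LinearMap.toMatrix' (ψ.toLinearMap ∘ₗ g.toLinearMap ∘ₗ ψ.symm.toLinearMap)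
    have hX (v : V) : ψ (g v) = X *ᵥ ψ v := by
      rw [← toLin'_apply, toLin'_toMatrix']; simp
    refine ⟨⟨X, ?_⟩, hX⟩
    rw [SymplecticGroup.mem_iff']
    refine ext_of_mulVec_single fun i => (dotProduct_eq _ _ fun w => ?_).symm
    have := hg (ψ.symm w) (ψ.symm (Pi.single i 1))
    rw [hψ, hψ, hX, hX] at this
    rw [hpair, LinearEquiv.apply_symm_apply, LinearEquiv.apply_symm_apply] at this
    rw [dotProduct_comm, ← this, dotProduct_comm]
  obtain ⟨X, hX⟩ := hmat x hx
  obtain ⟨Y, hY⟩ := hmat y hy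
  have hext {M N : symplecticGroup (Fin 3) F} (h : ∀ v, M.1 *ᵥ ψ v = N.1 *ᵥ ψ v) : M = N := by
    apply Subtype.ext
    apply ext_of_mulVec_single
    intro i
    simpa using h (ψ.symm (Pi.single i 1))
  have hgen : Subgroup.closure {X, Y} = ⊤ := by
    rw [eq_top_iff]
    rintro M -
    obtain ⟨g, hg⟩ : ∃ g : V ≃ₗ[F] V, ∀ v, ψ (g v) = M.1 *ᵥ ψ v :=
      ⟨(ψ.trans (toLin'OfInv (congrArg Subtype.val (inv_mul_cancel M))
        (congrArg Subtype.val (mul_inv_cancel M)))).trans ψ.symm, fun v => by simp [toLin'OfInv]⟩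
    have hg' : g ∈ Subgroup.closure {x, y} := by
      refine mem_of_forall_isFull hB hBn hH hfull g fun u v => ?_
      rw [hψ, hψ, hg, hg, hpair, SymplecticGroup.mem_iff'.1 M.2]
    suffices ∃ N ∈ Subgroup.closure {X, Y}, ∀ v, ψ (g v) = N.1 *ᵥ ψ v by
      obtain ⟨N, hN, hN'⟩ := this
      rwa [hext fun v => (hg v).symm.trans (hN' v)]
    clear hg
    induction hg' using Subgroup.closure_induction with
    | mem g hg =>
      rcases hg with rfl | rfl
      · exact ⟨X, Subgroup.subset_closure (by simp), hX⟩
      · exact ⟨Y, Subgroup.subset_closure (by simp), hY⟩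
    | one => exact ⟨1, Subgroup.one_mem _, by simp⟩
    | mul g h _ _ hg hh =>
      obtain ⟨N, hN, hN'⟩ := hg
      obtain ⟨M, hM, hM'⟩ := hh
      exact ⟨N * M, Subgroup.mul_mem _ hN hM, fun v => by
        rw [LinearEquiv.mul_apply, hN', hM', mulVec_mulVec]; rfl⟩
    | inv g _ hg =>
      obtain ⟨N, hN, hN'⟩ := hg
      refine ⟨N⁻¹, Subgroup.inv_mem _ hN, fun v => ?_⟩
      have : ψ v = N.1 *ᵥ ψ (g⁻¹ v) := by
        rw [← hN', ← LinearEquiv.mul_apply]; simp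
      rw [this, mulVec_mulVec]
      have : (N⁻¹ : symplecticGroup (Fin 3) F).1 * N.1 = 1 := congrArg Subtype.val (inv_mul_cancel N)
      rw [this, one_mulVec]
  have hXY : X * Y ≠ Y * X := by
    intro h
    apply hxy
    apply ψ.injective
    rw [hX, hY, hY, hX, mulVec_mulVec, mulVec_mulVec]
    exact congrArg (· *ᵥ ψ u₀) (congrArg Subtype.val h)
  have hX2 : X ^ 2 ∈ Subgroup.center (symplecticGroup (Fin 3) F) := by
    rw [Subgroup.mem_center_iff]
    intro M
    refine hext fun v => ?_
    have h (v : V) : (X ^ 2).1 *ᵥ ψ v = ε • ψ v := by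
      rw [pow_two, ← map_smul, ← hx2, hX, hX, mulVec_mulVec]; rfl
    have h' : M.1 *ᵥ ψ v = ψ (ψ.symm (M.1 *ᵥ ψ v)) := by simp
    change (M.1 * (X ^ 2).1) *ᵥ _ = ((X ^ 2).1 * M.1) *ᵥ _
    rw [← mulVec_mulVec, ← mulVec_mulVec, h, h', h, ← h', mulVec_smul]
  have hY3 : Y ^ 3 = 1 := by
    refine hext fun v => ?_
    have : ((1 : symplecticGroup (Fin 3) F)).1 *ᵥ ψ v = ψ v := one_mulVec _
    rw [this]
    nth_rw 2 [← hy3 v]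
    rw [hY, hY, hY, mulVec_mulVec, mulVec_mulVec, pow_three']; rfl
  refine ⟨QuotientGroup.mk X, QuotientGroup.mk Y, ?_, ?_, ?_⟩
  · refine orderOf_eq_prime ?_ ?_
    · rw [← QuotientGroup.mk_pow]
      exact (QuotientGroup.eq_one_iff _).2 hX2
    · rw [Ne, QuotientGroup.eq_one_iff, Subgroup.mem_center_iff]
      exact fun h => hXY (h Y).symm
  · refine orderOf_eq_prime ?_ ?_
    · rw [← QuotientGroup.mk_pow, hY3, QuotientGroup.mk_one]
    · rw [Ne, QuotientGroup.eq_one_iff, Subgroup.mem_center_iff]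
      exact fun h => hXY (h X)
  · have := congrArg (Subgroup.map (QuotientGroup.mk' (Subgroup.center _))) hgen
    rwa [MonoidHom.map_closure, Subgroup.map_top_of_surjective _ (QuotientGroup.mk'_surjective _),
      Set.image_pair] at this

/-- In characteristic two, the transvections along two non-orthogonal vectors generate a dihedral
group of twice odd order, whose reflections exchange the two vectors. -/
theorem HasTransvection.exchange [Finite V] [CharP F 2] (hB : B.IsAlt)
    (hH : ∀ g ∈ H, ∀ u v, B (g u) (g v) = B u v) {u v : V} (hu : HasTransvection B H u 1)
    (hv : HasTransvection B H v 1) (h : B u v ≠ 0) :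
    (∃ g ∈ H, g u = v) ∧ HasTransvection B H (u + v) (B u v)⁻¹ := by
  have two : (2 : F) = 0 := CharTwo.two_eq_zero
  have hself (w : V) : w + w = 0 := by rw [← two_smul F, two, zero_smul]
  obtain ⟨s, hs, hs'⟩ := hu
  obtain ⟨t, ht, ht'⟩ := hv
  simp only [one_mul] at hs' ht'
  set ν := B u v with hν
  have hvu : B v u = ν := by rw [← hB.neg, ← hν]; linear_combination -ν * two
  have hss : s * s = 1 := LinearEquiv.ext fun w => by
    rw [LinearEquiv.mul_apply, hs', hs', map_add, map_smul, hB u, smul_zero, add_zero, add_assoc,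
      hself, add_zero]; rfl
  have htt : t * t = 1 := LinearEquiv.ext fun w => by
    rw [LinearEquiv.mul_apply, ht', ht', map_add, map_smul, hB v, smul_zero, add_zero, add_assoc,
      hself, add_zero]; rfl
  obtain ⟨m, hm, hm'⟩ := exists_pow_eq_one_of_squarefree 2 (s * t)
    (separable_linear_mul_quadratic (s := ν ^ 2) (by
      intro h4; exact h (by simpa [show (4 : F) = 0 by linear_combination 2 * two] using h4))).squarefree
    (by
      ext w
      simp only [map_mul, map_sub, map_add, Polynomial.aeval_X, Polynomial.aeval_C, map_one,
        Module.End.mul_apply, LinearMap.sub_apply, LinearMap.add_apply, pow_two,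
        LinearEquiv.coe_coe, LinearEquiv.mul_apply, hs', ht', map_smul, Module.End.one_apply,
        Module.algebraMap_end_apply, hB u, hB v, hvu, ← hν, smul_eq_mul, LinearMap.zero_apply]
      match_scalars <;> grind)
  obtain ⟨k, rfl⟩ : Odd m := by
    rw [← Nat.not_even_iff_odd, even_iff_two_dvd]
    exact fun h => hm ((CharP.cast_eq_zero_iff F 2 m).2 h)
  have hinv : s * (s * t) ^ k * s = ((s * t) ^ k)⁻¹ := by
    have hs1 : s⁻¹ = s := inv_eq_of_mul_eq_one_left hss
    have ht1 : t⁻¹ = t := inv_eq_of_mul_eq_one_left htt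
    have := conj_pow (i := k) (a := s) (b := s * t)
    rw [← inv_pow, mul_inv_rev, ht1, hs1]
    rw [hs1] at this
    rw [← this, ← mul_assoc s s, hss, one_mul]
  have hconj : (s * t) ^ k * s = t * (s * t) ^ k := by
    have h1 : (s * t) ^ k * s = s * ((s * t) ^ k)⁻¹ := by
      rw [← hinv, ← mul_assoc, ← mul_assoc, hss, one_mul]
    have h2 : ((s * t) ^ k)⁻¹ = (s * t) ^ (k + 1) :=
      inv_eq_of_mul_eq_one_left (by rw [← pow_add, ← hm']; congr 1; ring)
    rw [h1, h2, pow_succ', ← mul_assoc, ← mul_assoc, hss, one_mul]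
  have hgH : (s * t) ^ k ∈ H := H.pow_mem (H.mul_mem hs ht) k
  set g := (s * t) ^ k with hg
  have hkey (w : V) : B u w • g u = B v (g w) • v := by
    have := congrArg (fun f : V ≃ₗ[F] V => f w) hconj
    simpa [hs', ht'] using this
  have hv0 : v ≠ 0 := by rintro rfl; simp at hν; exact h hν
  have hgu : g u = v := by
    have h1 : g u = (ν⁻¹ * B v (g v)) • v := by
      rw [mul_smul, ← hkey, ← hν, inv_smul_smul₀ h]
    have h2 := hH g hgH u v
    rw [h1, ← hν, map_smul, LinearMap.smul_apply, smul_eq_mul] at h2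
    have h3 : (ν⁻¹ * B v (g v)) ^ 2 = 1 := by
      field_simp at h2 ⊢; linear_combination h2
    have h4 : (ν⁻¹ * B v (g v) - 1) ^ 2 = 0 := by
      linear_combination h3 + (1 - ν⁻¹ * B v (g v)) * two
    rw [h1, sub_eq_zero.1 (pow_eq_zero_iff two_ne_zero |>.1 h4), one_smul]
  have hgs : (g * s) * (g * s) = 1 := by
    rw [← mul_assoc, mul_assoc g s, mul_assoc g, hinv, mul_inv_cancel]
  have hju : (g * s) u = v := by rw [LinearEquiv.mul_apply, hs', hB u, zero_smul, add_zero, hgu]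
  have hjv : (g * s) v = u := by rw [← hju, ← LinearEquiv.mul_apply, hgs]; rfl
  have hjw (w : V) (h1 : B u w = 0) (h2 : B v w = 0) : (g * s) w = w := by
    have : ∀ n : ℕ, ((s * t) ^ n) w = w := fun n => by
      induction n with
      | zero => rfl
      | succ n ih => rw [pow_succ, LinearEquiv.mul_apply, LinearEquiv.mul_apply, ht', h2, zero_smul,
          add_zero, hs', h1, zero_smul, add_zero, ih]
    rw [LinearEquiv.mul_apply, hs', h1, zero_smul, add_zero, hg, this]
  refine ⟨⟨g, hgH, hgu⟩, g * s, H.mul_mem hgH hs, fun w => ?_⟩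
  have := hjw (w + (ν⁻¹ * B v w) • u + (ν⁻¹ * B u w) • v)
    (by simp only [map_add, map_smul, hB u, ← hν, smul_eq_mul]; field_simp; grind)
    (by simp only [map_add, map_smul, hB v, hvu, smul_eq_mul]; field_simp; grind)
  rw [map_add, map_add, map_smul, map_smul, hju, hjv] at this
  rw [map_add, LinearMap.add_apply]
  rw [eq_sub_of_add_eq (eq_sub_of_add_eq this)]
  match_scalars <;> grind

/-- A transvection lies in `H` as soon as `H` contains its product with a commuting element that is
annihilated by a suitable product of quadratic polynomials. -/
theorem hasTransvection_of_quadratics [Finite V] (p : ℕ) [Fact p.Prime] [CharP F p]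
    (hB : B.IsAlt) {w : V ≃ₗ[F] V} (hw : w ∈ H) (hwB : ∀ u v, B (w u) (w v) = B u v) {v : V}
    (hv : w v = v) (a : F) {s t : F} (hs : s ^ 2 ≠ 4) (ht : t ^ 2 ≠ 4) (hst : s ≠ t) (A : V → V)
    (hA : ∀ u, w u = A u + (a * B v u) • v) (P Q : V → V)
    (hP : ∀ u, A (A u) - t • A u + u = P u) (hQ : ∀ u, A (A (P u)) - s • A (P u) + P u = Q u)
    (hAQ : ∀ u, A (Q u) = Q u) : HasTransvection B H v a := by
  refine hasTransvection_of_squarefree p hB hw hwB hv a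
    (squarefree_linear_mul_quadratics hs ht hst) ?_
  ext u
  have h (u : V) : (w.toLinearMap - (a • B v).smulRight v) u = A u := by
    simp [hA]
  simp only [map_mul, map_sub, map_add, Polynomial.aeval_X, Polynomial.aeval_C, map_one,
    Module.End.mul_apply, LinearMap.sub_apply _ (1 : Module.End F V), LinearMap.add_apply, pow_two,
    LinearMap.sub_apply (_ * _), h, Module.End.one_apply, Module.algebraMap_end_apply,
    hP, hQ, hAQ, sub_self, LinearMap.zero_apply]

theorem HasTransvection.transvect (hH : ∀ g ∈ H, ∀ u v, B (g u) (g v) = B u v) {u v : V} {a b : F}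
    (hu : HasTransvection B H u a) (hv : HasTransvection B H v b) :
    HasTransvection B H (u + (b * B v u) • v) a := by
  obtain ⟨g, hg, hg'⟩ := hv
  rw [← hg']
  exact hu.map hH hg

/-- `H` contains the isometry `u ↦ u + B e u • s + B s u • e`. -/
def HasSiegel (B : V →ₗ[F] V →ₗ[F] F) (H : Subgroup (V ≃ₗ[F] V)) (e s : V) : Prop :=
  ∃ g ∈ H, ∀ u, g u = u + B e u • s + B s u • e

theorem HasSiegel.map (hH : ∀ g ∈ H, ∀ u v, B (g u) (g v) = B u v) {g : V ≃ₗ[F] V}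
    (hg : g ∈ H) {e s : V} (h : HasSiegel B H e s) : HasSiegel B H (g e) (g s) := by
  obtain ⟨t, ht, ht'⟩ := h
  refine ⟨g * t * g⁻¹, H.mul_mem (H.mul_mem hg ht) (H.inv_mem hg), fun u => ?_⟩
  have hu : g (g⁻¹ u) = u := by rw [← LinearEquiv.mul_apply]; simp
  rw [LinearEquiv.mul_apply, LinearEquiv.mul_apply, ht', map_add, map_add, map_smul, map_smul,
    ← hH g hg e, ← hH g hg s, hu]

theorem HasSiegel.nsmul (hB : B.IsAlt) {e s : V} (hes : B e s = 0) (h : HasSiegel B H e s) (n : ℕ) :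
    HasSiegel B H e (n • s) := by
  have hse : B s e = 0 := by rw [← hB.neg, hes, neg_zero]
  induction n with
  | zero => exact ⟨1, H.one_mem, fun u => by simp⟩
  | succ n ih =>
    obtain ⟨g, hg, hg'⟩ := h
    obtain ⟨k, hk, hk'⟩ := ih
    refine ⟨k * g, H.mul_mem hk hg, fun u => ?_⟩
    rw [LinearEquiv.mul_apply, hk', hg']
    simp only [map_add, map_smul, LinearMap.add_apply, add_smul, one_smul, map_nsmul,
      LinearMap.smul_apply, hes, hse, hB e, hB s, smul_zero, add_zero]
    module

theorem HasSiegel.half (hB : B.IsAlt) {n : ℕ} (hn : (n : F) * 2 = 1) {e s : V} (hes : B e s = 0)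
    (h : HasSiegel B H e ((2 : F) • s)) : HasSiegel B H e s := by
  have := h.nsmul hB (by simp [hes]) n
  rwa [← Nat.cast_smul_eq_nsmul F, smul_smul, hn, one_smul] at this

/-- The group generated by transvections along a hyperbolic pair `e, f` contains the rotation
`e ↦ f ↦ -e`. -/
theorem exists_rotation (hB : B.IsAlt) {e f : V} (hef : B e f = 1) (he : HasTransvection B H e 1)
    (hf : HasTransvection B H f 1) :
    ∃ n ∈ H, n e = f ∧ n f = -e ∧ ∀ s, B e s = 0 → B f s = 0 → n s = s := by
  have hfe : B f e = -1 := by rw [← hef, hB.neg]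
  obtain ⟨g, hg, hg'⟩ := he.neg hB
  obtain ⟨k, hk, hk'⟩ := hf.neg hB
  refine ⟨k * g * k, H.mul_mem (H.mul_mem hk hg) hk, ?_, ?_, fun s h1 h2 => by simp [hg', hk', h1, h2]⟩ <;>
    simp only [LinearEquiv.mul_apply, hg', hk', map_add, map_smul, hef, hfe, hB e, hB f] <;>
    module

theorem HasSiegel.of_hasTransvection (hB : B.IsAlt) {n : ℕ} (hn : (n : F) * 2 = 1) {e s : V}
    (hes : B e s = 0) (h : HasTransvection B H (e + s) 1) (h' : HasTransvection B H (-e + s) 1) :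
    HasSiegel B H e s := by
  have hse : B s e = 0 := by rw [← hB.neg, hes, neg_zero]
  obtain ⟨g, hg, hg'⟩ := h
  obtain ⟨k, hk, hk'⟩ := h'.neg hB
  refine .half hB hn hes ⟨g * k, H.mul_mem hg hk, fun u => ?_⟩
  simp only [LinearEquiv.mul_apply, hg', hk', map_add, map_smul, map_neg, LinearMap.add_apply,
    LinearMap.neg_apply, LinearMap.smul_apply, hes, hse, hB e, hB s, smul_eq_mul]
  match_scalars <;> ring

theorem HasSiegel.commutator (hB : B.IsAlt) {n : ℕ} (hn : (n : F) * 2 = 1) {e r s : V}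
    (her : B e r = 0) (hes : B e s = 0) (hr : HasSiegel B H e r) (hs : HasSiegel B H e s) :
    HasTransvection B H e (B r s) := by
  have hre : B r e = 0 := by rw [← hB.neg, her, neg_zero]
  have hse : B s e = 0 := by rw [← hB.neg, hes, neg_zero]
  have hsr : B s r = -B r s := (hB.neg r s).symm
  have key : HasTransvection B H e (2 * B r s) := by
    obtain ⟨g, hg, hg'⟩ := hr
    obtain ⟨k, hk, hk'⟩ := hs
    refine ⟨g * k * (k * g)⁻¹, H.mul_mem (H.mul_mem hg hk) (H.inv_mem (H.mul_mem hk hg)),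
      fun u => ?_⟩
    obtain ⟨w, rfl⟩ := (k * g).surjective u
    rw [← LinearEquiv.mul_apply (_ * _), inv_mul_cancel_right]
    simp only [LinearEquiv.mul_apply, hg', hk', map_add, map_smul, her, hes, hre, hse, hB e, hsr,
      smul_eq_mul]
    match_scalars <;> ring
  have := (transvectionFactors hB H e).nsmul_mem key n
  rw [nsmul_eq_mul, ← mul_assoc, hn, one_mul] at this
  exact this

theorem HasSiegel.smul (hB : B.IsAlt) (hH : ∀ g ∈ H, ∀ u v, B (g u) (g v) = B u v) {n : ℕ}
    (hn : (n : F) * 2 = 1) {e f s : V} (hef : B e f = 1) (he : HasTransvection B H e 1)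
    (hf : HasTransvection B H f 1) (hes : B e s = 0) (hfs : B f s = 0) (h : HasSiegel B H e s)
    {a : F} (ha : HasTransvection B H e a) : HasSiegel B H e (a • s) := by
  have hse : B s e = 0 := by rw [← hB.neg, hes, neg_zero]
  have hsf : B s f = 0 := by rw [← hB.neg, hfs, neg_zero]
  obtain ⟨m, hm, hme, hmf, hms⟩ := exists_rotation hB hef he hf
  have h1 : HasSiegel B H f s := by simpa [hme, hms s hes hfs] using h.map hH hm
  have h2 : HasSiegel B H (f + a • e) s := by
    obtain ⟨t, ht, ht'⟩ := ha
    simpa [ht', hef, hes] using h1.map hH ht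
  have h3 : HasSiegel B H (-f) s := by simpa [hmf, hme, hms s hes hfs] using (h1.map hH hm).map hH hm
  have h4 : HasSiegel B H (-f - a • e) s := by
    simpa [hmf, hme, hms s hes hfs, sub_eq_add_neg] using (h2.map hH hm).map hH hm
  obtain ⟨g₁, hg₁, hg₁'⟩ := h1
  obtain ⟨g₂, hg₂, hg₂'⟩ := h2
  obtain ⟨g₃, hg₃, hg₃'⟩ := h3
  obtain ⟨g₄, hg₄, hg₄'⟩ := h4
  refine .half hB hn (by simp [hes]) ⟨g₂ * g₃ * (g₄ * g₁)⁻¹,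
    H.mul_mem (H.mul_mem hg₂ hg₃) (H.inv_mem (H.mul_mem hg₄ hg₁)), fun u => ?_⟩
  obtain ⟨w, rfl⟩ := (g₄ * g₁).surjective u
  rw [← LinearEquiv.mul_apply (_ * _), inv_mul_cancel_right]
  simp only [LinearEquiv.mul_apply, hg₁', hg₂', hg₃', hg₄', map_add, map_smul, map_neg, map_sub,
    LinearMap.add_apply, LinearMap.neg_apply, LinearMap.sub_apply, LinearMap.smul_apply, hes, hfs,
    hse, hsf, hef, hB e, hB s, hB f, smul_eq_mul]
  match_scalars <;> ring

theorem isFull_of_siegel [Finite F] (hB : B.IsAlt) (hH : ∀ g ∈ H, ∀ u v, B (g u) (g v) = B u v)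
    {n : ℕ} (hn : (n : F) * 2 = 1) {e f r s : V} (hef : B e f = 1) (he : HasTransvection B H e 1)
    (hf : HasTransvection B H f 1) (her : B e r = 0) (hfr : B f r = 0) (hes : B e s = 0)
    (hfs : B f s = 0) (hr : HasTransvection B H (-e + r) 1) (hs : HasTransvection B H (-e + s) 1)
    (htop : Subfield.closure {B r s} = ⊤) : IsFull B H e := by
  obtain ⟨m, hm, hme, hmf, hms⟩ := exists_rotation hB hef he hf
  have hr' : HasSiegel B H e r := .of_hasTransvection hB hn her (by
    simpa [hme, hmf, hms r her hfr] using (hr.map hH hm).map hH hm) hr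
  have hs' : HasSiegel B H e s := .of_hasTransvection hB hn hes (by
    simpa [hme, hmf, hms s hes hfs] using (hs.map hH hm).map hH hm) hs
  have := AddSubgroup.eq_top_of_mul_mem (S := transvectionFactors hB H e) (b := B r s) he
    (fun a ha => by
      have := (hr'.smul hB hH hn hef he hf her hfr ha).commutator hB hn (by simp [her]) hes hs'
      rwa [map_smul, LinearMap.smul_apply, smul_eq_mul, mul_comm] at this) htop
  exact fun a => (mem_transvectionFactors hB).1 (by rw [this]; trivial)

end Transvections

section Generators

variable {F : Type*} [Field F]

/-- The permutation of order three `e₀ ↦ e₁ ↦ e₂ ↦ e₀`, `e₃ ↦ e₄ ↦ e₅ ↦ e₃` of the coordinates. -/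
def doubleCycle (F : Type*) [Field F] : (Fin 6 → F) ≃ₗ[F] (Fin 6 → F) where
  toFun u := ![u 2, u 0, u 1, u 5, u 3, u 4]
  invFun u := ![u 1, u 2, u 0, u 4, u 5, u 3]
  map_add' u v := by ext i; fin_cases i <;> rfl
  map_smul' c u := by ext i; fin_cases i <;> rfl
  left_inv u := by ext i; fin_cases i <;> rfl
  right_inv u := by ext i; fin_cases i <;> rfl

theorem doubleCycle_apply (u : Fin 6 → F) :
    doubleCycle F u = ![u 2, u 0, u 1, u 5, u 3, u 4] := rfl

theorem doubleCycle_inv_apply (u : Fin 6 → F) :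
    (doubleCycle F)⁻¹ u = ![u 1, u 2, u 0, u 4, u 5, u 3] := rfl

theorem doubleCycle_cube (u : Fin 6 → F) : doubleCycle F (doubleCycle F (doubleCycle F u)) = u := by
  ext i; fin_cases i <;> rfl

end Generators

section Even

variable {F : Type*} [Field F]

/-- An alternating form on `F⁶` with hyperbolic pairs `(e₀, e₅)`, `(e₂, e₄)`, `(e₁, e₃)`. -/
def evenForm (F : Type*) [Field F] : (Fin 6 → F) →ₗ[F] (Fin 6 → F) →ₗ[F] F :=
  LinearMap.mk₂ F (fun u v => (u 0 * v 5 - u 5 * v 0) + (u 2 * v 4 - u 4 * v 2) +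
      (u 1 * v 3 - u 3 * v 1))
    (fun u v w => by simp only [Pi.add_apply]; ring)
    (fun c u v => by simp only [Pi.smul_apply, smul_eq_mul]; ring)
    (fun u v w => by simp only [Pi.add_apply]; ring)
    (fun c u v => by simp only [Pi.smul_apply, smul_eq_mul]; ring)

theorem evenForm_apply (u v : Fin 6 → F) : evenForm F u v = (u 0 * v 5 - u 5 * v 0) +
    (u 2 * v 4 - u 4 * v 2) + (u 1 * v 3 - u 3 * v 1) := rfl

theorem evenForm_isAlt : (evenForm F).IsAlt := fun u => by rw [evenForm_apply]; ring

theorem evenForm_doubleCycle (u v : Fin 6 → F) :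
    evenForm F (doubleCycle F u) (doubleCycle F v) = evenForm F u v := by
  simp [evenForm_apply, doubleCycle_apply]; ring

variable [CharP F 2] (β γ : F)

/-- An involution preserving `evenForm`. -/
def evenInvolution : (Fin 6 → F) ≃ₗ[F] (Fin 6 → F) :=
  .ofInvolutive
    { toFun u := ![u 0 + β * u 4 + γ * u 5, u 3, u 2 + u 4 + β * u 5, u 1, u 4, u 5]
      map_add' u v := by ext i; fin_cases i <;> simp <;> ring
      map_smul' c u := by ext i; fin_cases i <;> simp <;> ring }
    fun u => by ext i; fin_cases i <;> simp <;> grind [CharTwo.two_eq_zero (R := F)]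

theorem evenInvolution_apply (u : Fin 6 → F) : evenInvolution β γ u =
    ![u 0 + β * u 4 + γ * u 5, u 3, u 2 + u 4 + β * u 5, u 1, u 4, u 5] := rfl

theorem evenForm_evenInvolution (u v : Fin 6 → F) :
    evenForm F (evenInvolution β γ u) (evenInvolution β γ v) = evenForm F u v := by
  have := CharTwo.two_eq_zero (R := F)
  simp [evenForm_apply, evenInvolution_apply]; grind

/-- The group generated by the two elements of order two and three. -/
def evenGroup : Subgroup ((Fin 6 → F) ≃ₗ[F] (Fin 6 → F)) :=
  .closure {evenInvolution β γ, doubleCycle F}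

variable {β γ}

theorem evenInvolution_mem : evenInvolution β γ ∈ evenGroup β γ :=
  Subgroup.subset_closure (by simp)

theorem doubleCycle_mem_evenGroup : doubleCycle F ∈ evenGroup β γ :=
  Subgroup.subset_closure (by simp)

theorem evenGroup_isometry : ∀ g ∈ evenGroup β γ, ∀ u v,
    evenForm F (g u) (g v) = evenForm F u v :=
  isometry_of_mem_closure (evenForm_evenInvolution β γ) evenForm_doubleCycle

theorem HasTransvection.map_evenInvolution {u₀ u₁ u₂ u₃ u₄ u₅ a : F}
    (h : HasTransvection (evenForm F) (evenGroup β γ) ![u₀, u₁, u₂, u₃, u₄, u₅] a) :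
    HasTransvection (evenForm F) (evenGroup β γ)
      ![u₀ + β * u₄ + γ * u₅, u₃, u₂ + u₄ + β * u₅, u₁, u₄, u₅] a := by
  simpa [evenInvolution_apply] using h.map evenGroup_isometry evenInvolution_mem

theorem HasTransvection.map_doubleCycle {u₀ u₁ u₂ u₃ u₄ u₅ a : F}
    (h : HasTransvection (evenForm F) (evenGroup β γ) ![u₀, u₁, u₂, u₃, u₄, u₅] a) :
    HasTransvection (evenForm F) (evenGroup β γ) ![u₂, u₀, u₁, u₅, u₃, u₄] a := by
  simpa [doubleCycle_apply] using h.map evenGroup_isometry doubleCycle_mem_evenGroup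

theorem IsFull.add_even {u₀ u₁ u₂ u₃ u₄ u₅ v₀ v₁ v₂ v₃ v₄ v₅ : F}
    (hu : IsFull (evenForm F) (evenGroup β γ) ![u₀, u₁, u₂, u₃, u₄, u₅])
    (hv : IsFull (evenForm F) (evenGroup β γ) ![v₀, v₁, v₂, v₃, v₄, v₅])
    (h : (v₀ * u₅ - v₅ * u₀) + (v₂ * u₄ - v₄ * u₂) + (v₁ * u₃ - v₃ * u₁) ≠ 0) :
    IsFull (evenForm F) (evenGroup β γ)
      ![u₀ + v₀, u₁ + v₁, u₂ + v₂, u₃ + v₃, u₄ + v₄, u₅ + v₅] := by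
  convert hu.add evenGroup_isometry hv (by simpa [evenForm_apply] using h) using 1
  ext i; fin_cases i <;> rfl

theorem isFull_evenForm (hβ : β ≠ 0)
    (h : IsFull (evenForm F) (evenGroup β γ) ![1, 0, 0, 0, 0, 0])
    (hBn : ∀ v, (∀ u, evenForm F v u = 0) → v = 0) (v : Fin 6 → F) :
    IsFull (evenForm F) (evenGroup β γ) v := by
  have h1 : IsFull (evenForm F) (evenGroup β γ) ![0, 1, 0, 0, 0, 0] := fun a => (h a).map_doubleCycle
  have h2 : IsFull (evenForm F) (evenGroup β γ) ![0, 0, 1, 0, 0, 0] := fun a => (h1 a).map_doubleCycle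
  have h3 : IsFull (evenForm F) (evenGroup β γ) ![0, 0, 0, 1, 0, 0] := fun a => by
    simpa using (h1 a).map_evenInvolution
  have h4 : IsFull (evenForm F) (evenGroup β γ) ![0, 0, 0, 0, 1, 0] := fun a => (h3 a).map_doubleCycle
  have h5 : IsFull (evenForm F) (evenGroup β γ) ![0, 0, 0, 0, 0, 1] := fun a => (h4 a).map_doubleCycle
  have h6 : IsFull (evenForm F) (evenGroup β γ) ![β, 0, 1, 0, 1, 0] := fun a => by
    simpa using (h4 a).map_evenInvolution
  have h7 : IsFull (evenForm F) (evenGroup β γ) ![γ, 0, β, 0, 0, 1] := fun a => by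
    simpa using (h5 a).map_evenInvolution
  have h8 : IsFull (evenForm F) (evenGroup β γ) ![0, 1, β, 1, 0, 0] := fun a =>
    (h6 a).map_doubleCycle.map_doubleCycle
  have h9 : IsFull (evenForm F) (evenGroup β γ) ![0, β, γ, 0, 1, 0] := fun a =>
    (h7 a).map_doubleCycle.map_doubleCycle
  have hspan : Submodule.span F {v | IsFull (evenForm F) (evenGroup β γ) v ∧
      (evenForm F ![0, 0, 1, 0, 0, 0] v ≠ 0 ∨ evenForm F ![0, 0, 0, 0, 1, 0] v ≠ 0)} = ⊤ := by
    set S := Submodule.span F {v | IsFull (evenForm F) (evenGroup β γ) v ∧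
      (evenForm F ![0, 0, 1, 0, 0, 0] v ≠ 0 ∨ evenForm F ![0, 0, 0, 0, 1, 0] v ≠ 0)}
    have m2 : ![0, 0, 1, 0, 0, 0] ∈ S := Submodule.subset_span ⟨h2, by simp [evenForm_apply]⟩
    have m4 : ![0, 0, 0, 0, 1, 0] ∈ S := Submodule.subset_span ⟨h4, by simp [evenForm_apply]⟩
    have m6 : ![β, 0, 1, 0, 1, 0] ∈ S := Submodule.subset_span ⟨h6, by simp [evenForm_apply]⟩
    have m7 : ![γ, 0, β, 0, 0, 1] ∈ S := Submodule.subset_span ⟨h7, by simp [evenForm_apply, hβ]⟩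
    have m8 : ![0, 1, β, 1, 0, 0] ∈ S := Submodule.subset_span ⟨h8, by simp [evenForm_apply, hβ]⟩
    have m9 : ![0, β, γ, 0, 1, 0] ∈ S := Submodule.subset_span ⟨h9, by simp [evenForm_apply]⟩
    rw [eq_top_iff]
    intro u _
    have n0 : ![1, 0, 0, 0, 0, 0] ∈ S := by
      convert S.smul_mem β⁻¹ (S.sub_mem (S.sub_mem m6 m2) m4) using 1
      ext i; fin_cases i <;> simp [hβ]
    have n1 : ![0, 1, 0, 0, 0, 0] ∈ S := by
      convert S.smul_mem β⁻¹ (S.sub_mem (S.sub_mem m9 (S.smul_mem γ m2)) m4) using 1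
      ext i; fin_cases i <;> simp [hβ]
    convert S.add_mem (S.add_mem (S.add_mem (S.smul_mem (u 0 - u 5 * γ) n0)
      (S.smul_mem (u 1 - u 3) n1)) (S.add_mem (S.smul_mem (u 2 - u 5 * β - u 3 * β) m2)
      (S.smul_mem (u 4) m4))) (S.add_mem (S.smul_mem (u 5) m7) (S.smul_mem (u 3) m8)) using 1
    ext i; fin_cases i <;> simp
  by_cases hF : ∀ a : F, a = 0 ∨ a = 1
  · have hβ : β = 1 := (hF β).resolve_left hβ
    subst hβ
    have h10 : IsFull (evenForm F) (evenGroup 1 γ) ![1, 0, 1, 0, 0, 0] := by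
      simpa [CharTwo.add_self_eq_zero] using h6.add_even h4 (by simp)
    have h11 : IsFull (evenForm F) (evenGroup 1 γ) ![1, 0, 1, 0, 0, 1] := by
      simpa using h10.add_even h5 (by simp)
    have h12 : IsFull (evenForm F) (evenGroup 1 γ) ![0, 0, 1, 0, 0, 1] := by
      simpa [CharTwo.add_self_eq_zero] using h11.add_even h (by simp)
    refine isFull_of_span_of_two hF evenForm_isAlt hBn evenGroup_isometry
      (by simp [evenForm_apply]) h2 h4 hspan (p := ![1, 0, 0, 0, 0, 0])
      (q := ![0, 0, 0, 0, 0, 1]) ?_ ?_ ?_ ?_ ?_ ?_ ?_ ?_ v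
    any_goals simp [evenForm_apply]
    · exact h10
    · exact h12
    · exact h11
  · push Not at hF
    obtain ⟨k, hk, hk1⟩ := hF
    exact isFull_of_span evenForm_isAlt hBn evenGroup_isometry hk hk1 (by simp [evenForm_apply])
      h2 h4 hspan v

theorem isFull_evenForm_of_two (hF : ∀ a : F, a = 0 ∨ a = 1) :
    IsFull (evenForm F) (evenGroup (1 : F) 0) ![1, 0, 0, 0, 0, 0] := by
  have two := CharTwo.two_eq_zero (R := F)
  set x := evenInvolution (1 : F) 0
  set y := doubleCycle F
  have hx : x ∈ evenGroup (1 : F) 0 := evenInvolution_mem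
  have hy : y ∈ evenGroup (1 : F) 0 := doubleCycle_mem_evenGroup
  have full {v : Fin 6 → F} (h : HasTransvection (evenForm F) (evenGroup 1 0) v 1) :
      IsFull (evenForm F) (evenGroup (1 : F) 0) v := fun a => by
    rcases hF a with rfl | rfl
    exacts [.zero v, h]
  have h1 : IsFull (evenForm F) (evenGroup (1 : F) 0) ![1, 0, 0, 0, 0, 1] := by
    refine full ⟨((x * y) ^ 3 * x * y⁻¹) ^ 5, Subgroup.pow_mem _ (Subgroup.mul_mem _ (Subgroup.mul_mem _
      (Subgroup.pow_mem _ (Subgroup.mul_mem _ hx hy) 3) hx) (Subgroup.inv_mem _ hy)) 5, fun u => ?_⟩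
    set w := (x * y) ^ 3 * x * y⁻¹ with hw
    have w1 (u : Fin 6 → F) : w u = ![u 0 + u 1, u 2, u 0 + u 1 + u 2 + u 3 + u 5,
        u 1 + u 2 + u 4, u 0 + u 2 + u 3 + u 5, u 1 + u 5] := by
      simp only [hw, pow_three, LinearEquiv.mul_apply, x, y, evenInvolution_apply,
        doubleCycle_apply, doubleCycle_inv_apply]
      ext i; fin_cases i <;> simp <;> grind
    have w2 (u : Fin 6 → F) : w (w u) = ![u 0 + u 1 + u 2, u 0 + u 1 + u 2 + u 3 + u 5,
        u 2 + u 3 + u 4, u 1 + u 2, u 3 + u 4, u 1 + u 2 + u 5] := by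
      rw [w1, w1]; ext i; fin_cases i <;> simp <;> grind
    have w4 (u : Fin 6 → F) : w (w (w (w u))) = ![u 2 + u 4 + u 5, u 2 + u 4, u 1,
        u 0 + u 1 + u 4 + u 5, u 1 + u 2 + u 3 + u 4, u 0 + u 2 + u 4] := by
      rw [w2, w2]; ext i; fin_cases i <;> simp <;> grind
    have w5 : w (w (w (w (w u)))) = ![u 5, u 1, u 2, u 3, u 4, u 0] := by
      rw [w4, w1]; ext i; fin_cases i <;> simp <;> grind
    rw [pow_succ, pow_succ, pow_succ, pow_two, LinearEquiv.mul_apply, LinearEquiv.mul_apply,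
      LinearEquiv.mul_apply, LinearEquiv.mul_apply, w5]
    ext i; fin_cases i <;> simp [evenForm_apply]
    linear_combination (u 0 - u 5) * two
  have h2 : IsFull (evenForm F) (evenGroup (1 : F) 0) ![1, 0, 1, 0, 0, 1] := full <| by
    simpa using (h1 1).map_evenInvolution
  have h3 : IsFull (evenForm F) (evenGroup (1 : F) 0) ![0, 0, 1, 0, 1, 0] := fun a => by
    simpa using (h1 a).map_doubleCycle.map_doubleCycle
  have h4 : IsFull (evenForm F) (evenGroup (1 : F) 0) ![1, 0, 0, 0, 1, 1] := by
    simpa [CharTwo.add_self_eq_zero] using h2.add_even h3 (by simp)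
  have h5 : IsFull (evenForm F) (evenGroup (1 : F) 0) ![1, 0, 0, 0, 1, 0] := fun a => by
    simpa [CharTwo.add_self_eq_zero] using (h3 a).map_evenInvolution
  have h6 : IsFull (evenForm F) (evenGroup (1 : F) 0) ![0, 0, 0, 0, 1, 1] := by
    simpa [CharTwo.add_self_eq_zero] using h1.add_even h5 (by simp)
  simpa [CharTwo.add_self_eq_zero] using h4.add_even h6 (by simp)

theorem hasTransvection_evenForm_of_ne [Finite F] {δ : F} (hδ : δ ≠ 0) (hδ1 : δ ≠ 1)
    (hγ : γ = 1 + δ ^ 2) (hβ : β * δ = γ) :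
    HasTransvection (evenForm F) (evenGroup β γ) ![1, 0, 0, 0, 0, 0] 1 := by
  have two := CharTwo.two_eq_zero (R := F)
  have four : (4 : F) = 0 := by linear_combination 2 * two
  set x := evenInvolution β γ with hx
  set y := doubleCycle F with hy
  have hw : x * y * x * y⁻¹ ∈ evenGroup β γ :=
    mul_mem (mul_mem (mul_mem evenInvolution_mem doubleCycle_mem_evenGroup) evenInvolution_mem)
      (inv_mem doubleCycle_mem_evenGroup)
  have hγ0 : γ ≠ 0 := by
    intro h
    have : (δ - 1) ^ 2 = 0 := by linear_combination h - hγ - δ * two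
    exact hδ1 (sub_eq_zero.1 (pow_eq_zero_iff two_ne_zero |>.1 this))
  have hγ1 : 1 ≠ γ := fun h =>
    hδ (pow_eq_zero_iff two_ne_zero |>.1 (by linear_combination -h - hγ))
  refine hasTransvection_of_quadratics 2 evenForm_isAlt hw (evenGroup_isometry _ hw) ?_ 1
    (s := 1) (t := γ) (by simp [four]) (by simpa [four] using hγ0) hγ1
    (fun u => ![u 0 + β * (u 2 + u 3) + γ * u 5, u 3, u 2 + u 4 + β * u 5,
      u 1 + β * u 5 + γ * u 3, u 2, u 5]) (fun u => ?_)
    (fun u => ![γ * u 0 + β * (u 1 + u 3 + u 4) + β * γ * u 2 + γ ^ 2 * u 5, β * u 5,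
      (1 + γ) * (u 2 + u 4) + β * γ * u 5, β * u 5, (1 + γ) * u 2 + β * u 5, γ * u 5])
    (fun u => ![γ * u 0 + β * (u 1 + u 3) + β * γ * (u 2 + u 4), β * u 5, β * γ * u 5, β * u 5,
      β * γ * u 5, γ * u 5]) (fun u => ?_) (fun u => ?_) (fun u => ?_)
  · simp [hx, hy, evenInvolution_apply, doubleCycle_apply, doubleCycle_inv_apply]
  · simp only [hx, hy, evenInvolution_apply, doubleCycle_apply, doubleCycle_inv_apply,
      LinearEquiv.mul_apply]
    ext i; fin_cases i <;> simp [evenForm_apply] <;> grind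
  · ext i; fin_cases i <;> simp <;> grind
  · ext i; fin_cases i <;> simp <;> grind
  · have h : β ^ 2 * (γ + 1) + γ ^ 2 = 0 := by grind
    ext i; fin_cases i <;> simp <;> grind

/-- Applying the transvection along a second vector. -/
theorem HasTransvection.transvect_even {u₀ u₁ u₂ u₃ u₄ u₅ v₀ v₁ v₂ v₃ v₄ v₅ a c : F}
    (hu : HasTransvection (evenForm F) (evenGroup β γ) ![u₀, u₁, u₂, u₃, u₄, u₅] a)
    (hv : HasTransvection (evenForm F) (evenGroup β γ) ![v₀, v₁, v₂, v₃, v₄, v₅] 1)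
    (h : (v₀ * u₅ - v₅ * u₀) + (v₂ * u₄ - v₄ * u₂) + (v₁ * u₃ - v₃ * u₁) = c) :
    HasTransvection (evenForm F) (evenGroup β γ)
      ![u₀ + c * v₀, u₁ + c * v₁, u₂ + c * v₂, u₃ + c * v₃, u₄ + c * v₄, u₅ + c * v₅] a := by
  convert hu.transvect evenGroup_isometry hv using 1
  have : evenForm F ![v₀, v₁, v₂, v₃, v₄, v₅] ![u₀, u₁, u₂, u₃, u₄, u₅] = c := by
    rw [← h]; simp [evenForm_apply]
  rw [one_mul, this]
  ext i; fin_cases i <;> rfl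

theorem exists_isFull_evenForm [Finite F] : ∃ β γ : F, β ≠ 0 ∧
    IsFull (evenForm F) (evenGroup β γ) ![1, 0, 0, 0, 0, 0] := by
  have two := CharTwo.two_eq_zero (R := F)
  have neg (a : F) : -a = a := CharTwo.neg_eq a
  by_cases hF : ∀ a : F, a = 0 ∨ a = 1
  · exact ⟨1, 0, one_ne_zero, isFull_evenForm_of_two hF⟩
  obtain ⟨t, ht⟩ := IsCyclic.exists_generator (α := Fˣ)
  have ht1 : (t : F) ≠ 1 := by
    intro h
    refine hF fun a => or_iff_not_imp_left.2 fun ha => ?_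
    obtain ⟨k, hk⟩ := ht (Units.mk0 a ha)
    have := congrArg Units.val hk
    simpa [h] using this.symm
  have ht0 : (t : F) ≠ 0 := t.ne_zero
  have hβ0 : (t : F) + (t : F)⁻¹ ≠ 0 := by
    intro h
    have : (t - 1 : F) ^ 2 = 0 := by field_simp at h; linear_combination h - t * two
    exact ht1 (sub_eq_zero.1 (pow_eq_zero_iff two_ne_zero |>.1 this))
  refine ⟨t + (t : F)⁻¹, 1 + t ^ 2, hβ0, ?_⟩
  have h0 := hasTransvection_evenForm_of_ne ht0 ht1 rfl
    (show ((t : F) + (t : F)⁻¹) * t = _ by field_simp; ring)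
  set β := (t : F) + (t : F)⁻¹ with hβ
  set γ := 1 + (t : F) ^ 2 with hγ
  have h2 := h0.map_doubleCycle.map_doubleCycle
  have h4 := by simpa using h0.map_doubleCycle.map_evenInvolution.map_doubleCycle
  have h5 := h4.map_doubleCycle
  -- transvections along vectors of the two hyperbolic planes
  have d1 : HasTransvection (evenForm F) (evenGroup β γ) ![β, 0, 1, 0, 1, 0] 1 := by
    simpa using h4.map_evenInvolution
  have d2 {a : F} (h : HasTransvection (evenForm F) (evenGroup β γ) ![β, 0, 1, 0, 1, 0] a) :
      HasTransvection (evenForm F) (evenGroup β γ) ![β, 0, 1, 0, 0, 0] a := by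
    simpa [neg, CharTwo.add_self_eq_zero] using h.transvect_even h4 rfl
  have d3 {a : F} (h : HasTransvection (evenForm F) (evenGroup β γ) ![β, 0, 1, 0, 0, 0] a) :
      HasTransvection (evenForm F) (evenGroup β γ) ![β, 0, 1, 0, 0, β] a := by
    simpa [neg] using h.transvect_even h5 rfl
  have d4 {a : F} (h : HasTransvection (evenForm F) (evenGroup β γ) ![β, 0, 1, 0, 0, β] a) :
      HasTransvection (evenForm F) (evenGroup β γ) ![0, 0, 1, 0, 0, β] a := by
    simpa [neg, CharTwo.add_self_eq_zero] using h.transvect_even h0 rfl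
  by_cases hβ1 : β = 1
  · have htt : (t : F) ^ 2 = t + 1 := by
      have : (t : F) + (t : F)⁻¹ = 1 := hβ1
      field_simp at this; linear_combination this - two
    have hγt : γ = t := by linear_combination htt + two
    have e1 : HasTransvection (evenForm F) (evenGroup β γ) ![γ, 0, β, 0, 0, 1] 1 := by
      simpa using h5.map_evenInvolution
    have e2 := (e1.exchange evenForm_isAlt evenGroup_isometry (d4 (d3 (d2 d1)))
      (by simp [evenForm_apply, hβ1, hγt])).2
    have e3 : HasTransvection (evenForm F) (evenGroup β γ) ![1, 0, 0, 0, 0, 0] t := by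
      have : ![γ, 0, β, 0, 0, 1] + ![0, 0, 1, 0, 0, β] = (t : F) • ![1, 0, 0, 0, 0, 0] := by
        ext i; fin_cases i <;> simp [hβ1, hγt, CharTwo.add_self_eq_zero]
      rw [this, hasTransvection_smul_iff] at e2
      convert e2 using 1
      simp [evenForm_apply, hβ1, hγt]
      field_simp
    have hpow (k : ℕ) : (t : F) ^ k = 1 ∨ (t : F) ^ k = t ∨ (t : F) ^ k = t + 1 := by
      induction k with
      | zero => simp
      | succ k ih => rw [pow_succ]; rcases ih with h | h | h <;> rw [h] <;> grind
    intro a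
    rcases eq_or_ne a 0 with rfl | ha
    · exact .zero _
    have := Fintype.ofFinite F
    obtain ⟨k, hk⟩ := mem_powers_iff_mem_zpowers.2 (ht (Units.mk0 a ha))
    have hk : (t : F) ^ k = a := by simpa using congrArg Units.val hk
    rw [← hk]
    rcases hpow k with h | h | h <;> rw [h]
    exacts [h0, e3, e3.add evenForm_isAlt h0]
  have d5 : HasTransvection (evenForm F) (evenGroup β γ) ![β, 0, 0, 0, 1, 0] 1 := by
    simpa [neg, CharTwo.add_self_eq_zero] using d1.transvect_even h2 rfl
  have d6 : HasTransvection (evenForm F) (evenGroup β γ) ![β, 0, 0, 0, 1, β] 1 := by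
    simpa [neg] using d5.transvect_even h5 rfl
  have d7 : HasTransvection (evenForm F) (evenGroup β γ) ![0, 0, 0, 0, 1, β] 1 := by
    simpa [neg, CharTwo.add_self_eq_zero] using d6.transvect_even h0 rfl
  have hμ0 : 1 + β ≠ 0 := fun h => hβ1 (by linear_combination h - two)
  have hm : IsFull (evenForm F) (evenGroup β γ) ![β, 0, 1, 0, 1, 0] := by
    set m : Fin 6 → F := ![β, 0, 1, 0, 1, 0] with hm
    set μ := (1 + β)⁻¹ with hμ
    have hμ' : (1 + β) * μ = 1 := mul_inv_cancel₀ hμ0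
    have hμ1 : μ ≠ 0 := inv_ne_zero hμ0
    have m1 : HasTransvection (evenForm F) (evenGroup β γ) (μ • m) 1 := by
      have hb : evenForm F ![0, 0, 0, 0, 1, β] ![β, 0, 1, 0, 0, β] = (1 + β) ^ 2 := by
        simp [evenForm_apply]
        linear_combination -(1 + β + β ^ 2) * two
      have h := (d7.exchange evenForm_isAlt evenGroup_isometry (d3 (d2 d1))
        (by rw [hb]; exact pow_ne_zero 2 hμ0)).2
      rw [hb, ← inv_pow] at h
      rw [hasTransvection_smul_iff, mul_one]
      convert h using 1
      ext i; fin_cases i <;> simp [hm, CharTwo.add_self_eq_zero]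
    have hB : evenForm F m ![0, 0, 0, 0, 0, 1] ≠ 0 := by simpa [evenForm_apply, hm] using hβ0
    obtain ⟨⟨g, hg, hg'⟩, -⟩ := d1.exchange evenForm_isAlt evenGroup_isometry h5 hB
    obtain ⟨⟨g₁, hg₁, hg₁'⟩, -⟩ := m1.exchange evenForm_isAlt evenGroup_isometry h5
      (by simpa [hμ1] using hB)
    have hgm : (g⁻¹ * g₁) (μ • m) = m := by
      rw [LinearEquiv.mul_apply, hg₁', ← hg', ← LinearEquiv.mul_apply, inv_mul_cancel]; rfl
    have hmul (a : F) (ha : HasTransvection (evenForm F) (evenGroup β γ) m a) :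
        HasTransvection (evenForm F) (evenGroup β γ) m ((1 + β) ^ 2 * a) := by
      rw [← hasTransvection_smul_iff]
      convert ha.map evenGroup_isometry (mul_mem (inv_mem hg) hg₁) using 1
      conv_lhs => rw [← hgm, map_smul, smul_smul, hμ', one_smul]
    let S : AddSubgroup F :=
      { carrier := {a | HasTransvection (evenForm F) (evenGroup β γ) m (a ^ 2)}
        zero_mem' := by simpa using HasTransvection.zero m
        add_mem' := fun {a b} ha hb => by
          simpa only [Set.mem_ofPred_eq, CharTwo.add_sq] using ha.add evenForm_isAlt hb
        neg_mem' := fun {a} ha => by simpa only [Set.mem_ofPred_eq, neg_sq] using ha }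
    have hS : S = ⊤ := by
      refine AddSubgroup.eq_top_of_mul_mem (b := β) (by simpa [S] using d1) (fun a ha => ?_)
        (closure_add_inv_eq_top ht hβ1)
      have := (hmul _ ha).add evenForm_isAlt ha
      simp only [S, AddSubgroup.mem_mk]
      change HasTransvection _ _ _ _
      convert this using 1
      linear_combination -(a ^ 2 + β * a ^ 2) * two
    intro a
    obtain ⟨b, rfl⟩ : ∃ b, b ^ 2 = a := by
      obtain ⟨b, hb⟩ := isSquare_of_charTwo' a
      exact ⟨b, by rw [hb, pow_two]⟩
    have : b ∈ S := hS ▸ AddSubgroup.mem_top b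
    exact this
  have m1 : IsFull (evenForm F) (evenGroup β γ) ![β, 0, 1, 0, 0, 0] := fun a => d2 (hm a)
  have m2 : IsFull (evenForm F) (evenGroup β γ) ![0, 0, 1, 0, 0, β] := fun a => d4 (d3 (m1 a))
  have m3 : IsFull (evenForm F) (evenGroup β γ) ![1, 0, 0, 0, 0, 1] := by
    refine .of_smul hβ0 ?_
    simpa [CharTwo.add_self_eq_zero] using m1.add_even m2 (by simpa using hβ0)
  intro a
  simpa [neg, CharTwo.add_self_eq_zero] using (m3 a).transvect_even h5 rfl

theorem exists_generators_of_charP_two [Finite F] :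
    ∃ g h : Matrix.symplecticGroup (Fin 3) F ⧸
        Subgroup.center (Matrix.symplecticGroup (Fin 3) F),
      orderOf g = 2 ∧ orderOf h = 3 ∧
        Subgroup.closure {g, h} = (⊤ : Subgroup (Matrix.symplecticGroup (Fin 3) F ⧸
          Subgroup.center (Matrix.symplecticGroup (Fin 3) F))) := by
  obtain ⟨β, γ, hβ, h⟩ := exists_isFull_evenForm (F := F)
  let ψ : (Fin 6 → F) ≃ₗ[F] (Fin 3 ⊕ Fin 3 → F) :=
    { toFun u := Sum.elim ![u 5, u 4, u 3] ![u 0, u 2, u 1]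
      invFun v := ![v (.inr 0), v (.inr 2), v (.inr 1), v (.inl 2), v (.inl 1), v (.inl 0)]
      map_add' u v := by ext (i | i) <;> fin_cases i <;> rfl
      map_smul' c u := by ext (i | i) <;> fin_cases i <;> rfl
      left_inv u := by ext i; fin_cases i <;> rfl
      right_inv u := by ext (i | i) <;> fin_cases i <;> rfl }
  refine exists_generators_of_isFull evenForm_isAlt ψ (fun u v => ?_) (evenInvolution β γ)
    (doubleCycle F) (evenForm_evenInvolution β γ) evenForm_doubleCycle (ε := 1) (fun u => ?_)
    doubleCycle_cube (u₀ := ![1, 0, 0, 0, 0, 0]) (fun h => ?_)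
    (fun hBn _ => isFull_evenForm hβ h hBn)
  · simp [ψ, Matrix.J, evenForm_apply, Fin.sum_univ_three, dotProduct, Matrix.mulVec, Matrix.one_apply]
    ring
  · have two := CharTwo.two_eq_zero (R := F)
    ext i; fin_cases i <;> simp [evenInvolution_apply] <;> grind
  · have := congrFun h 1
    simp [evenInvolution_apply, doubleCycle_apply] at this

end Even

section Odd

variable {F : Type*} [Field F] (d κ α β γ : F)

/-- An alternating form on `F⁶` invariant under `doubleCycle F`. -/
def oddForm : (Fin 6 → F) →ₗ[F] (Fin 6 → F) →ₗ[F] F :=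
  LinearMap.mk₂ F (fun u v => (u 0 * v 1 - u 1 * v 0) + (u 1 * v 2 - u 2 * v 1) +
      (u 2 * v 0 - u 0 * v 2) + (1 - d - (d + 2) * κ) * ((u 3 * v 4 - u 4 * v 3) +
      (u 4 * v 5 - u 5 * v 4) + (u 5 * v 3 - u 3 * v 5)) +
      (u 0 * (v 3 + d * v 4 + v 5) - (u 3 + d * u 4 + u 5) * v 0) +
      (u 1 * (v 3 + v 4 + d * v 5) - (u 3 + u 4 + d * u 5) * v 1) +
      (u 2 * (d * v 3 + v 4 + v 5) - (d * u 3 + u 4 + u 5) * v 2))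
    (fun u v w => by simp only [Pi.add_apply]; ring)
    (fun c u v => by simp only [Pi.smul_apply, smul_eq_mul]; ring)
    (fun u v w => by simp only [Pi.add_apply]; ring)
    (fun c u v => by simp only [Pi.smul_apply, smul_eq_mul]; ring)

theorem oddForm_apply (u v : Fin 6 → F) : oddForm d κ u v =
    (u 0 * v 1 - u 1 * v 0) + (u 1 * v 2 - u 2 * v 1) +
      (u 2 * v 0 - u 0 * v 2) + (1 - d - (d + 2) * κ) * ((u 3 * v 4 - u 4 * v 3) +
      (u 4 * v 5 - u 5 * v 4) + (u 5 * v 3 - u 3 * v 5)) +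
      (u 0 * (v 3 + d * v 4 + v 5) - (u 3 + d * u 4 + u 5) * v 0) +
      (u 1 * (v 3 + v 4 + d * v 5) - (u 3 + u 4 + d * u 5) * v 1) +
      (u 2 * (d * v 3 + v 4 + v 5) - (d * u 3 + u 4 + u 5) * v 2) := rfl

theorem oddForm_isAlt : (oddForm d κ).IsAlt := fun u => by rw [oddForm_apply]; ring

theorem oddForm_doubleCycle (u v : Fin 6 → F) :
    oddForm d κ (doubleCycle F u) (doubleCycle F v) = oddForm d κ u v := by
  simp [oddForm_apply, doubleCycle_apply]; ring

/-- A linear map which squares to `-1` and preserves `oddForm` if `α ^ 2 + β * γ = -1`. -/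
def oddMap : (Fin 6 → F) →ₗ[F] (Fin 6 → F) where
  toFun u := ![
    u 1 + u 4 * ((κ + d - 1) * (1 + β) - κ * α) - u 5 * ((κ + d - 1) * α + κ * (γ + 1)),
    -u 0 + u 4 * (-κ * (α - β + 1) + (1 - d) * α) +
      u 5 * (d - 1 - κ * (γ + α) + κ + γ - d * γ),
    -u 3 - u 4 * (1 + κ * (α - β)) - u 5 * (1 + κ * (γ + α)),
    u 2 + u 4 * (κ - α - β) + u 5 * (α - κ - γ),
    u 4 * α + u 5 * γ,
    u 4 * β - u 5 * α]
  map_add' u v := by ext i; fin_cases i <;> simp <;> ring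
  map_smul' c u := by ext i; fin_cases i <;> simp <;> ring

theorem oddMap_apply (u : Fin 6 → F) : oddMap d κ α β γ u = ![
    u 1 + u 4 * ((κ + d - 1) * (1 + β) - κ * α) - u 5 * ((κ + d - 1) * α + κ * (γ + 1)),
    -u 0 + u 4 * (-κ * (α - β + 1) + (1 - d) * α) +
      u 5 * (d - 1 - κ * (γ + α) + κ + γ - d * γ),
    -u 3 - u 4 * (1 + κ * (α - β)) - u 5 * (1 + κ * (γ + α)),
    u 2 + u 4 * (κ - α - β) + u 5 * (α - κ - γ),
    u 4 * α + u 5 * γ,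
    u 4 * β - u 5 * α] := rfl

variable {α β γ}

theorem oddMap_oddMap (h : α ^ 2 + β * γ = -1) (u : Fin 6 → F) :
    oddMap d κ α β γ (oddMap d κ α β γ u) = -u := by
  simp only [oddMap_apply]
  ext i; fin_cases i <;> simp <;> grind

theorem oddForm_oddMap (h : α ^ 2 + β * γ = -1) (u v : Fin 6 → F) :
    oddForm d κ (oddMap d κ α β γ u) (oddMap d κ α β γ v) = oddForm d κ u v := by
  simp [oddForm_apply, oddMap_apply]
  grind

/-- `oddMap` as an automorphism of `F⁶`. -/
def oddEquiv (h : α ^ 2 + β * γ = -1) : (Fin 6 → F) ≃ₗ[F] (Fin 6 → F) :=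
  .ofLinearMap (oddMap d κ α β γ) (-oddMap d κ α β γ)
    (LinearMap.ext fun u => by simp [oddMap_oddMap d κ h])
    (LinearMap.ext fun u => by simp [oddMap_oddMap d κ h])

theorem oddEquiv_apply (h : α ^ 2 + β * γ = -1) (u : Fin 6 → F) :
    oddEquiv d κ h u = oddMap d κ α β γ u := rfl

/-- The group generated by `oddEquiv` and `doubleCycle`. -/
def oddGroup (h : α ^ 2 + β * γ = -1) : Subgroup ((Fin 6 → F) ≃ₗ[F] (Fin 6 → F)) :=
  Subgroup.closure {oddEquiv d κ h, doubleCycle F}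

variable {d κ}

theorem oddEquiv_mem (h : α ^ 2 + β * γ = -1) : oddEquiv d κ h ∈ oddGroup d κ h :=
  Subgroup.subset_closure (by simp)

theorem doubleCycle_mem_oddGroup (h : α ^ 2 + β * γ = -1) : doubleCycle F ∈ oddGroup d κ h :=
  Subgroup.subset_closure (by simp)

/-- Under the stated conditions the generated group contains all transvections as soon as it contains
one along `e₀`. -/
theorem isFull_oddForm [Finite F] {n : ℕ} (hn : (n : F) * 2 = 1) (h : α ^ 2 + β * γ = -1)
    (hd : Subfield.closure {d + 2} = ⊤)
    (he : HasTransvection (oddForm d κ) (oddGroup d κ h) ![1, 0, 0, 0, 0, 0] 1)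
    (hBn : ∀ v, (∀ u, oddForm d κ v u = 0) → v = 0)
    (hH : ∀ g ∈ oddGroup d κ h, ∀ u v, oddForm d κ (g u) (g v) = oddForm d κ u v)
    (v : Fin 6 → F) : IsFull (oddForm d κ) (oddGroup d κ h) v := by
  have hy {u₀ u₁ u₂ u₃ u₄ u₅ a : F}
      (hu : HasTransvection (oddForm d κ) (oddGroup d κ h) ![u₀, u₁, u₂, u₃, u₄, u₅] a) :
      HasTransvection (oddForm d κ) (oddGroup d κ h) ![u₂, u₀, u₁, u₅, u₃, u₄] a :=
    hu.map hH (doubleCycle_mem_oddGroup h)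
  have hx {u : Fin 6 → F} {a : F} (hu : HasTransvection (oddForm d κ) (oddGroup d κ h) u a) :
      HasTransvection (oddForm d κ) (oddGroup d κ h) (oddMap d κ α β γ u) a :=
    hu.map hH (oddEquiv_mem h)
  have step {a : F} (h0 : HasTransvection (oddForm d κ) (oddGroup d κ h) ![1, 0, 0, 0, 0, 0] a) :
      HasTransvection (oddForm d κ) (oddGroup d κ h) ![0, 1, 0, 0, 0, 0] a ∧
      HasTransvection (oddForm d κ) (oddGroup d κ h) ![0, 0, 1, 0, 0, 0] a ∧
      HasTransvection (oddForm d κ) (oddGroup d κ h) ![0, 0, 0, 1, 0, 0] a ∧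
      HasTransvection (oddForm d κ) (oddGroup d κ h) ![0, 0, 0, 0, 1, 0] a ∧
      HasTransvection (oddForm d κ) (oddGroup d κ h) ![0, 0, 0, 0, 0, 1] a := by
    have h2 := hy (hy h0)
    have h3 : HasTransvection (oddForm d κ) (oddGroup d κ h) ![0, 0, 0, 1, 0, 0] a := by
      simpa [oddMap_apply] using hx h2
    exact ⟨hy h0, h2, h3, hy h3, hy (hy h3)⟩
  obtain ⟨h1, h2, h3, -⟩ := step he
  have hr : HasTransvection (oddForm d κ) (oddGroup d κ h) ![0, 1, 1, 0, 0, 0] 1 := by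
    convert h2.transvect hH h1 using 1
    simp [oddForm_apply]
  have hs : HasTransvection (oddForm d κ) (oddGroup d κ h) ![0, -1, 0, 1, 0, 0] 1 := by
    convert h3.transvect hH (h1.neg (oddForm_isAlt d κ)) using 1
    simp [oddForm_apply]
  have hfull : IsFull (oddForm d κ) (oddGroup d κ h) ![1, 0, 0, 0, 0, 0] :=
    isFull_of_siegel (oddForm_isAlt d κ) hH hn (f := ![0, 1, 0, 0, 0, 0])
      (r := ![1, 1, 1, 0, 0, 0]) (s := ![1, -1, 0, 1, 0, 0]) (by simp [oddForm_apply]) he h1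
      (by simp [oddForm_apply]) (by simp [oddForm_apply]) (by simp [oddForm_apply])
      (by simp [oddForm_apply])
      (by convert hr using 1; simp) (by convert hs using 1; simp)
      (by convert hd using 3; simp [oddForm_apply]; ring)
  have hf1 := fun a => (step (hfull a)).1
  have hneg : (-1 : F) ≠ 1 := fun h' => by grind
  refine isFull_of_span (oddForm_isAlt d κ) hBn hH (k := -1) (by simp) hneg
    (e := ![1, 0, 0, 0, 0, 0]) (f := ![0, 1, 0, 0, 0, 0]) (by simp [oddForm_apply]) hfull hf1 ?_ v
  refine eq_top_iff.2 fun u _ => ?_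
  have hu : u = u 0 • ![1, 0, 0, 0, 0, 0] + u 1 • ![0, 1, 0, 0, 0, 0] + u 2 • ![0, 0, 1, 0, 0, 0] +
      u 3 • ![0, 0, 0, 1, 0, 0] + u 4 • ![0, 0, 0, 0, 1, 0] + u 5 • ![0, 0, 0, 0, 0, 1] := by
    ext i; fin_cases i <;> simp
  rw [hu]
  refine add_mem (add_mem (add_mem (add_mem (add_mem ?_ ?_) ?_) ?_) ?_) ?_ <;>
    refine Submodule.smul_mem _ _ (Submodule.subset_span ⟨fun a => ?_, ?_⟩)
  · exact hfull a
  · simp [oddForm_apply]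
  · exact (step (hfull a)).1
  · simp [oddForm_apply]
  · exact (step (hfull a)).2.1
  · simp [oddForm_apply]
  · exact (step (hfull a)).2.2.1
  · simp [oddForm_apply]
  · exact (step (hfull a)).2.2.2.1
  · simp [oddForm_apply]
  · exact (step (hfull a)).2.2.2.2
  · simp [oddForm_apply]

/-- The group generated by `oddEquiv` and `doubleCycle` is the whole isometry group as soon as it
contains a transvection along `e₀`, provided `d + 2` generates the field. -/
theorem exists_generators_of_oddForm [Finite F] {n : ℕ} (hn : (n : F) * 2 = 1)
    (h : α ^ 2 + β * γ = -1) (hd : Subfield.closure {d + 2} = ⊤) (hd2 : d + 2 ≠ 0)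
    (hc : 1 - d - 3 * κ ≠ 0)
    (he : HasTransvection (oddForm d κ) (oddGroup d κ h) ![1, 0, 0, 0, 0, 0] 1) :
    ∃ g h : Matrix.symplecticGroup (Fin 3) F ⧸
        Subgroup.center (Matrix.symplecticGroup (Fin 3) F),
      orderOf g = 2 ∧ orderOf h = 3 ∧
        Subgroup.closure {g, h} = (⊤ : Subgroup (Matrix.symplecticGroup (Fin 3) F ⧸
          Subgroup.center (Matrix.symplecticGroup (Fin 3) F))) := by
  have hc' : (d + 2) * (1 - d - 3 * κ) ≠ 0 := mul_ne_zero hd2 hc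
  let ψ : (Fin 6 → F) ≃ₗ[F] (Fin 3 ⊕ Fin 3 → F) :=
    { toFun u := Sum.elim
        ![u 1 - u 2 + u 3 + d * u 4 + u 5, (d + 2) * (u 3 + u 4 + u 5),
          (d + 2) * (1 - d - 3 * κ) * u 5]
        ![u 0 - u 2 - u 3 - u 4 - d * u 5, u 2 + κ * u 4 - κ * u 5, u 4]
      invFun v :=
        let u₅ := v (.inl 2) / ((d + 2) * (1 - d - 3 * κ))
        let u₄ := v (.inr 2)
        let u₃ := v (.inl 1) / (d + 2) - u₄ - u₅
        let u₂ := v (.inr 1) - κ * u₄ + κ * u₅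
        ![v (.inr 0) + u₂ + u₃ + u₄ + d * u₅, v (.inl 0) + u₂ - u₃ - d * u₄ - u₅, u₂, u₃, u₄, u₅]
      map_add' u v := by ext (i | i) <;> fin_cases i <;> simp <;> ring
      map_smul' c u := by ext (i | i) <;> fin_cases i <;> simp <;> ring
      left_inv u := by ext i; fin_cases i <;> simp [hc', hd2] <;> ring
      right_inv u := by
        ext (i | i) <;> fin_cases i <;> simp [mul_div_cancel₀ _ hc'] <;> field_simp <;> ring }
  refine exists_generators_of_isFull (oddForm_isAlt d κ) ψ (fun u v => ?_) (oddEquiv d κ h)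
    (doubleCycle F) (oddForm_oddMap d κ h) (oddForm_doubleCycle d κ) (ε := -1)
    (fun u => (oddMap_oddMap d κ h u).trans (neg_one_smul F u).symm)
    doubleCycle_cube (u₀ := ![1, 0, 0, 0, 0, 0]) (fun h' => ?_)
    (fun hBn hH => isFull_oddForm hn h hd he hBn hH)
  · simp [ψ, Matrix.J, oddForm_apply, Matrix.fromBlocks, Fin.sum_univ_three, dotProduct,
      Matrix.mulVec, Matrix.one_apply]
    ring
  · have := congrFun h' 0
    simp [oddEquiv_apply, oddMap_apply, doubleCycle_apply] at this

set_option maxHeartbeats 1000000 in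
/-- A power of `oddEquiv * doubleCycle` is a transvection along `e₀` for `α = 0` and generic `β, γ, κ`. -/
theorem hasTransvection_oddForm [Finite F] (p : ℕ) [Fact p.Prime] [CharP F p]
    (h : (0 : F) ^ 2 + β * γ = -1) (hs : (κ - 1) ^ 2 ≠ 4) (ht : (γ - β) ^ 2 ≠ 4)
    (hst : κ - 1 ≠ γ - β) :
    HasTransvection (oddForm (4 - 2 * κ) κ) (oddGroup (4 - 2 * κ) κ h) ![1, 0, 0, 0, 0, 0] 1 := by
  refine hasTransvection_of_quadratics p (oddForm_isAlt (4 - 2 * κ) κ)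
    (mul_mem (oddEquiv_mem h) (doubleCycle_mem_oddGroup h)) (fun u v => ?_) ?_ 1 hs ht hst
    (fun u => ![
      u 0 - u 1 + u 2 + (-κ * β - κ + 3 * β + 2) * u 3 + (-κ * γ + κ - 4) * u 4 - u 5,
      -u 2 + (κ * β - κ) * u 3 + (κ * γ - κ - 3 * γ + 3) * u 4,
      (κ * β - 1) * u 3 + (-κ * γ - 1) * u 4 - u 5,
      u 1 + (κ - β) * u 3 + (-κ - γ) * u 4,
      γ * u 4,
      β * u 3]) (fun u => ?_)
    (fun u => ![
      (β - γ + 2) * u 0 + (-κ * β - κ + 2 * β + γ + 1) * u 1 + (β - γ + 2) * u 2 +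
        (-κ ^ 2 * β - κ ^ 2 + 2 * κ * β + κ * γ + κ + 2 * β - 2 * γ + 4) * u 3 +
        (κ ^ 2 * β + κ ^ 2 - 2 * κ * β - 2 * κ * γ - 4 * β + γ - 5) * u 4 + (-β + γ - 2) * u 5,
      (κ * β - κ + 1) * u 1 + (-β + γ) * u 2 + (κ ^ 2 * β - κ ^ 2 - κ * β + κ * γ + κ + 1) * u 3 +
        (-κ ^ 2 * β + κ ^ 2 - κ * β + 2 * κ * γ + 3 * β + 4) * u 4 + u 5,
      (κ * β - 1) * u 1 + u 2 + (κ ^ 2 * β - β + γ) * u 3 + (-κ ^ 2 * β + 3 * κ - β + γ) * u 4 +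
        (-β + γ) * u 5,
      (κ - γ) * u 1 - u 2 + (κ ^ 2 - κ * γ - κ) * u 3 + (-κ ^ 2 - κ - 3 * γ + 3) * u 4,
      0,
      β * u 1 + (κ * β + 1) * u 3 + (-κ * β + 1) * u 4 + u 5])
    (fun u => ![
      (-κ * β + κ * γ - 2 * κ + 3 * β - 3 * γ + 6) * u 0 + (-κ * β - κ + 3 * β + 3) * u 1 +
        (κ * γ - κ - 3 * γ + 3) * u 2 + (-2 * κ * β + κ * γ - 3 * κ + 6 * β - 3 * γ + 9) * u 3 +
        (2 * κ ^ 2 * β + 2 * κ ^ 2 * γ - 5 * κ * β - 5 * κ * γ - 3 * β - 3 * γ) * u 4 +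
        (κ * β - 2 * κ * γ + 3 * κ - 3 * β + 6 * γ - 9) * u 5,
      (κ * γ - κ + β - γ + 2) * u 1 + (-κ * γ + κ - β + γ - 2) * u 2 +
        (κ * γ - κ + β - γ + 2) * u 3 +
        (-2 * κ ^ 2 * γ + 2 * κ ^ 2 - 2 * κ * β + 6 * κ * γ - 8 * κ + 4 * β - 4 * γ + 8) * u 4 +
        (κ * γ - κ + β - γ + 2) * u 5,
      (κ * β + κ - β + γ - 2) * u 1 + (-κ * β - κ + β - γ + 2) * u 2 +
        (κ * β + κ - β + γ - 2) * u 3 +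
        (-2 * κ ^ 2 * β - 2 * κ ^ 2 + 6 * κ * β - 2 * κ * γ + 8 * κ - 4 * β + 4 * γ - 8) * u 4 +
        (κ * β + κ - β + γ - 2) * u 5,
      (-γ + 1) * u 1 + (γ - 1) * u 2 + (-γ + 1) * u 3 + (2 * κ * γ - 2 * κ - 4 * γ + 4) * u 4 +
        (-γ + 1) * u 5,
      0,
      (β + 1) * u 1 + (-β - 1) * u 2 + (β + 1) * u 3 + (-2 * κ * β - 2 * κ + 4 * β + 4) * u 4 +
        (β + 1) * u 5])
    (fun u => ?_) (fun u => ?_) (fun u => ?_)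
  · simp only [LinearEquiv.mul_apply]
    exact (oddForm_oddMap _ κ h _ _).trans (oddForm_doubleCycle _ κ u v)
  · simp only [LinearEquiv.mul_apply, oddEquiv_apply]
    ext i; fin_cases i <;> simp [oddMap_apply, doubleCycle_apply]
  · simp only [LinearEquiv.mul_apply, oddEquiv_apply]
    ext i; fin_cases i <;> simp [oddMap_apply, doubleCycle_apply, oddForm_apply] <;> ring
  · ext i; fin_cases i <;> simp <;> grind
  · ext i; fin_cases i <;> simp <;> grind
  · ext i; fin_cases i <;> simp <;> grind

set_option maxHeartbeats 1000000 in
/-- The parameters used over the field with three elements. -/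
theorem hasTransvection_oddForm_of_charP_three [Finite F] [CharP F 3]
    (h : (-1 : F) ^ 2 + 1 * 1 = -1) :
    HasTransvection (oddForm (-1 : F) 0) (oddGroup (-1) 0 h) ![1, 0, 0, 0, 0, 0] 1 := by
  have three : (3 : F) = 0 := by exact_mod_cast CharP.cast_eq_zero F 3
  have : Fact (Nat.Prime 3) := ⟨Nat.prime_three⟩
  have h8 : ((8 : ℕ) : F) ≠ 0 := fun h8 => by
    rw [CharP.cast_eq_zero_iff F 3] at h8
    omega
  refine hasTransvection_of_squarefree 3 (oddForm_isAlt (-1) 0)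
    (mul_mem (oddEquiv_mem h) (doubleCycle_mem_oddGroup h)) (fun u v => ?_) ?_ 1
    (Polynomial.separable_X_pow_sub_C 1 h8 one_ne_zero).squarefree ?_
  · simp only [LinearEquiv.mul_apply]
    exact (oddForm_oddMap _ 0 h _ _).trans (oddForm_doubleCycle _ 0 u v)
  · simp only [LinearEquiv.mul_apply, oddEquiv_apply]
    ext i; fin_cases i <;> simp [oddMap_apply, doubleCycle_apply]
  · set L := (oddEquiv (-1) 0 h * doubleCycle F).toLinearMap -
      ((1 : F) • oddForm (-1 : F) 0 ![1, 0, 0, 0, 0, 0]).smulRight ![1, 0, 0, 0, 0, 0] with hL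
    have h1 (u) : L u = ![u 0 - u 1 + u 2 + u 3 - u 4 - u 5, -u 2 + u 3, -u 3 - u 4 - u 5,
        u 1 + u 4, -u 3 + u 4, u 3 + u 4] := by
      simp only [hL, LinearMap.sub_apply, LinearEquiv.coe_coe, LinearEquiv.mul_apply,
        oddEquiv_apply]
      ext i; fin_cases i <;> simp [oddMap_apply, doubleCycle_apply, oddForm_apply] <;> grind
    have h2 (u) : (L ^ 2) u = ![u 0 - u 2 - u 3 + u 5, u 1 + u 3 - u 4 + u 5, -u 1, -u 2 + u 4,
        -u 1 - u 3, u 1 - u 3 - u 4] := by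
      rw [pow_two, Module.End.mul_apply, h1, h1]
      ext i; fin_cases i <;> simp <;> grind
    have h4 (u) : (L ^ 4) u = ![u 0 - u 1 + u 3 + u 4 + u 5, -u 2 + u 3 - u 4 + u 5,
        -u 1 - u 3 + u 4 - u 5, -u 3, -u 1 + u 2 - u 3 - u 5, -u 1 + u 2 - u 3 + u 4 + u 5] := by
      rw [show 4 = 2 + 2 from rfl, pow_add, Module.End.mul_apply, h2, h2]
      ext i; fin_cases i <;> simp <;> grind
    have h8 : L ^ 8 = 1 := by
      refine LinearMap.ext fun u => ?_
      rw [show 8 = 4 + 4 from rfl, pow_add, Module.End.mul_apply, h4, h4]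
      ext i; fin_cases i <;> simp <;> grind
    simp [h8]

/-- The $(2,3)$-generation of $PSp_6(q)$ for odd `q`. -/
theorem exists_generators_of_odd [Finite F] (p : ℕ) [Fact p.Prime] [CharP F p] (hp : p ≠ 2) :
    ∃ g h : Matrix.symplecticGroup (Fin 3) F ⧸
        Subgroup.center (Matrix.symplecticGroup (Fin 3) F),
      orderOf g = 2 ∧ orderOf h = 3 ∧
        Subgroup.closure {g, h} = (⊤ : Subgroup (Matrix.symplecticGroup (Fin 3) F ⧸
          Subgroup.center (Matrix.symplecticGroup (Fin 3) F))) := by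
  obtain ⟨k, hk⟩ := (Fact.out : p.Prime).odd_of_ne_two hp
  have hn : ((k + 1 : ℕ) : F) * 2 = 1 := by
    have := CharP.cast_eq_zero F p
    rw [hk] at this
    push_cast at this ⊢
    linear_combination this
  have two : (2 : F) ≠ 0 := right_ne_zero_of_mul (hn.trans_ne one_ne_zero)
  have four : (4 : F) ≠ 0 := by
    rw [show (4 : F) = 2 * 2 by norm_num]
    exact mul_ne_zero two two
  have of_param (κ β γ : F) (h : (0 : F) ^ 2 + β * γ = -1)
      (htop : Subfield.closure {4 - 2 * κ + 2} = ⊤) (h0 : 4 - 2 * κ + 2 ≠ 0)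
      (h3 : 1 - (4 - 2 * κ) - 3 * κ ≠ 0) (hs : (κ - 1) ^ 2 ≠ 4) (ht : (γ - β) ^ 2 ≠ 4)
      (hst : κ - 1 ≠ γ - β) :=
    exists_generators_of_oddForm hn h htop h0 h3 (hasTransvection_oddForm p h hs ht hst)
  by_cases hbot : (⊥ : Subfield F) = ⊤
  · have htop (a : F) : Subfield.closure {a} = ⊤ := top_unique (hbot ▸ bot_le)
    by_cases three : (3 : F) = 0
    · have : CharP F 3 := (CharP.charP_iff_prime_eq_zero Nat.prime_three).2 (by exact_mod_cast three)
      have h : (-1 : F) ^ 2 + 1 * 1 = -1 := by linear_combination three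
      exact exists_generators_of_oddForm hn h (htop _) (by norm_num) (by norm_num [two])
        (hasTransvection_oddForm_of_charP_three h)
    · refine of_param 0 2⁻¹ (-2) (by field_simp; ring) (htop _) ?_ ?_ ?_ ?_ ?_
      · rw [show (4 - 2 * 0 + 2 : F) = 2 * 3 by norm_num]
        exact mul_ne_zero two three
      · intro h; apply three; linear_combination -h
      · intro h; apply three; linear_combination -h
      · intro h
        field_simp at h
        apply mul_ne_zero three three
        linear_combination h
      · intro h
        field_simp at h
        apply three
        linear_combination h
  · obtain ⟨κ, hκ⟩ := IsCyclic.exists_generator (α := Fˣ)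
    have htop {K : Subfield F} (hK : (κ : F) ∈ K) : K = ⊤ := by
      refine eq_top_iff.2 fun a _ => ?_
      by_cases ha : a = 0
      · exact ha ▸ K.zero_mem
      · obtain ⟨n, hn⟩ := Subgroup.mem_zpowers_iff.1 (hκ (Units.mk0 a ha))
        rw [← Units.val_mk0 ha, ← hn, Units.val_zpow_eq_zpow_val]
        exact zpow_mem hK n
    have hne (m : ℤ) : (κ : F) ≠ m := fun h => hbot (htop (h ▸ intCast_mem _ m))
    have h1 : (κ : F) - 1 ≠ 0 := sub_ne_zero.2 (by simpa using hne 1)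
    have h2 : (κ : F) + 1 ≠ 0 := fun h => hne (-1) (by push_cast; linear_combination h)
    have h3 : (κ : F) - 3 ≠ 0 := sub_ne_zero.2 (by simpa using hne 3)
    have h4 : (κ : F) + 3 ≠ 0 := fun h => hne (-3) (by push_cast; linear_combination h)
    have h0 : (κ : F) ≠ 0 := κ.ne_zero
    refine of_param κ (-(κ : F)⁻¹) κ (by field_simp; ring) (htop ?_) ?_ ?_ ?_ ?_ ?_
    · have h6 : (4 - 2 * κ + 2 : F) ∈ Subfield.closure {(4 - 2 * κ + 2 : F)} :=
        Subfield.subset_closure rfl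
      have := div_mem (sub_mem (ofNat_mem _ 6) h6) (ofNat_mem _ 2)
      convert this
      field_simp
      ring
    · rw [show (4 - 2 * κ + 2 : F) = -2 * (κ - 3) by ring]
      exact mul_ne_zero (neg_ne_zero.2 two) h3
    · intro h; apply h4; linear_combination -h
    · intro h
      apply mul_ne_zero h3 h2
      linear_combination h
    · intro h
      field_simp at h
      apply pow_ne_zero 2 (mul_ne_zero h1 h2)
      linear_combination h
    · intro h
      field_simp at h
      apply h2
      linear_combination -h

end Odd

/-- **The $(2,3)$-generation of $PSp_6(q)$.** For every prime power `q`, the projective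
symplectic group `PSp_6(q)`, i.e. the quotient of the symplectic group `Sp_6(q)` of `6×6`
matrices over `F_q` preserving a fixed nondegenerate alternating bilinear form by its
center, is generated by an element of order `2` together with an element of order `3`. -/
theorem PSp6_is_two_three_generated (q : ℕ) (hq : IsPrimePow q) (F : Type) [Field F] [Fintype F]
    (hF : Fintype.card F = q) :
    ∃ g h : Matrix.symplecticGroup (Fin 3) F ⧸
        Subgroup.center (Matrix.symplecticGroup (Fin 3) F),
      orderOf g = 2 ∧ orderOf h = 3 ∧
        Subgroup.closure {g, h} = (⊤ : Subgroup (Matrix.symplecticGroup (Fin 3) F ⧸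
          Subgroup.center (Matrix.symplecticGroup (Fin 3) F))) := by
  obtain ⟨p, hp⟩ := CharP.exists F
  have : Fact p.Prime := ⟨CharP.char_is_prime F p⟩
  by_cases h2 : p = 2
  · subst h2
    exact exists_generators_of_charP_two
  · exact exists_generators_of_odd p h2
end

section
/- For every odd prime power q, the group Ω_7(q) — realized as the commutator subgroup of the orthogonal group O_7(q) of 7×7 matrices over F_q preserving the standard symmetric bilinear form (Mathlib's Matrix.orthogonalGroup (Fin 7) F_q) — is (2,3)-generated. -/
attribute [local instance] starRingOfComm

/-- Coordinate vectors of a seven-dimensional quadratic space: three hyperbolic planes with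
coordinates `(aᵢ, bᵢ)` and an anisotropic line with coordinate `z`. -/
@[ext]
structure QuadSpace (F : Type) where
  a1 : F
  a2 : F
  a3 : F
  b1 : F
  b2 : F
  b3 : F
  z : F

namespace QuadSpace

open Equiv
open scoped commutatorElement

section Rotation

variable {F : Type}

/-- The cyclic permutation of the three hyperbolic planes. -/
def cyc : Perm (QuadSpace F) where
  toFun v := ⟨v.a3, v.a1, v.a2, v.b3, v.b1, v.b2, v.z⟩
  invFun v := ⟨v.a2, v.a3, v.a1, v.b2, v.b3, v.b1, v.z⟩
  left_inv _ := rfl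
  right_inv _ := rfl

theorem cyc_apply (v : QuadSpace F) : cyc v = ⟨v.a3, v.a1, v.a2, v.b3, v.b1, v.b2, v.z⟩ := rfl

theorem cyc_inv_apply (v : QuadSpace F) : cyc⁻¹ v = ⟨v.a2, v.a3, v.a1, v.b2, v.b3, v.b1, v.z⟩ := rfl

/-- Conjugation by the cyclic permutation of the hyperbolic planes. -/
def rot (g : Perm (QuadSpace F)) : Perm (QuadSpace F) := cyc * g * cyc⁻¹

theorem rot_apply (g : Perm (QuadSpace F)) (v : QuadSpace F) :
    rot g v = cyc (g (cyc⁻¹ v)) := rfl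

theorem rot_inv_apply (g : Perm (QuadSpace F)) (v : QuadSpace F) :
    (rot g)⁻¹ v = cyc (g⁻¹ (cyc⁻¹ v)) := rfl

theorem rot_rot_rot (g : Perm (QuadSpace F)) : rot (rot (rot g)) = g := rfl

end Rotation

section Ring

variable {F : Type} [CommRing F]

/-- The polar form of the quadratic form `a₁b₁ + a₂b₂ + a₃b₃ - z²`. -/
def polar (v w : QuadSpace F) : F :=
  v.a1 * w.b1 + v.b1 * w.a1 + v.a2 * w.b2 + v.b2 * w.a2 + v.a3 * w.b3 + v.b3 * w.a3
    - 2 * (v.z * w.z)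

/-- The isometry group of the polar form. -/
def isometries (F : Type) [CommRing F] : Subgroup (Perm (QuadSpace F)) where
  carrier := {f | ∀ v w, polar (f v) (f w) = polar v w}
  one_mem' _ _ := rfl
  mul_mem' {f g} hf hg v w := by rw [Perm.mul_apply, Perm.mul_apply, hf, hg]
  inv_mem' {f} hf v w := by
    change polar (f.symm v) (f.symm w) = _
    rw [← hf, apply_symm_apply, apply_symm_apply]

/-- The product of the root elements for the short root `ε₁` and the long root `-ε₂ - ε₃`. -/
def P (s t : F) : Perm (QuadSpace F) where
  toFun v := ⟨v.a1 + 2 * s * v.z + s ^ 2 * v.b1, v.a2, v.a3,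
    v.b1, v.b2 + t * v.a3, v.b3 - t * v.a2, v.z + s * v.b1⟩
  invFun v := ⟨v.a1 - 2 * s * v.z + s ^ 2 * v.b1, v.a2, v.a3,
    v.b1, v.b2 - t * v.a3, v.b3 + t * v.a2, v.z - s * v.b1⟩
  left_inv v := by ext <;> dsimp only <;> ring
  right_inv v := by ext <;> dsimp only <;> ring

/-- The product of the root elements for the short root `-ε₁` and the long root `ε₂ + ε₃`. -/
def Q (s t : F) : Perm (QuadSpace F) where
  toFun v := ⟨v.a1, v.a2 + t * v.b3, v.a3 - t * v.b2,
    v.b1 + 2 * s * v.z + s ^ 2 * v.a1, v.b2, v.b3, v.z + s * v.a1⟩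
  invFun v := ⟨v.a1, v.a2 - t * v.b3, v.a3 + t * v.b2,
    v.b1 - 2 * s * v.z + s ^ 2 * v.a1, v.b2, v.b3, v.z - s * v.a1⟩
  left_inv v := by ext <;> dsimp only <;> ring
  right_inv v := by ext <;> dsimp only <;> ring

/-- The root element for the long root `ε₁ - ε₂`. -/
def E (t : F) : Perm (QuadSpace F) where
  toFun v := ⟨v.a1 + t * v.a2, v.a2, v.a3, v.b1, v.b2 - t * v.b1, v.b3, v.z⟩
  invFun v := ⟨v.a1 - t * v.a2, v.a2, v.a3, v.b1, v.b2 + t * v.b1, v.b3, v.z⟩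
  left_inv v := by ext <;> dsimp only <;> ring
  right_inv v := by ext <;> dsimp only <;> ring

/-- The root element for the long root `ε₁ - ε₃`. -/
def E' (t : F) : Perm (QuadSpace F) where
  toFun v := ⟨v.a1 + t * v.a3, v.a2, v.a3, v.b1, v.b2, v.b3 - t * v.b1, v.z⟩
  invFun v := ⟨v.a1 - t * v.a3, v.a2, v.a3, v.b1, v.b2, v.b3 + t * v.b1, v.z⟩
  left_inv v := by ext <;> dsimp only <;> ring
  right_inv v := by ext <;> dsimp only <;> ring

/-- The involution negating the second and third hyperbolic planes. -/
def D : Perm (QuadSpace F) where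
  toFun v := ⟨v.a1, -v.a2, -v.a3, v.b1, -v.b2, -v.b3, v.z⟩
  invFun v := ⟨v.a1, -v.a2, -v.a3, v.b1, -v.b2, -v.b3, v.z⟩
  left_inv v := by ext <;> dsimp only <;> ring
  right_inv v := by ext <;> dsimp only <;> ring

section apply

variable (s t : F) (v : QuadSpace F)

theorem P_apply : P s t v = ⟨v.a1 + 2 * s * v.z + s ^ 2 * v.b1, v.a2, v.a3,
    v.b1, v.b2 + t * v.a3, v.b3 - t * v.a2, v.z + s * v.b1⟩ := rfl

theorem P_inv_apply : (P s t)⁻¹ v = ⟨v.a1 - 2 * s * v.z + s ^ 2 * v.b1, v.a2, v.a3,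
    v.b1, v.b2 - t * v.a3, v.b3 + t * v.a2, v.z - s * v.b1⟩ := rfl

theorem Q_apply : Q s t v = ⟨v.a1, v.a2 + t * v.b3, v.a3 - t * v.b2,
    v.b1 + 2 * s * v.z + s ^ 2 * v.a1, v.b2, v.b3, v.z + s * v.a1⟩ := rfl

theorem Q_inv_apply : (Q s t)⁻¹ v = ⟨v.a1, v.a2 - t * v.b3, v.a3 + t * v.b2,
    v.b1 - 2 * s * v.z + s ^ 2 * v.a1, v.b2, v.b3, v.z - s * v.a1⟩ := rfl

theorem E_apply : E t v =
    ⟨v.a1 + t * v.a2, v.a2, v.a3, v.b1, v.b2 - t * v.b1, v.b3, v.z⟩ := rfl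

theorem E_inv_apply : (E t)⁻¹ v =
    ⟨v.a1 - t * v.a2, v.a2, v.a3, v.b1, v.b2 + t * v.b1, v.b3, v.z⟩ := rfl

theorem E'_apply : E' t v =
    ⟨v.a1 + t * v.a3, v.a2, v.a3, v.b1, v.b2, v.b3 - t * v.b1, v.z⟩ := rfl

theorem E'_inv_apply : (E' t)⁻¹ v =
    ⟨v.a1 - t * v.a3, v.a2, v.a3, v.b1, v.b2, v.b3 + t * v.b1, v.z⟩ := rfl

theorem D_apply : D v = ⟨v.a1, -v.a2, -v.a3, v.b1, -v.b2, -v.b3, v.z⟩ := rfl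

theorem D_inv_apply : D⁻¹ v = ⟨v.a1, -v.a2, -v.a3, v.b1, -v.b2, -v.b3, v.z⟩ := rfl

end apply

theorem cyc_mem_isometries : (cyc : Perm (QuadSpace F)) ∈ isometries F := fun v w => by
  simp only [polar, cyc_apply]; ring

theorem P_mem_isometries (s t : F) : P s t ∈ isometries F := fun v w => by
  simp only [polar, P_apply]; ring

theorem Q_mem_isometries (s t : F) : Q s t ∈ isometries F := fun v w => by
  simp only [polar, Q_apply]; ring

theorem P_mul_P (s t s' t' : F) : P s t * P s' t' = P (s + s') (t + t') := by
  ext v <;> simp only [Perm.mul_apply, P_apply] <;> ring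

theorem Q_mul_Q (s t s' t' : F) : Q s t * Q s' t' = Q (s + s') (t + t') := by
  ext v <;> simp only [Perm.mul_apply, Q_apply] <;> ring

theorem E_mul_E (s t : F) : E s * E t = E (s + t) := by
  ext v <;> simp only [Perm.mul_apply, E_apply] <;> ring

theorem E'_mul_E' (s t : F) : E' s * E' t = E' (s + t) := by
  ext v <;> simp only [Perm.mul_apply, E'_apply] <;> ring

theorem commutator_E_rot_E (s t : F) : ⁅E s, rot (E t)⁆ = E' (s * t) := by
  ext v <;> simp only [commutatorElement_def, rot_apply, rot_inv_apply, Perm.mul_apply,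
    cyc_apply, cyc_inv_apply, E_apply, E_inv_apply, E'_apply] <;> ring

theorem commutator_E'_rot_rot_E' (s t : F) : ⁅E' s, rot (rot (E' t))⁆ = E (s * t) := by
  ext v <;> simp only [commutatorElement_def, rot_apply, rot_inv_apply, Perm.mul_apply,
    cyc_apply, cyc_inv_apply, E'_apply, E'_inv_apply, E_apply] <;> ring

end Ring

section Involution

variable {F : Type} [Field F] {b : F}

/-- The involution which generates `Ω₇` together with the cyclic permutation of the planes. -/
def inv (b : F) : Perm (QuadSpace F) :=
  rot (rot (P 1 (-3 / (2 * b)))) * rot (Q 1 b) * D * (rot (rot (P 1 (-3 / (2 * b)))))⁻¹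

theorem inv_apply (h2 : (2 : F) ≠ 0) (hb : b ≠ 0) (v : QuadSpace F) : inv b v =
    ⟨v.a1 + b * v.b3, -v.a2, -v.a2 / 2 - v.a3 + b * v.b1 - 4 * v.b3 + 4 * v.z,
      3 / b * v.a2 + v.b1, 3 / b * v.a1 - v.a2 - v.b2 - v.b3 / 2 + 2 * v.z, -v.b3,
      -v.a2 - 2 * v.b3 + v.z⟩ := by
  ext <;> simp only [inv, rot_apply, rot_inv_apply, Perm.mul_apply, P_apply, P_inv_apply,
    Q_apply, D_apply, cyc_apply, cyc_inv_apply] <;> field_simp <;> ring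

theorem inv_mul_rot_inv_apply (h2 : (2 : F) ≠ 0) (hb : b ≠ 0) (v : QuadSpace F) :
    (inv b * rot (inv b)) v =
    ⟨-v.a1 + 3 * v.a2 - (1 / 2 + b) * v.a3 - (4 + b / 2) * v.b1 + b * v.b2 - b * v.b3
        + (4 + 2 * b) * v.z,
      -v.a2 - b * v.b1,
      -(12 / b + 1 / 2) * v.a2 + v.a3 - (6 + 3 * b / 2) * v.b1 + 4 * v.b3 - 4 * v.z,
      3 / b * v.a2 + 2 * v.b1,
      -3 / b * v.a1 - (3 / (2 * b) + 1) * v.a2 - (9 / (2 * b) + 3 / 2) * v.a3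
        - (12 / b + 15 / 4 + b) * v.b1 + 2 * v.b2 + v.b3 / 2 + (12 / b + 1) * v.z,
      -3 / b * v.a2 + v.a3 + v.b1 / 2 + v.b3 - 2 * v.z,
      -(6 / b + 1) * v.a2 + v.a3 - (1 + b) * v.b1 + 2 * v.b3 - 3 * v.z⟩ := by
  have h4 : (4 : F) ≠ 0 := by simpa [show (4 : F) = 2 * 2 by norm_num] using h2
  ext <;> simp only [Perm.mul_apply, rot_apply, inv_apply h2 hb, cyc_apply, cyc_inv_apply] <;>
    field_simp <;> ring

theorem inv_mul_rot_inv_pow_three_apply (h2 : (2 : F) ≠ 0) (hb : b ≠ 0) (v : QuadSpace F) :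
    ((inv b * rot (inv b)) ^ 3) v =
    ⟨-v.a1 - (21 / b + 6 + 7 * b / 4) * v.a2 - b / 2 * v.a3 + b ^ 2 / 4 * v.b1 - b * v.b3
        + b * v.z,
      -v.a2,
      -6 / b * v.a2 + v.a3 - b * v.b1 + 4 * v.b3 - 4 * v.z,
      -v.b1,
      9 / b ^ 2 * v.a2 - 3 / b * v.a3 + (21 / b + 9 + 7 * b / 4) * v.b1 - v.b2 - 6 / b * v.b3
        + 6 / b * v.z,
      -3 / b * v.a2 + v.a3 - b / 2 * v.b1 + v.b3 - 2 * v.z,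
      -3 / b * v.a2 + v.a3 - b / 2 * v.b1 + 2 * v.b3 - 3 * v.z⟩ := by
  have h4 : (4 : F) ≠ 0 := by simpa [show (4 : F) = 2 * 2 by norm_num] using h2
  rw [pow_succ, pow_two, Perm.mul_apply, Perm.mul_apply]
  ext <;> simp only [inv_mul_rot_inv_apply h2 hb] <;> field_simp <;> ring

theorem inv_mul_rot_inv_pow_six (h2 : (2 : F) ≠ 0) (hb : b ≠ 0) :
    (inv b * rot (inv b)) ^ 6 = E (7 * b / 2 + 15 + 42 / b) := by
  have h4 : (4 : F) ≠ 0 := by simpa [show (4 : F) = 2 * 2 by norm_num] using h2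
  rw [show (inv b * rot (inv b)) ^ 6 = (inv b * rot (inv b)) ^ 3 * (inv b * rot (inv b)) ^ 3 by
    rw [← pow_add]]
  ext <;> simp only [Perm.mul_apply, inv_mul_rot_inv_pow_three_apply h2 hb, E_apply] <;>
    field_simp <;> ring

theorem inv_mul_inv (b : F) : inv b * inv b = 1 := by
  ext v <;> simp only [inv, rot_apply, rot_inv_apply, Perm.mul_apply, P_apply, P_inv_apply,
    Q_apply, D_apply, cyc_apply, cyc_inv_apply, Perm.one_apply] <;> ring

end Involution

section Generation

variable {F : Type}

theorem rot_mem {H : Subgroup (Perm (QuadSpace F))} (hc : cyc ∈ H) {g : Perm (QuadSpace F)}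
    (hg : g ∈ H) : rot g ∈ H :=
  H.mul_mem (H.mul_mem hc hg) (H.inv_mem hc)

theorem rot_mem_iff {H : Subgroup (Perm (QuadSpace F))} (hc : cyc ∈ H)
    {g : Perm (QuadSpace F)} : rot g ∈ H ↔ g ∈ H :=
  ⟨fun h => rot_rot_rot g ▸ rot_mem hc (rot_mem hc h), rot_mem hc⟩

theorem commutator_mem {G : Type*} [Group G] {H : Subgroup G} {g h : G} (hg : g ∈ H)
    (hh : h ∈ H) : ⁅g, h⁆ ∈ H :=
  H.mul_mem (H.mul_mem (H.mul_mem hg hh) (H.inv_mem hg)) (H.inv_mem hh)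

variable [Field F] {H : Subgroup (Perm (QuadSpace F))}

theorem P_pow (s t : F) (n : ℕ) : P s t ^ n = P (n * s) (n * t) := by
  induction n with
  | zero => ext v <;> simp [P_apply]
  | succ n ih => rw [pow_succ, ih, P_mul_P]; congr 1 <;> push_cast <;> ring

theorem Q_pow (s t : F) (n : ℕ) : Q s t ^ n = Q (n * s) (n * t) := by
  induction n with
  | zero => ext v <;> simp [Q_apply]
  | succ n ih => rw [pow_succ, ih, Q_mul_Q]; congr 1 <;> push_cast <;> ring

theorem exists_natCast_mul_two_eq_one [Fintype F] (h2 : (2 : F) ≠ 0) :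
    ∃ k : ℕ, (k : F) * 2 = 1 := by
  have h : Odd (Fintype.card F) := by
    rw [← Nat.not_even_iff_odd, even_iff_two_dvd]
    rintro ⟨k, hk⟩
    have h3 : ringChar F = 2 := by
      have := FiniteField.even_card_iff_char_two (F := F)
      rw [this]; omega
    exact h2 (by exact_mod_cast (ringChar.spec F 2).2 (by rw [h3]))
  obtain ⟨k, hk⟩ := h
  refine ⟨k + 1, ?_⟩
  have := FiniteField.cast_card_eq_zero F
  rw [hk] at this
  push_cast at this ⊢
  linear_combination this

theorem P_mem_of_two_mul [Fintype F] (h2 : (2 : F) ≠ 0) {s t : F} (h : P (2 * s) (2 * t) ∈ H) :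
    P s t ∈ H := by
  obtain ⟨k, hk⟩ := exists_natCast_mul_two_eq_one h2
  have := H.pow_mem h k
  rwa [P_pow, ← mul_assoc, ← mul_assoc, hk, one_mul, one_mul] at this

theorem Q_mem_of_two_mul [Fintype F] (h2 : (2 : F) ≠ 0) {s t : F} (h : Q (2 * s) (2 * t) ∈ H) :
    Q s t ∈ H := by
  obtain ⟨k, hk⟩ := exists_natCast_mul_two_eq_one h2
  have := H.pow_mem h k
  rwa [Q_pow, ← mul_assoc, ← mul_assoc, hk, one_mul, one_mul] at this

theorem E_inv (t : F) : (E t)⁻¹ = E (-t) := by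
  ext v <;> simp only [E_inv_apply, E_apply] <;> ring

theorem E'_inv (t : F) : (E' t)⁻¹ = E' (-t) := by
  ext v <;> simp only [E'_inv_apply, E'_apply] <;> ring

theorem E'_mem (hc : cyc ∈ H) {s t : F} (hs : E s ∈ H) (ht : E t ∈ H) : E' (s * t) ∈ H :=
  commutator_E_rot_E s t ▸ commutator_mem hs (rot_mem hc ht)

theorem E_mem (hc : cyc ∈ H) {s t : F} (hs : E' s ∈ H) (ht : E' t ∈ H) : E (s * t) ∈ H :=
  commutator_E'_rot_rot_E' s t ▸ commutator_mem hs (rot_mem hc (rot_mem hc ht))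

theorem E_pow_mem (hc : cyc ∈ H) {c : F} (h : E c ∈ H) (k : ℕ) :
    E (c ^ (3 * k + 1)) ∈ H ∧ E' (c ^ (3 * k + 2)) ∈ H := by
  induction k with
  | zero => exact ⟨by simpa using h, by simpa [pow_two] using E'_mem hc h h⟩
  | succ k ih =>
    have h1 : E (c ^ (3 * (k + 1) + 1)) ∈ H := by
      have := E_mem hc ih.2 (E'_mem hc h h)
      rwa [show c ^ (3 * k + 2) * (c * c) = c ^ (3 * (k + 1) + 1) by ring] at this
    refine ⟨h1, ?_⟩
    have := E'_mem hc h1 h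
    rwa [← pow_succ] at this

theorem E'_inv_mem [Fintype F] (hc : cyc ∈ H) {c : F} (hc0 : c ≠ 0) (h : E c ∈ H) :
    E' c⁻¹ ∈ H := by
  have h1 := (E_pow_mem hc h (Fintype.card F - 2)).2
  suffices c ^ (3 * (Fintype.card F - 2) + 2) = c⁻¹ by rwa [this] at h1
  refine eq_inv_of_mul_eq_one_left ?_
  rw [← pow_succ]
  have hq : 1 < Fintype.card F := Fintype.one_lt_card
  rw [show 3 * (Fintype.card F - 2) + 2 + 1 = (Fintype.card F - 1) * 3 by omega, pow_mul,
    FiniteField.pow_card_sub_one_eq_one c hc0, one_pow]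

/-- A representative of the reflection in the root `ε₁ - ε₂`. -/
def weyl (t : F) : Perm (QuadSpace F) := E t * rot (E' (-t⁻¹)) * E t

theorem weyl_apply {t : F} (ht : t ≠ 0) (v : QuadSpace F) :
    weyl t v = ⟨t * v.a2, -t⁻¹ * v.a1, v.a3, t⁻¹ * v.b2, -t * v.b1, v.b3, v.z⟩ := by
  ext <;> simp only [weyl, Perm.mul_apply, rot_apply, E_apply, E'_apply, cyc_apply,
    cyc_inv_apply] <;> field_simp <;> ring

theorem weyl_mul_weyl {t : F} (ht : t ≠ 0) : weyl t * weyl t = rot (rot D) := by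
  ext v <;> simp only [Perm.mul_apply, weyl_apply ht, rot_apply, D_apply, cyc_apply,
    cyc_inv_apply] <;> field_simp

theorem weyl_mem (hc : cyc ∈ H) {t : F} (h1 : E t ∈ H) (h2 : E' t⁻¹ ∈ H) : weyl t ∈ H :=
  H.mul_mem (H.mul_mem h1 (rot_mem hc (E'_inv t⁻¹ ▸ H.inv_mem h2))) h1

theorem D_mem [Fintype F] (hc : cyc ∈ H) {c : F} (hc0 : c ≠ 0) (h : E c ∈ H) : D ∈ H := by
  rw [← rot_mem_iff hc, ← rot_mem_iff hc, ← weyl_mul_weyl hc0]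
  have := weyl_mem hc h (E'_inv_mem hc hc0 h)
  exact H.mul_mem this this

section Unipotent

variable (s t s' t' : F)

theorem D_conj : rot D * (rot (rot (P s t)) * rot (Q s' t') * rot (rot (P s t))) * rot D =
    (rot (rot (P s t)))⁻¹ * rot (Q s' t') * (rot (rot (P s t)))⁻¹ := by
  ext v <;> simp only [rot_apply, rot_inv_apply, Perm.mul_apply, P_apply, P_inv_apply,
    Q_apply, D_apply, cyc_apply, cyc_inv_apply] <;> ring

theorem isolate_Q : rot (rot (P s t)) * rot (Q s' t') * rot (Q s' t') * (rot (rot (P s t)))⁻¹ *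
    (D * (rot (rot (P s t)) * rot (Q s' t') * rot (Q s' t') * (rot (rot (P s t)))⁻¹) * D)⁻¹ =
      rot (Q (2 * (2 * s')) (2 * (2 * t'))) := by
  ext v <;> simp only [rot_apply, rot_inv_apply, Perm.mul_apply, P_apply, P_inv_apply,
    Q_apply, Q_inv_apply, D_inv_apply, mul_inv_rev, inv_inv, cyc_apply,
    cyc_inv_apply] <;> ring

theorem isolate_P :
    rot (rot (P s t)) * rot (Q s' t') * rot (rot (P s t)) * (rot (Q s' t'))⁻¹ *
      (D * (rot (rot (P s t)) * rot (Q s' t') * rot (rot (P s t)) * (rot (Q s' t'))⁻¹) * D)⁻¹ =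
      rot (rot (P (2 * (2 * s)) (2 * (2 * t)))) := by
  ext v <;> simp only [rot_apply, rot_inv_apply, Perm.mul_apply, P_apply, P_inv_apply,
    Q_apply, Q_inv_apply, D_inv_apply, mul_inv_rev, inv_inv, cyc_apply,
    cyc_inv_apply] <;> ring

theorem commutator_Q_rot_Q (b : F) : ⁅Q 1 b, rot (Q 1 b)⁆ *
    (rot (rot D) * ⁅Q 1 b, rot (Q 1 b)⁆ * rot (rot D)) =
      rot (rot (P (2 * (2 * -b)) (2 * (2 * 1)))) := by
  ext v <;> simp only [rot_apply, rot_inv_apply, Perm.mul_apply, P_apply, commutatorElement_def,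
    Q_apply, Q_inv_apply, D_apply, cyc_apply, cyc_inv_apply] <;> ring

theorem commutator_P_rot_P (m : F) : ⁅P 1 m, rot (P 1 m)⁆ *
    (rot (rot D) * ⁅P 1 m, rot (P 1 m)⁆ * rot (rot D)) =
      rot (rot (Q (2 * (2 * -m)) (2 * (2 * 1)))) := by
  ext v <;> simp only [rot_apply, rot_inv_apply, Perm.mul_apply, P_apply, commutatorElement_def,
    P_inv_apply, Q_apply, D_apply, cyc_apply, cyc_inv_apply] <;> ring

theorem commutator_P_rot_Q : ⁅P s t, rot (Q s' t')⁆ = E (2 * s * s' - t * t') := by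
  ext v <;> simp only [rot_apply, rot_inv_apply, Perm.mul_apply, P_apply, commutatorElement_def,
    P_inv_apply, Q_apply, Q_inv_apply, E_apply, cyc_apply, cyc_inv_apply] <;> ring

theorem commutator_P_rot_rot_Q : ⁅P s t, rot (rot (Q s' t'))⁆ = E' (2 * s * s' - t * t') := by
  ext v <;> simp only [rot_apply, rot_inv_apply, Perm.mul_apply, P_apply, commutatorElement_def,
    P_inv_apply, Q_apply, Q_inv_apply, E'_apply, cyc_apply, cyc_inv_apply] <;> ring

end Unipotent

end Generation

section Generation

variable {F : Type} [Field F] {H : Subgroup (Perm (QuadSpace F))} {b : F}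

theorem inv_mul_D (b : F) : inv b * D =
    rot (rot (P 1 (-3 / (2 * b)))) * rot (Q 1 b) * rot (rot (P 1 (-3 / (2 * b)))) := by
  ext v <;> simp only [inv, rot_apply, rot_inv_apply, Perm.mul_apply, P_apply, P_inv_apply,
    Q_apply, D_apply, cyc_apply, cyc_inv_apply] <;> ring

theorem E_mem_of_inv_mem (h2 : (2 : F) ≠ 0) (hb : b ≠ 0) (hc : cyc ∈ H) (hi : inv b ∈ H) :
    E (7 * b / 2 + 15 + 42 / b) ∈ H :=
  inv_mul_rot_inv_pow_six h2 hb ▸ H.pow_mem (H.mul_mem hi (rot_mem hc hi)) 6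

theorem P_mem_and_Q_mem [Fintype F] (h2 : (2 : F) ≠ 0) {m : F} (hc : cyc ∈ H) (hD : D ∈ H)
    (h : rot (rot (P 1 m)) * rot (Q 1 b) * rot (rot (P 1 m)) ∈ H) :
    P 1 m ∈ H ∧ Q 1 b ∈ H := by
  have hQ : Q 1 b ∈ H := by
    have h1 := H.mul_mem h (H.mul_mem (H.mul_mem (rot_mem hc hD) h) (rot_mem hc hD))
    rw [D_conj] at h1
    have h3 : rot (rot (P 1 m)) * rot (Q 1 b) * rot (Q 1 b) * (rot (rot (P 1 m)))⁻¹ ∈ H := by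
      convert h1 using 1
      group
    have h4 := H.mul_mem h3 (H.inv_mem (H.mul_mem (H.mul_mem hD h3) hD))
    rw [isolate_Q, rot_mem_iff hc] at h4
    exact Q_mem_of_two_mul h2 (Q_mem_of_two_mul h2 h4)
  refine ⟨?_, hQ⟩
  have h1 := H.mul_mem h (H.inv_mem (rot_mem hc hQ))
  have h4 := H.mul_mem h1 (H.inv_mem (H.mul_mem (H.mul_mem hD h1) hD))
  rw [isolate_P, rot_mem_iff hc, rot_mem_iff hc] at h4
  exact P_mem_of_two_mul h2 (P_mem_of_two_mul h2 h4)

theorem P_neg_mem [Fintype F] (h2 : (2 : F) ≠ 0) (hc : cyc ∈ H) (hD : D ∈ H) (h : Q 1 b ∈ H) :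
    P (-b) 1 ∈ H := by
  have h1 := commutator_mem h (rot_mem hc h)
  have hD' := rot_mem hc (rot_mem hc hD)
  have h3 := H.mul_mem h1 (H.mul_mem (H.mul_mem hD' h1) hD')
  rw [commutator_Q_rot_Q, rot_mem_iff hc, rot_mem_iff hc] at h3
  exact P_mem_of_two_mul h2 (P_mem_of_two_mul h2 h3)

theorem Q_neg_mem [Fintype F] (h2 : (2 : F) ≠ 0) {m : F} (hc : cyc ∈ H) (hD : D ∈ H)
    (h : P 1 m ∈ H) : Q (-m) 1 ∈ H := by
  have h1 := commutator_mem h (rot_mem hc h)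
  have hD' := rot_mem hc (rot_mem hc hD)
  have h3 := H.mul_mem h1 (H.mul_mem (H.mul_mem hD' h1) hD')
  rw [commutator_P_rot_P, rot_mem_iff hc, rot_mem_iff hc] at h3
  exact Q_mem_of_two_mul h2 (Q_mem_of_two_mul h2 h3)

/-- The set of parameters of the root elements for `ε₁ - ε₂` in a subgroup, as a subring. -/
def parameterRing (hc : cyc ∈ H) (h1 : E (1 : F) ∈ H) (h1' : E' (1 : F) ∈ H) : Subring F where
  carrier := {t | E t ∈ H}
  one_mem' := h1
  zero_mem' := by
    have := H.mul_mem h1 (H.inv_mem h1)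
    rwa [E_inv, E_mul_E, add_neg_cancel] at this
  add_mem' {s t} hs ht := by
    rw [Set.mem_ofPred_eq, ← E_mul_E]
    exact H.mul_mem hs ht
  neg_mem' {t} ht := by
    rw [Set.mem_ofPred_eq, ← E_inv]
    exact H.inv_mem ht
  mul_mem' {s t} hs ht := by
    have := E_mem hc (E'_mem hc hs ht) h1'
    rwa [mul_one] at this

theorem mem_parameterRing {hc : cyc ∈ H} {h1 : E (1 : F) ∈ H} {h1' : E' (1 : F) ∈ H} {t : F} :
    t ∈ parameterRing hc h1 h1' ↔ E t ∈ H := Iff.rfl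

theorem inv_mem_subring [Fintype F] (K : Subring F) {a : F} (ha : a ∈ K) : a⁻¹ ∈ K := by
  by_cases h : a = 0
  · simp [h]
  have : a ^ (Fintype.card F - 2) = a⁻¹ := by
    refine eq_inv_of_mul_eq_one_left ?_
    have hq : 1 < Fintype.card F := Fintype.one_lt_card
    rw [← pow_succ, show Fintype.card F - 2 + 1 = Fintype.card F - 1 by omega,
      FiniteField.pow_card_sub_one_eq_one a h]
  exact this ▸ K.pow_mem ha _

theorem E_pow (t : F) (n : ℕ) : E t ^ n = E (n * t) := by
  induction n with
  | zero => ext v <;> simp [E_apply]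
  | succ n ih => rw [pow_succ, ih, E_mul_E]; congr 1; push_cast; ring

theorem E'_pow (t : F) (n : ℕ) : E' t ^ n = E' (n * t) := by
  induction n with
  | zero => ext v <;> simp [E'_apply]
  | succ n ih => rw [pow_succ, ih, E'_mul_E']; congr 1; push_cast; ring

theorem E_mem_of_two_mul [Fintype F] (h2 : (2 : F) ≠ 0) {t : F} (h : E (2 * t) ∈ H) :
    E t ∈ H := by
  obtain ⟨k, hk⟩ := exists_natCast_mul_two_eq_one h2
  have := H.pow_mem h k
  rwa [E_pow, ← mul_assoc, hk, one_mul] at this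

theorem E'_mem_of_two_mul [Fintype F] (h2 : (2 : F) ≠ 0) {t : F} (h : E' (2 * t) ∈ H) :
    E' t ∈ H := by
  obtain ⟨k, hk⟩ := exists_natCast_mul_two_eq_one h2
  have := H.pow_mem h k
  rwa [E'_pow, ← mul_assoc, hk, one_mul] at this

theorem weyl_conj_P {t : F} (ht : t ≠ 0) (s u : F) :
    weyl t * weyl (-1) * P s u * (weyl 1 * weyl (-t)) = P (t * s) (t * u) := by
  ext v <;> simp only [Perm.mul_apply, weyl_apply ht, weyl_apply (neg_ne_zero.2 ht),
    weyl_apply one_ne_zero, weyl_apply (neg_ne_zero.2 (one_ne_zero (α := F))), P_apply] <;>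
    field_simp

theorem weyl_conj_Q {t : F} (ht : t ≠ 0) (s u : F) :
    weyl t * weyl (-1) * Q s u * (weyl 1 * weyl (-t)) = Q (t⁻¹ * s) (t⁻¹ * u) := by
  ext v <;> simp only [Perm.mul_apply, weyl_apply ht, weyl_apply (neg_ne_zero.2 ht),
    weyl_apply one_ne_zero, weyl_apply (neg_ne_zero.2 (one_ne_zero (α := F))), Q_apply] <;>
    field_simp

/-- A subgroup containing the two generators contains all the root elements. -/
theorem root_mem_of_inv_mem [Fintype F] (h2 : (2 : F) ≠ 0) (hb : b ≠ 0)
    (hb' : 7 * b / 2 + 15 + 42 / b ≠ 0) (hK : ∀ K : Subring F, b ∈ K → K = ⊤)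
    (hc : cyc ∈ H) (hi : inv b ∈ H) : (∀ s t, P s t ∈ H) ∧ ∀ s t, Q s t ∈ H := by
  have hE := E_mem_of_inv_mem h2 hb hc hi
  have hD := D_mem hc hb' hE
  have hPQ := H.mul_mem hi hD
  rw [inv_mul_D] at hPQ
  obtain ⟨m, hm⟩ : ∃ m, m = -3 / (2 * b) := ⟨_, rfl⟩
  rw [← hm] at hPQ
  replace hm : m * b = -3 / 2 := by rw [hm]; field_simp
  obtain ⟨hP, hQ⟩ := P_mem_and_Q_mem h2 hc hD hPQ
  have hP' := P_neg_mem h2 hc hD hQ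
  have hQ' := Q_neg_mem h2 hc hD hP
  have h4 : 2 * -b * -m - 1 * 1 = (2 * (2 * -1) : F) := by
    field_simp at hm ⊢
    linear_combination hm
  have h1 : E (1 : F) ∈ H := by
    have := commutator_mem hP' (rot_mem hc hQ')
    rw [commutator_P_rot_Q, h4] at this
    simpa [E_inv] using H.inv_mem (E_mem_of_two_mul h2 (E_mem_of_two_mul h2 this))
  have h1' : E' (1 : F) ∈ H := by
    have := commutator_mem hP' (rot_mem hc (rot_mem hc hQ'))
    rw [commutator_P_rot_rot_Q, h4] at this
    simpa [E'_inv] using H.inv_mem (E'_mem_of_two_mul h2 (E'_mem_of_two_mul h2 this))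
  have hbK : b ∈ parameterRing hc h1 h1' := by
    have hE3 := commutator_mem hP' (rot_mem hc hQ)
    rw [commutator_P_rot_Q, ← mem_parameterRing (hc := hc) (h1 := h1) (h1' := h1')] at hE3
    have h3K : (3 : F) ∈ parameterRing hc h1 h1' := by
      exact_mod_cast natCast_mem (parameterRing hc h1 h1') 3
    by_cases h3 : (3 : F) = 0
    · have := add_mem (mem_parameterRing (hc := hc) (h1 := h1) (h1' := h1').2 hE)
        (mem_parameterRing (hc := hc) (h1 := h1) (h1' := h1').2 hE)
      convert this using 1
      field_simp
      linear_combination (-(4 * b ^ 2 + 20 * b + 56)) * h3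
    · have := neg_mem (mul_mem (inv_mem_subring _ h3K) hE3)
      convert this using 1
      field_simp
      ring
  have hEt (t : F) : E t ∈ H := by
    rw [← mem_parameterRing (hc := hc) (h1 := h1) (h1' := h1'), hK _ hbK]
    trivial
  have hEt' (t : F) : E' t ∈ H := mul_one t ▸ E'_mem hc (hEt t) h1
  have hw (t : F) : weyl t ∈ H := weyl_mem hc (hEt t) (hEt' _)
  have hPt {s u : F} (h : P s u ∈ H) (t : F) : P (t * s) (t * u) ∈ H := by
    by_cases ht : t = 0
    · have := H.pow_mem h 0
      rw [P_pow] at this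
      simpa [ht] using this
    rw [← weyl_conj_P ht]
    exact H.mul_mem (H.mul_mem (H.mul_mem (hw _) (hw _)) h) (H.mul_mem (hw _) (hw _))
  have hQt {s u : F} (h : Q s u ∈ H) (t : F) : Q (t * s) (t * u) ∈ H := by
    by_cases ht : t = 0
    · have := H.pow_mem h 0
      rw [Q_pow] at this
      simpa [ht] using this
    rw [← inv_inv t, ← weyl_conj_Q (inv_ne_zero ht)]
    exact H.mul_mem (H.mul_mem (H.mul_mem (hw _) (hw _)) h) (H.mul_mem (hw _) (hw _))
  constructor <;> intro s t
  · have := H.mul_mem (hPt hP (-2 * (s + b * t))) (hPt hP' (t + 2 * m * (s + b * t)))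
    rw [P_mul_P] at this
    convert this using 2 <;> field_simp at hm ⊢
    · linear_combination (s + b * t) * hm
    · ring
  · have := H.mul_mem (hQt hQ (-2 * (s + m * t))) (hQt hQ' (t + 2 * b * (s + m * t)))
    rw [Q_mul_Q] at this
    convert this using 2 <;> field_simp at hm ⊢
    · linear_combination (s + m * t) * hm
    · ring

end Generation

section Parameter

variable {F : Type} [Field F] [Fintype F]

theorem exists_subring_generator :
    ∃ g : F, g ≠ 0 ∧ ∀ K : Subring F, g ∈ K → K = ⊤ := by
  obtain ⟨g, hg⟩ := IsCyclic.exists_generator (α := Fˣ)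
  refine ⟨g, g.ne_zero, fun K hK => eq_top_iff.2 fun a _ => ?_⟩
  by_cases ha : a = 0
  · exact ha ▸ K.zero_mem
  obtain ⟨n, hn⟩ := mem_powers_iff_mem_zpowers.2 (hg (Units.mk0 a ha))
  have : (g : F) ^ n = a := by simpa using congrArg Units.val hn
  exact this ▸ K.pow_mem hK n

theorem exists_parameter (h2 : (2 : F) ≠ 0) :
    ∃ b : F, b ≠ 0 ∧ 7 * b / 2 + 15 + 42 / b ≠ 0 ∧ ∀ K : Subring F, b ∈ K → K = ⊤ := by
  obtain ⟨g, hg, hK⟩ := exists_subring_generator (F := F)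
  have key {b : F} (hb : b ≠ 0) (h : 7 * b / 2 + 15 + 42 / b = 0) :
      7 * b ^ 2 + 30 * b + 84 = 0 := by
    field_simp at h
    linear_combination h
  by_cases h : 7 * g / 2 + 15 + 42 / g = 0
  swap
  · exact ⟨g, hg, h, hK⟩
  by_cases h' : 7 * -g / 2 + 15 + 42 / -g = 0
  swap
  · exact ⟨-g, neg_ne_zero.2 hg, h', fun K hb => hK K (by simpa using K.neg_mem hb)⟩
  replace h := key hg h
  replace h' := key (neg_ne_zero.2 hg) h'
  have h15 : (15 : F) = 0 := by
    have : (2 * 2 * g) * 15 = 0 := by linear_combination h - h'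
    simpa [h2, hg] using this
  have h3 : (3 : F) ≠ 0 := fun h3 => hg <| by
    have : g ^ 2 = 0 := by linear_combination h - (2 * g ^ 2 + 10 * g + 28) * h3
    simpa using this
  have h5 : (5 : F) = 0 := by
    have : (3 : F) * 5 = 0 := by linear_combination h15
    simpa [h3] using this
  have hg2 : 2 * g ≠ 0 := mul_ne_zero h2 hg
  refine ⟨2 * g, hg2, fun h0 => h2 ?_, fun K hb => hK K ?_⟩
  · linear_combination -(50 + 12 * g) * h5 + 4 * h - key hg2 h0
  · have := K.add_mem (K.add_mem hb hb) hb
    convert this using 1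
    linear_combination -g * h5

end Parameter

section Elementary

variable {F : Type} [Field F]

/-- The subgroup generated by root elements and the cyclic permutation of the planes. -/
def elementary (F : Type) [Field F] : Subgroup (Perm (QuadSpace F)) :=
  Subgroup.closure {g | g = cyc ∨ (∃ s t, g = P s t) ∨ ∃ s t, g = Q s t}

theorem cyc_mem_elementary : cyc ∈ elementary F := Subgroup.subset_closure (.inl rfl)

theorem P_mem_elementary (s t : F) : P s t ∈ elementary F :=
  Subgroup.subset_closure (.inr (.inl ⟨s, t, rfl⟩))

theorem Q_mem_elementary (s t : F) : Q s t ∈ elementary F :=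
  Subgroup.subset_closure (.inr (.inr ⟨s, t, rfl⟩))

theorem elementary_le {H : Subgroup (Perm (QuadSpace F))} (hc : cyc ∈ H)
    (hP : ∀ s t, P s t ∈ H) (hQ : ∀ s t, Q s t ∈ H) : elementary F ≤ H := by
  rw [elementary, Subgroup.closure_le]
  rintro g (rfl | ⟨s, t, rfl⟩ | ⟨s, t, rfl⟩)
  exacts [hc, hP s t, hQ s t]

theorem elementary_le_isometries : elementary F ≤ isometries F :=
  elementary_le cyc_mem_isometries P_mem_isometries Q_mem_isometries

theorem rot_mem_elementary {g : Perm (QuadSpace F)} :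
    rot g ∈ elementary F ↔ g ∈ elementary F := rot_mem_iff cyc_mem_elementary

theorem E_mem_elementary (h2 : (2 : F) ≠ 0) (t : F) : E t ∈ elementary F := by
  have h := commutator_mem (P_mem_elementary (t / 2) 0)
    (rot_mem_elementary.2 (Q_mem_elementary 1 0))
  rw [commutator_P_rot_Q] at h
  convert h using 2
  field_simp
  ring

theorem E'_mem_elementary (h2 : (2 : F) ≠ 0) (t : F) : E' t ∈ elementary F := by
  have h := E'_mem cyc_mem_elementary (E_mem_elementary h2 t) (E_mem_elementary h2 1)
  rwa [mul_one] at h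

theorem weyl_mem_elementary (h2 : (2 : F) ≠ 0) (t : F) : weyl t ∈ elementary F :=
  weyl_mem cyc_mem_elementary (E_mem_elementary h2 t) (E'_mem_elementary h2 _)

theorem norm_eq_of_polar_self_eq_zero (h2 : (2 : F) ≠ 0) {v : QuadSpace F}
    (h : polar v v = 0) : v.a1 * v.b1 + v.a2 * v.b2 + v.a3 * v.b3 = v.z ^ 2 := by
  have : 2 * (v.a1 * v.b1 + v.a2 * v.b2 + v.a3 * v.b3 - v.z ^ 2) = 0 := by
    rw [← h, polar]; ring
  linear_combination (mul_eq_zero.1 this).resolve_left h2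

/-- A standard basis vector of the first hyperbolic plane. -/
def e1 : QuadSpace F := ⟨1, 0, 0, 0, 0, 0, 0⟩
/-- A standard basis vector of the second hyperbolic plane. -/
def e2 : QuadSpace F := ⟨0, 1, 0, 0, 0, 0, 0⟩
/-- A standard basis vector of the third hyperbolic plane. -/
def e3 (t : F) : QuadSpace F := ⟨0, 0, t, 0, 0, 0, 0⟩
/-- The other standard basis vector of the first hyperbolic plane. -/
def f1 : QuadSpace F := ⟨0, 0, 0, 1, 0, 0, 0⟩
/-- The other standard basis vector of the second hyperbolic plane. -/
def f2 : QuadSpace F := ⟨0, 0, 0, 0, 1, 0, 0⟩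
/-- The other standard basis vector of the third hyperbolic plane. -/
def f3 (t : F) : QuadSpace F := ⟨0, 0, 0, 0, 0, t, 0⟩

theorem exists_elementary_a1_ne_zero (h2 : (2 : F) ≠ 0) {v : QuadSpace F}
    (hv : polar v v = 0) (h0 : v ≠ ⟨0, 0, 0, 0, 0, 0, 0⟩) :
    ∃ n ∈ elementary F, (n v).a1 ≠ 0 := by
  by_contra! h
  have ha1 : v.a1 = 0 := h 1 (one_mem _)
  have ha2 : v.a2 = 0 := by simpa [E_apply, ha1] using h _ (E_mem_elementary h2 1)
  have ha3 : v.a3 = 0 := by simpa [E'_apply, ha1] using h _ (E'_mem_elementary h2 1)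
  have hz : v.z = 0 := by
    simpa [ha1, ha2, ha3] using (norm_eq_of_polar_self_eq_zero h2 hv).symm
  have hb1 : v.b1 = 0 := by simpa [P_apply, ha1, hz] using h _ (P_mem_elementary 1 0)
  have hb2 : v.b2 = 0 := by
    simpa [rot_apply, cyc_apply, cyc_inv_apply, Q_apply, ha1] using
      h _ (rot_mem_elementary.2 (rot_mem_elementary.2 (Q_mem_elementary 0 1)))
  have hb3 : v.b3 = 0 := by
    simpa [rot_apply, cyc_apply, cyc_inv_apply, Q_apply, ha1] using
      h _ (rot_mem_elementary.2 (Q_mem_elementary 0 1))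
  exact h0 (QuadSpace.ext ha1 ha2 ha3 hb1 hb2 hb3 hz)

theorem exists_elementary_eq_e1 (h2 : (2 : F) ≠ 0) {v : QuadSpace F}
    (hv : polar v v = 0) (h0 : v ≠ ⟨0, 0, 0, 0, 0, 0, 0⟩) :
    ∃ n ∈ elementary F, n v = e1 := by
  obtain ⟨n₁, hn₁, h⟩ := exists_elementary_a1_ne_zero h2 hv h0
  have hw : weyl (n₁ v).a1⁻¹ * weyl (-1) ∈ elementary F :=
    mul_mem (weyl_mem_elementary h2 _) (weyl_mem_elementary h2 _)
  obtain ⟨w, hw'⟩ : ∃ w, w = (weyl (n₁ v).a1⁻¹ * weyl (-1) : Perm (QuadSpace F)) (n₁ v) := ⟨_, rfl⟩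
  have ha1 : w.a1 = 1 := by
    rw [hw', Perm.mul_apply, weyl_apply (inv_ne_zero h),
      weyl_apply (neg_ne_zero.2 (one_ne_zero (α := F)))]
    simp [h]
  have hn := norm_eq_of_polar_self_eq_zero h2 (v := w) (by
    rw [hw', elementary_le_isometries hw, elementary_le_isometries hn₁, hv])
  rw [ha1, one_mul] at hn
  refine ⟨Q (-w.z) 0 * rot (rot (P 0 w.b2)) * rot (P 0 (-w.b3)) * rot (rot (E (-w.a3))) *
    rot (E' (-w.a2)) * (weyl (n₁ v).a1⁻¹ * weyl (-1)) * n₁,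
    mul_mem (mul_mem (mul_mem (mul_mem (mul_mem (mul_mem (Q_mem_elementary _ _) ?_) ?_) ?_) ?_)
      hw) hn₁, ?_⟩
  · exact rot_mem_elementary.2 (rot_mem_elementary.2 (P_mem_elementary _ _))
  · exact rot_mem_elementary.2 (P_mem_elementary _ _)
  · exact rot_mem_elementary.2 (rot_mem_elementary.2 (E_mem_elementary h2 _))
  · exact rot_mem_elementary.2 (E'_mem_elementary h2 _)
  · rw [Perm.mul_apply, Perm.mul_apply, ← hw']
    ext <;> simp only [Perm.mul_apply, Q_apply, P_apply, E_apply, E'_apply, rot_apply, cyc_apply,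
      cyc_inv_apply, ha1, e1] <;> first | ring1 | linear_combination hn

theorem exists_elementary_eq_f1 (h2 : (2 : F) ≠ 0) {v : QuadSpace F}
    (hv : polar v v = 0) (h1 : v.b1 = 1) :
    ∃ n ∈ elementary F, n e1 = e1 ∧ n v = f1 := by
  have hn := norm_eq_of_polar_self_eq_zero h2 hv
  rw [h1, mul_one] at hn
  refine ⟨P (-v.z) 0 * rot (Q 0 (-v.a3)) * rot (rot (Q 0 v.a2)) * E' v.b3 * E v.b2,
    mul_mem (mul_mem (mul_mem (mul_mem (P_mem_elementary _ _) ?_) ?_)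
      (E'_mem_elementary h2 _)) (E_mem_elementary h2 _), ?_, ?_⟩
  · exact rot_mem_elementary.2 (Q_mem_elementary _ _)
  · exact rot_mem_elementary.2 (rot_mem_elementary.2 (Q_mem_elementary _ _))
  · ext <;> simp only [Perm.mul_apply, Q_apply, P_apply, E_apply, E'_apply, rot_apply, cyc_apply,
      cyc_inv_apply, e1] <;> ring1
  · ext <;> simp only [Perm.mul_apply, Q_apply, P_apply, E_apply, E'_apply, rot_apply, cyc_apply,
      cyc_inv_apply, h1, f1] <;> first | ring1 | linear_combination hn

theorem exists_elementary_a2_ne_zero (h2 : (2 : F) ≠ 0) {v : QuadSpace F}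
    (hv : polar v v = 0) (h0 : v ≠ ⟨0, 0, 0, 0, 0, 0, 0⟩) (ha1 : v.a1 = 0) (hb1 : v.b1 = 0) :
    ∃ n ∈ elementary F, n e1 = e1 ∧ n f1 = f1 ∧ (n v).a2 ≠ 0 := by
  by_contra! h
  have ha2 : v.a2 = 0 := h 1 (one_mem _) rfl rfl
  have ha3 : v.a3 = 0 := by
    simpa [rot_apply, cyc_apply, cyc_inv_apply, E_apply, e1, f1, ha2] using
      h _ (rot_mem_elementary.2 (E_mem_elementary h2 1))
  have hz : v.z = 0 := by
    simpa [ha1, ha2, ha3] using (norm_eq_of_polar_self_eq_zero h2 hv).symm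
  have hb2 : v.b2 = 0 := by
    simpa [rot_apply, cyc_apply, cyc_inv_apply, P_apply, e1, f1, ha2, hz] using
      h _ (rot_mem_elementary.2 (P_mem_elementary 1 0))
  have hb3 : v.b3 = 0 := by
    simpa [Q_apply, e1, f1, ha2] using h _ (Q_mem_elementary 0 1)
  exact h0 (QuadSpace.ext ha1 ha2 ha3 hb1 hb2 hb3 hz)

theorem a1_eq_and_b1_eq {f : Perm (QuadSpace F)} (hf : f ∈ isometries F)
    (he : f e1 = e1) (hf1 : f f1 = f1) {v : QuadSpace F} :
    (f v).a1 = v.a1 ∧ (f v).b1 = v.b1 := by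
  have h1 := hf v e1
  have h2 := hf v f1
  rw [he] at h1
  rw [hf1] at h2
  constructor
  · simpa [polar, f1] using h2
  · simpa [polar, e1] using h1

theorem exists_elementary_eq_e2 (h2 : (2 : F) ≠ 0) {v : QuadSpace F}
    (hv : polar v v = 0) (h0 : v ≠ ⟨0, 0, 0, 0, 0, 0, 0⟩) (ha1 : v.a1 = 0) (hb1 : v.b1 = 0) :
    ∃ n ∈ elementary F, n e1 = e1 ∧ n f1 = f1 ∧ n v = e2 := by
  obtain ⟨n₁, hn₁, he, hf, h⟩ := exists_elementary_a2_ne_zero h2 hv h0 ha1 hb1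
  have hw : rot (weyl (n₁ v).a2⁻¹ * weyl (-1)) ∈ elementary F :=
    rot_mem_elementary.2 (mul_mem (weyl_mem_elementary h2 _) (weyl_mem_elementary h2 _))
  obtain ⟨w, hw'⟩ : ∃ w, w = rot (weyl (n₁ v).a2⁻¹ * weyl (-1) : Perm (QuadSpace F)) (n₁ v) :=
    ⟨_, rfl⟩
  have hrot (u : QuadSpace F) : rot (weyl (n₁ v).a2⁻¹ * weyl (-1) : Perm (QuadSpace F)) u =
      ⟨u.a1, (n₁ v).a2⁻¹ * u.a2, (n₁ v).a2 * u.a3, u.b1, (n₁ v).a2 * u.b2, (n₁ v).a2⁻¹ * u.b3,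
        u.z⟩ := by
    rw [rot_apply, Perm.mul_apply, weyl_apply (inv_ne_zero h),
      weyl_apply (neg_ne_zero.2 (one_ne_zero (α := F)))]
    ext <;> simp [cyc_apply, cyc_inv_apply]
  have ha2 : w.a2 = 1 := by rw [hw', hrot]; simp [h]
  have hw1 : w.a1 = 0 ∧ w.b1 = 0 := by
    rw [hw', hrot]
    simp [a1_eq_and_b1_eq (elementary_le_isometries hn₁) he hf, ha1, hb1]
  have hn := norm_eq_of_polar_self_eq_zero h2 (v := w) (by
    rw [hw', elementary_le_isometries hw, elementary_le_isometries hn₁, hv])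
  rw [ha2, hw1.1, zero_mul, one_mul, zero_add] at hn
  refine ⟨rot (Q (-w.z) 0) * P 0 w.b3 * rot (rot (E' (-w.a3))) *
    rot (weyl (n₁ v).a2⁻¹ * weyl (-1)) * n₁,
    mul_mem (mul_mem (mul_mem (mul_mem ?_ (P_mem_elementary _ _)) ?_) hw) hn₁, ?_, ?_, ?_⟩
  · exact rot_mem_elementary.2 (Q_mem_elementary _ _)
  · exact rot_mem_elementary.2 (rot_mem_elementary.2 (E'_mem_elementary h2 _))
  · rw [Perm.mul_apply, he, Perm.mul_apply, hrot]
    ext <;> simp only [Perm.mul_apply, Q_apply, P_apply, E'_apply, rot_apply, cyc_apply,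
      cyc_inv_apply, e1] <;> ring1
  · rw [Perm.mul_apply, hf, Perm.mul_apply, hrot]
    ext <;> simp only [Perm.mul_apply, Q_apply, P_apply, E'_apply, rot_apply, cyc_apply,
      cyc_inv_apply, f1] <;> ring1
  · rw [Perm.mul_apply, Perm.mul_apply, ← hw']
    ext <;> simp only [Perm.mul_apply, Q_apply, P_apply, E'_apply, rot_apply, cyc_apply,
      cyc_inv_apply, ha2, hw1, e2] <;> first | ring1 | linear_combination hn

theorem exists_elementary_eq_f2 (h2 : (2 : F) ≠ 0) {v : QuadSpace F}
    (hv : polar v v = 0) (ha1 : v.a1 = 0) (hb1 : v.b1 = 0) (hb2 : v.b2 = 1) :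
    ∃ n ∈ elementary F, n e1 = e1 ∧ n f1 = f1 ∧ n e2 = e2 ∧ n v = f2 := by
  have hn := norm_eq_of_polar_self_eq_zero h2 hv
  rw [hb2, ha1, mul_one, zero_mul, zero_add] at hn
  refine ⟨rot (P (-v.z) 0) * Q 0 v.a3 * rot (E v.b3),
    mul_mem (mul_mem ?_ (Q_mem_elementary _ _)) ?_, ?_, ?_, ?_, ?_⟩
  · exact rot_mem_elementary.2 (P_mem_elementary _ _)
  · exact rot_mem_elementary.2 (E_mem_elementary h2 _)
  all_goals
    ext <;> simp only [Perm.mul_apply, Q_apply, P_apply, E_apply, rot_apply, cyc_apply,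
      cyc_inv_apply, ha1, hb1, hb2, e1, f1, e2, f2] <;> first | ring1 | linear_combination hn

theorem exists_elementary_eq_e3 (h2 : (2 : F) ≠ 0) {v : QuadSpace F}
    (hv : polar v v = 0) (h0 : v ≠ ⟨0, 0, 0, 0, 0, 0, 0⟩) (ha1 : v.a1 = 0) (hb1 : v.b1 = 0)
    (ha2 : v.a2 = 0) (hb2 : v.b2 = 0) :
    ∃ n ∈ elementary F, n e1 = e1 ∧ n f1 = f1 ∧ n e2 = e2 ∧ n f2 = f2 ∧
      ∃ t ≠ 0, n v = e3 t := by
  have hn := norm_eq_of_polar_self_eq_zero h2 hv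
  rw [ha1, ha2, zero_mul, zero_mul, zero_add, zero_add] at hn
  by_cases ha3 : v.a3 = 0
  · have hz : v.z = 0 := by simpa [ha3] using hn.symm
    have hb3 : v.b3 ≠ 0 := fun hb3 => h0 (QuadSpace.ext ha1 ha2 ha3 hb1 hb2 hb3 hz)
    refine ⟨rot (rot (Q (-1) 0)) * rot (rot (P 1 0)), mul_mem ?_ ?_, ?_, ?_, ?_, ?_,
      v.b3, hb3, ?_⟩
    · exact rot_mem_elementary.2 (rot_mem_elementary.2 (Q_mem_elementary _ _))
    · exact rot_mem_elementary.2 (rot_mem_elementary.2 (P_mem_elementary _ _))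
    all_goals
      ext <;> simp only [Perm.mul_apply, Q_apply, P_apply, rot_apply, cyc_apply,
        cyc_inv_apply, ha1, hb1, ha2, hb2, ha3, hz, e1, f1, e2, f2, e3] <;> ring1
  · refine ⟨rot (rot (Q (-v.z / v.a3) 0)), ?_, ?_, ?_, ?_, ?_, v.a3, ha3, ?_⟩
    · exact rot_mem_elementary.2 (rot_mem_elementary.2 (Q_mem_elementary _ _))
    all_goals
      ext <;> simp only [Q_apply, rot_apply, cyc_apply,
        cyc_inv_apply, ha1, hb1, ha2, hb2, e1, f1, e2, f2, e3] <;> field_simp <;>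
        first | ring1 | linear_combination hn

theorem exists_elementary_eq_f3 (h2 : (2 : F) ≠ 0) {v : QuadSpace F}
    (hv : polar v v = 0) (ha1 : v.a1 = 0) (hb1 : v.b1 = 0)
    (ha2 : v.a2 = 0) (hb2 : v.b2 = 0) (hb3 : v.b3 ≠ 0) :
    ∃ n ∈ elementary F, n e1 = e1 ∧ n f1 = f1 ∧ n e2 = e2 ∧ n f2 = f2 ∧
      (∀ t, n (e3 t) = e3 t) ∧ n v = f3 v.b3 := by
  have hn := norm_eq_of_polar_self_eq_zero h2 hv
  rw [ha1, ha2, zero_mul, zero_mul, zero_add, zero_add] at hn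
  refine ⟨rot (rot (P (-v.z / v.b3) 0)), ?_, ?_, ?_, ?_, ?_, fun t => ?_, ?_⟩
  · exact rot_mem_elementary.2 (rot_mem_elementary.2 (P_mem_elementary _ _))
  all_goals
    ext <;> simp only [P_apply, rot_apply, cyc_apply,
      cyc_inv_apply, ha1, hb1, ha2, hb2, e1, f1, e2, f2, e3, f3] <;> field_simp <;>
      first | ring1 | linear_combination hn

end Elementary

section Decomposition

variable {F : Type} [Field F]

/-- The diagonal map scaling the third hyperbolic plane and the anisotropic line. -/
def dia (l e : Fˣ) : Perm (QuadSpace F) where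
  toFun v := ⟨v.a1, v.a2, l * v.a3, v.b1, v.b2, ↑l⁻¹ * v.b3, e * v.z⟩
  invFun v := ⟨v.a1, v.a2, ↑l⁻¹ * v.a3, v.b1, v.b2, l * v.b3, ↑e⁻¹ * v.z⟩
  left_inv v := by ext <;> simp
  right_inv v := by ext <;> simp

theorem dia_apply (l e : Fˣ) (v : QuadSpace F) :
    dia l e v = ⟨v.a1, v.a2, l * v.a3, v.b1, v.b2, ↑l⁻¹ * v.b3, e * v.z⟩ := rfl

theorem dia_mul_dia (l e l' e' : Fˣ) : dia l e * dia l' e' = dia (l * l') (e * e') := by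
  ext v <;> simp [dia_apply, mul_assoc, mul_left_comm]

theorem dia_one : dia (1 : Fˣ) 1 = 1 := by
  ext v <;> simp [dia_apply]

theorem dia_inv (l e : Fˣ) : (dia l e)⁻¹ = dia l⁻¹ e⁻¹ :=
  inv_eq_of_mul_eq_one_right (by rw [dia_mul_dia, mul_inv_cancel, mul_inv_cancel, dia_one])

theorem dia_conj_mem (h2 : (2 : F) ≠ 0) (l : Fˣ) {e : Fˣ} (he : e * e = 1)
    {g : Perm (QuadSpace F)} (hg : g ∈ elementary F) :
    dia l e * g * (dia l e)⁻¹ ∈ elementary F := by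
  have hinv : e⁻¹ = e := inv_eq_of_mul_eq_one_right he
  have he' : (e : F) * e = 1 := by simpa using congrArg Units.val he
  have hl := l.ne_zero
  suffices elementary F ≤ (elementary F).comap (MulAut.conj (dia l e)).toMonoidHom from this hg
  refine elementary_le ?_ (fun s t => ?_) fun s t => ?_
  · have : dia l e * cyc * (dia l e)⁻¹ = rot (rot (weyl (l : F) * weyl (-1))) * cyc := by
      rw [dia_inv]
      ext v <;> simp only [Perm.mul_apply, dia_apply, rot_apply, cyc_apply, cyc_inv_apply,
        weyl_apply hl, weyl_apply (neg_ne_zero.2 (one_ne_zero (α := F))), hinv,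
        Units.val_inv_eq_inv_val] <;> field_simp <;> linear_combination v.z * he'
    change dia l e * cyc * (dia l e)⁻¹ ∈ elementary F
    rw [this]
    exact mul_mem (rot_mem_elementary.2 (rot_mem_elementary.2
      (mul_mem (weyl_mem_elementary h2 _) (weyl_mem_elementary h2 _)))) cyc_mem_elementary
  · have : dia l e * P s t * (dia l e)⁻¹ = P (e * s) (↑l⁻¹ * t) := by
      rw [dia_inv]
      ext v <;> simp only [Perm.mul_apply, dia_apply, P_apply, hinv, inv_inv, Units.val_inv_eq_inv_val] <;>
        field_simp <;>
        first
        | ring1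
        | linear_combination (-v.b1 * s ^ 2) * he'
        | linear_combination v.z * he'
    change dia l e * P s t * (dia l e)⁻¹ ∈ elementary F
    exact this ▸ P_mem_elementary _ _
  · have : dia l e * Q s t * (dia l e)⁻¹ = Q (e * s) (l * t) := by
      rw [dia_inv]
      ext v <;> simp only [Perm.mul_apply, dia_apply, Q_apply, hinv, inv_inv, Units.val_inv_eq_inv_val] <;>
        field_simp <;>
        first
        | ring1
        | linear_combination (-v.a1 * s ^ 2) * he'
        | linear_combination v.z * he'
    change dia l e * Q s t * (dia l e)⁻¹ ∈ elementary F
    exact this ▸ Q_mem_elementary _ _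

theorem a2_eq_and_b2_eq {f : Perm (QuadSpace F)} (hf : f ∈ isometries F)
    (he : f e2 = e2) (hf2 : f f2 = f2) (v : QuadSpace F) :
    (f v).a2 = v.a2 ∧ (f v).b2 = v.b2 := by
  have h1 := hf v e2
  have h2 := hf v f2
  rw [he] at h1
  rw [hf2] at h2
  constructor
  · simpa [polar, f2] using h2
  · simpa [polar, e2] using h1

theorem eq_dia (h2 : (2 : F) ≠ 0) {f : Perm (QuadSpace F)} (hf : f ∈ isometries F)
    (he1 : f e1 = e1) (hf1 : f f1 = f1) (he2 : f e2 = e2) (hf2 : f f2 = f2) {t u : F}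
    (htu : t * u = 1) (he3 : f (e3 1) = e3 t) (hf3 : f (f3 1) = f3 u) :
    ∃ l e : Fˣ, e * e = 1 ∧ f = dia l e := by
  have ht : t ≠ 0 := left_ne_zero_of_mul_eq_one htu
  have hu : u ≠ 0 := right_ne_zero_of_mul_eq_one htu
  have hb3 (v : QuadSpace F) : (f v).b3 = u * v.b3 := by
    have h := hf v (e3 1)
    rw [he3] at h
    simp only [polar, e3, mul_zero, add_zero, zero_add, sub_zero, mul_one] at h
    linear_combination u * h - (f v).b3 * htu
  have ha3 (v : QuadSpace F) : (f v).a3 = t * v.a3 := by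
    have h := hf v (f3 1)
    rw [hf3] at h
    simp only [polar, f3, mul_zero, add_zero, zero_add, sub_zero, mul_one] at h
    linear_combination t * h - (f v).a3 * htu
  have h12 (v : QuadSpace F) := a1_eq_and_b1_eq hf he1 hf1 (v := v)
  have h22 (v : QuadSpace F) := a2_eq_and_b2_eq hf he2 hf2 v
  have hz (v w : QuadSpace F) : (f v).z * (f w).z = v.z * w.z := by
    have h := hf v w
    simp only [polar, hb3, ha3, h12, h22] at h
    have : 2 * ((f v).z * (f w).z - v.z * w.z) = 0 := by
      linear_combination (v.a3 * w.b3 + v.b3 * w.a3) * htu - h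
    exact sub_eq_zero.1 ((mul_eq_zero.1 this).resolve_left h2)
  obtain ⟨e, hedef⟩ : ∃ e, e = (f ⟨0, 0, 0, 0, 0, 0, 1⟩).z := ⟨_, rfl⟩
  have he : e * e = 1 := by rw [hedef, hz]; simp
  refine ⟨⟨t, u, htu, mul_comm t u ▸ htu⟩, ⟨e, e, he, he⟩, Units.ext he, ?_⟩
  ext v
  · exact (h12 v).1
  · exact (h22 v).1
  · exact ha3 v
  · exact (h12 v).2
  · exact (h22 v).2
  · exact hb3 v
  · have := hz v ⟨0, 0, 0, 0, 0, 0, 1⟩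
    rw [← hedef] at this
    change (f v).z = e * v.z
    linear_combination e * this - (f v).z * he

theorem ne_zero_of_polar_ne_zero {v w : QuadSpace F} (h : polar v w ≠ 0) :
    v ≠ ⟨0, 0, 0, 0, 0, 0, 0⟩ := by
  rintro rfl
  simp [polar] at h

theorem exists_elementary_mul_eq_dia (h2 : (2 : F) ≠ 0) {f : Perm (QuadSpace F)}
    (hf : f ∈ isometries F) :
    ∃ n ∈ elementary F, ∃ l e : Fˣ, e * e = 1 ∧ n * f = dia l e := by
  have hi {n : Perm (QuadSpace F)} (hn : n ∈ elementary F) := elementary_le_isometries hn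
  obtain ⟨n₁, hn₁, h₁⟩ := exists_elementary_eq_e1 h2 (v := f e1)
    (by rw [hf]; simp [polar, e1])
    (ne_zero_of_polar_ne_zero (w := f f1) (by rw [hf]; simp [polar, e1, f1]))
  have g₁ := mul_mem (hi hn₁) hf
  obtain ⟨n₂, hn₂, h₂e, h₂⟩ := exists_elementary_eq_f1 h2 (v := (n₁ * f) f1)
    (by rw [g₁]; simp [polar, f1])
    (by have := g₁ e1 f1; rw [Perm.mul_apply _ _ e1, h₁] at this; simpa [polar, e1, f1] using this)
  have g₂ := mul_mem (hi hn₂) g₁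
  have he1 : (n₂ * (n₁ * f)) e1 = e1 := by rw [Perm.mul_apply, Perm.mul_apply, h₁, h₂e]
  have hf1 : (n₂ * (n₁ * f)) f1 = f1 := h₂
  generalize hk₂ : n₂ * (n₁ * f) = k₂ at *
  have hd₂ (v : QuadSpace F) := a1_eq_and_b1_eq g₂ he1 hf1 (v := v)
  obtain ⟨n₃, hn₃, h₃e, h₃f, h₃⟩ := exists_elementary_eq_e2 h2 (v := k₂ e2)
    (by rw [g₂]; simp [polar, e2])
    (ne_zero_of_polar_ne_zero (w := k₂ f2) (by rw [g₂]; simp [polar, e2, f2]))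
    (hd₂ _).1 (hd₂ _).2
  have g₃ := mul_mem (hi hn₃) g₂
  replace he1 : (n₃ * k₂) e1 = e1 := by rw [Perm.mul_apply, he1, h₃e]
  replace hf1 : (n₃ * k₂) f1 = f1 := by rw [Perm.mul_apply, hf1, h₃f]
  have he2 : (n₃ * k₂) e2 = e2 := h₃
  generalize hk₃ : n₃ * k₂ = k₃ at *
  have hd₃ (v : QuadSpace F) := a1_eq_and_b1_eq g₃ he1 hf1 (v := v)
  obtain ⟨n₄, hn₄, h₄e, h₄f, h₄e2, h₄⟩ := exists_elementary_eq_f2 h2 (v := k₃ f2)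
    (by rw [g₃]; simp [polar, f2]) (hd₃ _).1 (hd₃ _).2
    (by have := g₃ e2 f2; rw [he2] at this; simpa [polar, e2, f2] using this)
  have g₄ := mul_mem (hi hn₄) g₃
  replace he1 : (n₄ * k₃) e1 = e1 := by rw [Perm.mul_apply, he1, h₄e]
  replace hf1 : (n₄ * k₃) f1 = f1 := by rw [Perm.mul_apply, hf1, h₄f]
  replace he2 : (n₄ * k₃) e2 = e2 := by rw [Perm.mul_apply, he2, h₄e2]
  have hf2 : (n₄ * k₃) f2 = f2 := h₄
  generalize hk₄ : n₄ * k₃ = k₄ at *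
  have hd₄ (v : QuadSpace F) := a1_eq_and_b1_eq g₄ he1 hf1 (v := v)
  have hd₄' (v : QuadSpace F) := a2_eq_and_b2_eq g₄ he2 hf2 v
  obtain ⟨n₅, hn₅, h₅e, h₅f, h₅e2, h₅f2, t, ht, h₅⟩ := exists_elementary_eq_e3 h2
    (v := k₄ (e3 1)) (by rw [g₄]; simp [polar, e3])
    (ne_zero_of_polar_ne_zero (w := k₄ (f3 1)) (by rw [g₄]; simp [polar, e3, f3]))
    (hd₄ _).1 (hd₄ _).2 (hd₄' _).1 (hd₄' _).2
  have g₅ := mul_mem (hi hn₅) g₄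
  replace he1 : (n₅ * k₄) e1 = e1 := by rw [Perm.mul_apply, he1, h₅e]
  replace hf1 : (n₅ * k₄) f1 = f1 := by rw [Perm.mul_apply, hf1, h₅f]
  replace he2 : (n₅ * k₄) e2 = e2 := by rw [Perm.mul_apply, he2, h₅e2]
  replace hf2 : (n₅ * k₄) f2 = f2 := by rw [Perm.mul_apply, hf2, h₅f2]
  have he3 : (n₅ * k₄) (e3 1) = e3 t := h₅
  generalize hk₅ : n₅ * k₄ = k₅ at *
  have hd₅ (v : QuadSpace F) := a1_eq_and_b1_eq g₅ he1 hf1 (v := v)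
  have hd₅' (v : QuadSpace F) := a2_eq_and_b2_eq g₅ he2 hf2 v
  have htu : t * (k₅ (f3 1)).b3 = 1 := by
    have := g₅ (e3 1) (f3 1)
    rw [he3] at this
    simpa [polar, e3, f3] using this
  obtain ⟨n₆, hn₆, h₆e, h₆f, h₆e2, h₆f2, h₆e3, h₆⟩ := exists_elementary_eq_f3 h2
    (v := k₅ (f3 1)) (by rw [g₅]; simp [polar, f3])
    (hd₅ _).1 (hd₅ _).2 (hd₅' _).1 (hd₅' _).2 (right_ne_zero_of_mul_eq_one htu)
  obtain ⟨l, e, he, h⟩ := eq_dia h2 (f := n₆ * k₅) (mul_mem (hi hn₆) g₅)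
    (by rw [Perm.mul_apply, he1, h₆e]) (by rw [Perm.mul_apply, hf1, h₆f])
    (by rw [Perm.mul_apply, he2, h₆e2]) (by rw [Perm.mul_apply, hf2, h₆f2]) htu
    (by rw [Perm.mul_apply, he3, h₆e3]) h₆
  refine ⟨n₆ * n₅ * n₄ * n₃ * n₂ * n₁, mul_mem (mul_mem (mul_mem (mul_mem (mul_mem hn₆ hn₅)
    hn₄) hn₃) hn₂) hn₁, l, e, he, ?_⟩
  rw [← h, ← hk₅, ← hk₄, ← hk₃, ← hk₂]
  simp only [mul_assoc]

end Decomposition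

section Swap

variable {F : Type}

/-- The exchange of the second and third hyperbolic planes. -/
def swap23 : Perm (QuadSpace F) where
  toFun v := ⟨v.a1, v.a3, v.a2, v.b1, v.b3, v.b2, v.z⟩
  invFun v := ⟨v.a1, v.a3, v.a2, v.b1, v.b3, v.b2, v.z⟩
  left_inv _ := rfl
  right_inv _ := rfl

theorem swap23_apply (v : QuadSpace F) :
    swap23 v = ⟨v.a1, v.a3, v.a2, v.b1, v.b3, v.b2, v.z⟩ := rfl

theorem swap23_inv_apply (v : QuadSpace F) :
    swap23⁻¹ v = ⟨v.a1, v.a3, v.a2, v.b1, v.b3, v.b2, v.z⟩ := rfl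

end Swap

section Derived

variable {F : Type} [Field F]

theorem commutator_isometries_le_elementary (h2 : (2 : F) ≠ 0) :
    ⁅isometries F, isometries F⁆ ≤ elementary F := by
  rw [Subgroup.commutator_le]
  intro f hf g hg
  obtain ⟨m, hm, l, e, he, h⟩ := exists_elementary_mul_eq_dia h2 hf
  obtain ⟨n, hn, k, i, hi, h'⟩ := exists_elementary_mul_eq_dia h2 hg
  have hcomm : dia l e * dia k i = dia k i * dia l e := by
    rw [dia_mul_dia, dia_mul_dia, mul_comm l, mul_comm e]
  have key := mul_mem (mul_mem (inv_mem hm) (dia_conj_mem h2 l he (inv_mem hn)))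
    (mul_mem (dia_conj_mem h2 k hi hm) hn)
  convert key using 1
  rw [← eq_inv_mul_iff_mul_eq] at h h'
  have hcomm' : (dia l e)⁻¹ * dia k i = dia k i * (dia l e)⁻¹ := by
    rw [inv_mul_eq_iff_eq_mul, ← mul_assoc, hcomm, mul_inv_cancel_right]
  calc ⁅f, g⁆ = m⁻¹ * dia l e * n⁻¹ * (dia k i * (dia l e)⁻¹) * m * (dia k i)⁻¹ * n := by
        rw [commutatorElement_def, h, h']; group
    _ = _ := by rw [← hcomm']; group

/-- The negation of the second hyperbolic plane. -/
def neg2 : Perm (QuadSpace F) where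
  toFun v := ⟨v.a1, -v.a2, v.a3, v.b1, -v.b2, v.b3, v.z⟩
  invFun v := ⟨v.a1, -v.a2, v.a3, v.b1, -v.b2, v.b3, v.z⟩
  left_inv v := by simp
  right_inv v := by simp

theorem neg2_apply (v : QuadSpace F) :
    neg2 v = ⟨v.a1, -v.a2, v.a3, v.b1, -v.b2, v.b3, v.z⟩ := rfl

theorem neg2_inv_apply (v : QuadSpace F) :
    neg2⁻¹ v = ⟨v.a1, -v.a2, v.a3, v.b1, -v.b2, v.b3, v.z⟩ := rfl

theorem swap23_mem_isometries : (swap23 : Perm (QuadSpace F)) ∈ isometries F := fun v w => by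
  simp only [polar, swap23_apply]; ring

theorem neg2_mem_isometries : (neg2 : Perm (QuadSpace F)) ∈ isometries F := fun v w => by
  simp only [polar, neg2_apply]; ring

theorem rot_mem_isometries {g : Perm (QuadSpace F)} (hg : g ∈ isometries F) :
    rot g ∈ isometries F := rot_mem cyc_mem_isometries hg

theorem cyc_mem_commutator :
    (cyc : Perm (QuadSpace F)) ∈ ⁅isometries F, isometries F⁆ := by
  have : (cyc : Perm (QuadSpace F)) = ⁅rot (swap23 : Perm (QuadSpace F)), swap23⁆ := by
    ext v <;> simp only [commutatorElement_def, Perm.mul_apply, rot_apply, rot_inv_apply,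
      cyc_apply, cyc_inv_apply, swap23_apply, swap23_inv_apply]
  exact this ▸ Subgroup.commutator_mem_commutator
    (rot_mem_isometries swap23_mem_isometries) swap23_mem_isometries

theorem D_mem_commutator : (D : Perm (QuadSpace F)) ∈ ⁅isometries F, isometries F⁆ := by
  have : (D : Perm (QuadSpace F)) = ⁅(swap23 : Perm (QuadSpace F)), neg2⁆ := by
    ext v <;> simp only [commutatorElement_def, Perm.mul_apply, D_apply, swap23_apply,
      swap23_inv_apply, neg2_apply, neg2_inv_apply]
  exact this ▸ Subgroup.commutator_mem_commutator swap23_mem_isometries neg2_mem_isometries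

theorem D_mem_isometries : (D : Perm (QuadSpace F)) ∈ isometries F := fun v w => by
  simp only [polar, D_apply]; ring

theorem inv_mem_commutator (h2 : (2 : F) ≠ 0) (b : F) :
    inv b ∈ ⁅isometries F, isometries F⁆ := by
  have hle : ⁅isometries F, isometries F⁆ ≤ isometries F :=
    (Subgroup.commutator_le).2 fun f hf g hg => commutator_mem hf hg
  have hQ : rot (Q 1 b) ∈ ⁅isometries F, isometries F⁆ := by
    have : rot (Q 1 b) = ⁅rot (Q (1 / 2) (b / 2)), D⁆ := by
      ext v <;> simp only [commutatorElement_def, rot_apply, rot_inv_apply, Perm.mul_apply,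
        Q_apply, Q_inv_apply, D_apply, D_inv_apply, cyc_apply, cyc_inv_apply] <;>
        field_simp <;> ring
    exact this ▸ Subgroup.commutator_mem_commutator
      (rot_mem_isometries (Q_mem_isometries _ _)) D_mem_isometries
  have hQD := mul_mem hQ D_mem_commutator
  have hP : rot (rot (P 1 (-3 / (2 * b)))) ∈ isometries F :=
    rot_mem_isometries (rot_mem_isometries (P_mem_isometries _ _))
  have := mul_mem (Subgroup.commutator_mem_commutator hP (hle hQD)) hQD
  convert this using 1
  rw [inv, commutatorElement_def]
  group

theorem orderOf_cyc : orderOf (cyc : Perm (QuadSpace F)) = 3 := by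
  have : Fact (Nat.Prime 3) := ⟨Nat.prime_three⟩
  refine orderOf_eq_prime rfl fun h => ?_
  have := congrArg QuadSpace.a1 (Equiv.congr_fun h e1)
  simp [cyc_apply, e1] at this

theorem orderOf_inv (h2 : (2 : F) ≠ 0) {b : F} (hb : b ≠ 0) : orderOf (inv b) = 2 := by
  refine orderOf_eq_prime (pow_two (inv b) ▸ inv_mul_inv b) fun h => h2 ?_
  have := congrArg QuadSpace.a2 (Equiv.congr_fun h e2)
  simp only [inv_apply h2 hb, e2, Perm.one_apply] at this
  linear_combination -this

/-- The derived group of the isometry group is generated by `inv b` and `cyc`, for suitable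
values of the parameter `b`. -/
theorem commutator_isometries_le_closure [Fintype F] (h2 : (2 : F) ≠ 0) {b : F} (hb : b ≠ 0)
    (hb' : 7 * b / 2 + 15 + 42 / b ≠ 0) (hK : ∀ K : Subring F, b ∈ K → K = ⊤) :
    ⁅isometries F, isometries F⁆ ≤ Subgroup.closure {inv b, cyc} := by
  have hc : cyc ∈ Subgroup.closure {inv b, cyc} := Subgroup.subset_closure (.inr rfl)
  obtain ⟨hP, hQ⟩ := root_mem_of_inv_mem h2 hb hb' hK hc (Subgroup.subset_closure (.inl rfl))
  exact (commutator_isometries_le_elementary h2).trans (elementary_le hc hP hQ)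

end Derived

section Transfer

open Matrix

variable {F : Type} [Field F]

/-- The coordinates identifying the sum of seven squares with the split quadratic form. -/
def coordinates (h2 : (2 : F) ≠ 0) {s t : F} (hst : s ^ 2 + t ^ 2 = -1) :
    (Fin 7 → F) ≃ QuadSpace F where
  toFun v := ⟨v 0 + (s * v 2 + t * v 3), v 1 + (t * v 2 - s * v 3), v 4 + (s * v 5 + t * v 6),
    v 0 - (s * v 2 + t * v 3), v 1 - (t * v 2 - s * v 3), v 4 - (s * v 5 + t * v 6),
    t * v 5 - s * v 6⟩
  invFun w := ![(w.a1 + w.b1) / 2, (w.a2 + w.b2) / 2,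
    -(s * (w.a1 - w.b1) + t * (w.a2 - w.b2)) / 2, -(t * (w.a1 - w.b1) - s * (w.a2 - w.b2)) / 2,
    (w.a3 + w.b3) / 2, -(s * (w.a3 - w.b3) / 2 + t * w.z), -(t * (w.a3 - w.b3) / 2 - s * w.z)]
  left_inv v := by
    ext i
    fin_cases i <;> simp <;> field_simp
    · ring
    · ring
    · linear_combination (-2 * v 2) * hst
    · linear_combination (-2 * v 3) * hst
    · ring
    · linear_combination (-2 * v 5) * hst
    · linear_combination (-2 * v 6) * hst
  right_inv w := by
    ext <;> simp <;> field_simp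
    · linear_combination (-(w.a1 - w.b1)) * hst
    · linear_combination (-(w.a2 - w.b2)) * hst
    · linear_combination (-(w.a3 - w.b3)) * hst
    · linear_combination (w.a1 - w.b1) * hst
    · linear_combination (w.a2 - w.b2) * hst
    · linear_combination (w.a3 - w.b3) * hst
    · linear_combination (-2 * w.z) * hst

theorem polar_coordinates (h2 : (2 : F) ≠ 0) {s t : F} (hst : s ^ 2 + t ^ 2 = -1)
    (v w : Fin 7 → F) : polar (coordinates h2 hst v) (coordinates h2 hst w) = 2 * (v ⬝ᵥ w) := by
  simp only [polar, coordinates, Equiv.coe_fn_mk, dotProduct, Fin.sum_univ_seven]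
  linear_combination
    (-2 * (v 2 * w 2 + v 3 * w 3 + v 5 * w 5 + v 6 * w 6)) * hst

/-- The action of the orthogonal group on column vectors. -/
def mulVecHom {n : Type*} [Fintype n] [DecidableEq n] :
    orthogonalGroup n F →* Perm (n → F) where
  toFun g :=
    { toFun v := (g : Matrix n n F) *ᵥ v
      invFun v := ((g⁻¹ : orthogonalGroup n F) : Matrix n n F) *ᵥ v
      left_inv v := by
        simp only [mulVec_mulVec, ← Submonoid.coe_mul]
        simp
      right_inv v := by
        simp only [mulVec_mulVec, ← Submonoid.coe_mul]
        simp }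
  map_one' := by ext; simp
  map_mul' g h := by ext; simp

theorem mulVecHom_apply {n : Type*} [Fintype n] [DecidableEq n] (g : orthogonalGroup n F)
    (v : n → F) : mulVecHom g v = (g : Matrix n n F) *ᵥ v := rfl

theorem mulVecHom_injective {n : Type*} [Fintype n] [DecidableEq n] :
    Function.Injective (mulVecHom (F := F) (n := n)) := fun g h hgh => by
  refine Subtype.ext (Matrix.ext_of_mulVec_single fun i => ?_)
  exact Equiv.congr_fun hgh _

theorem mem_range_mulVecHom {n : Type*} [Fintype n] [DecidableEq n] {f : Perm (n → F)} :
    f ∈ (mulVecHom (F := F) (n := n)).range ↔ ∀ v w, f v ⬝ᵥ f w = v ⬝ᵥ w := by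
  constructor
  · rintro ⟨g, rfl⟩ v w
    have hg : (g : Matrix n n F)ᵀ * (g : Matrix n n F) = 1 :=
      (mem_orthogonalGroup_iff' n F).1 g.2
    rw [mulVecHom_apply, mulVecHom_apply, dotProduct_mulVec, ← mulVec_transpose,
      mulVec_mulVec, hg, one_mulVec]
  · intro hf
    let M : Matrix n n F := Matrix.of fun i j => f (Pi.single j 1) i
    have hM (v : n → F) : Mᵀ *ᵥ f v = v := by
      ext i
      have := hf (Pi.single i 1) v
      rwa [single_one_dotProduct] at this
    have hMM : Mᵀ * M = 1 := by
      refine Matrix.ext_of_mulVec_single fun i => ?_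
      have : M *ᵥ Pi.single i 1 = f (Pi.single i 1) := by
        ext j; simp [M]
      rw [← mulVec_mulVec, this, hM, one_mulVec]
    refine ⟨⟨M, (mem_orthogonalGroup_iff' n F).2 hMM⟩, ?_⟩
    ext1 v
    rw [mulVecHom_apply]
    change M *ᵥ v = f v
    conv_lhs => rw [← hM v]
    rw [mulVec_mulVec, mul_eq_one_comm.1 hMM, one_mulVec]

/-- The action of the orthogonal group in the coordinates of the split quadratic form. -/
def coordinateHom (h2 : (2 : F) ≠ 0) {s t : F} (hst : s ^ 2 + t ^ 2 = -1) :
    orthogonalGroup (Fin 7) F →* Perm (QuadSpace F) :=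
  (coordinates h2 hst).permCongrHom.toMonoidHom.comp mulVecHom

theorem coordinateHom_injective (h2 : (2 : F) ≠ 0) {s t : F} (hst : s ^ 2 + t ^ 2 = -1) :
    Function.Injective (coordinateHom h2 hst) :=
  (coordinates h2 hst).permCongrHom.injective.comp mulVecHom_injective

theorem range_coordinateHom (h2 : (2 : F) ≠ 0) {s t : F} (hst : s ^ 2 + t ^ 2 = -1) :
    (coordinateHom h2 hst).range = isometries F := by
  ext f
  constructor
  · rintro ⟨g, rfl⟩ v w
    obtain ⟨v, rfl⟩ := (coordinates h2 hst).surjective v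
    obtain ⟨w, rfl⟩ := (coordinates h2 hst).surjective w
    have (u : Fin 7 → F) : coordinateHom h2 hst g (coordinates h2 hst u) =
        coordinates h2 hst (mulVecHom g u) := by
      change coordinates h2 hst (mulVecHom g ((coordinates h2 hst).symm _)) = _
      rw [Equiv.symm_apply_apply]
    rw [this, this, polar_coordinates, polar_coordinates, mem_range_mulVecHom.1 ⟨g, rfl⟩]
  · intro hf
    obtain ⟨k, rfl⟩ := (coordinates h2 hst).permCongrHom.surjective f
    obtain ⟨g, rfl⟩ := (mem_range_mulVecHom (f := k)).2 fun v w => by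
      have := hf (coordinates h2 hst v) (coordinates h2 hst w)
      change polar (coordinates h2 hst (k ((coordinates h2 hst).symm _)))
        (coordinates h2 hst (k ((coordinates h2 hst).symm _))) = _ at this
      rw [Equiv.symm_apply_apply, Equiv.symm_apply_apply, polar_coordinates,
        polar_coordinates] at this
      exact mul_left_cancel₀ h2 this
    exact ⟨g, rfl⟩

theorem map_commutator_coordinateHom (h2 : (2 : F) ≠ 0) {s t : F} (hst : s ^ 2 + t ^ 2 = -1) :
    (commutator (orthogonalGroup (Fin 7) F)).map (coordinateHom h2 hst) =
      ⁅isometries F, isometries F⁆ := by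
  rw [commutator_def, Subgroup.map_commutator, ← MonoidHom.range_eq_map, range_coordinateHom]

theorem exists_sq_add_sq_eq_neg_one [Fintype F] (h : Fintype.card F % 2 = 1) :
    ∃ s t : F, s ^ 2 + t ^ 2 = -1 := by
  obtain ⟨s, t, hst⟩ := FiniteField.exists_root_sum_quadratic
    (f := (Polynomial.X ^ 2 : Polynomial F)) (g := Polynomial.X ^ 2 + Polynomial.C 1)
    (Polynomial.degree_X_pow 2) (Polynomial.degree_X_pow_add_C two_pos 1) h
  refine ⟨s, t, ?_⟩
  simp only [Polynomial.eval_pow, Polynomial.eval_X, Polynomial.eval_add, Polynomial.eval_C]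
    at hst
  linear_combination hst

end Transfer

end QuadSpace

/-- **The $(2,3)$-generation of $\Omega_7(q)$, $q$ odd.** For every odd prime power `q`, the
group `Ω_7(q)`, realized as the commutator subgroup of the orthogonal group `O_7(q)` of
`7×7` matrices over `F_q` preserving the standard symmetric bilinear form, is generated by
an element of order `2` together with an element of order `3`. -/
theorem Omega7_is_two_three_generated (q : ℕ) (hq : IsPrimePow q) (hodd : Odd q)
    (F : Type) [Field F] [Fintype F] (hF : Fintype.card F = q) :
    ∃ g h : commutator (Matrix.orthogonalGroup (Fin 7) F),
      orderOf g = 2 ∧ orderOf h = 3 ∧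
        Subgroup.closure {g, h}
          = (⊤ : Subgroup (commutator (Matrix.orthogonalGroup (Fin 7) F))) := by
  have hcard : Fintype.card F % 2 = 1 := Nat.odd_iff.1 (hF ▸ hodd)
  have h2 : (2 : F) ≠ 0 := Ring.two_ne_zero fun h => by
    have := FiniteField.even_card_of_char_two h
    omega
  obtain ⟨s, t, hst⟩ := QuadSpace.exists_sq_add_sq_eq_neg_one hcard
  obtain ⟨b, hb, hb', hK⟩ := QuadSpace.exists_parameter h2
  have hinj : Function.Injective ((QuadSpace.coordinateHom h2 hst).comp
      (commutator (Matrix.orthogonalGroup (Fin 7) F)).subtype) :=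
    (QuadSpace.coordinateHom_injective h2 hst).comp Subtype.val_injective
  have hmap := QuadSpace.map_commutator_coordinateHom h2 hst
  have hi := QuadSpace.inv_mem_commutator h2 b
  have hc := QuadSpace.cyc_mem_commutator (F := F)
  rw [← hmap] at hi hc
  obtain ⟨g, hg, hgi⟩ := hi
  obtain ⟨h, hh, hhc⟩ := hc
  refine ⟨⟨g, hg⟩, ⟨h, hh⟩, ?_, ?_, ?_⟩
  · rw [← QuadSpace.orderOf_inv h2 hb, ← hgi]
    exact (orderOf_injective _ hinj ⟨g, hg⟩).symm
  · rw [← QuadSpace.orderOf_cyc (F := F), ← hhc]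
    exact (orderOf_injective _ hinj ⟨h, hh⟩).symm
  · rw [eq_top_iff]
    intro k _
    rw [← Subgroup.mem_map_iff_mem hinj, MonoidHom.map_closure, Set.image_pair]
    change QuadSpace.coordinateHom h2 hst k ∈ Subgroup.closure
      {QuadSpace.coordinateHom h2 hst g, QuadSpace.coordinateHom h2 hst h}
    rw [hgi, hhc]
    refine QuadSpace.commutator_isometries_le_closure h2 hb hb' hK ?_
    rw [← hmap]
    exact Subgroup.mem_map_of_mem _ k.2
end
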